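/- In the parameter plane of the Hénon family there exist infinitely many pairwise disjoint nondegenerate real-analytic arcs, i.e., injective non-constant curves c : [0,1] → ℝ² that extend to real-analytic maps on an open interval containing [0,1], such that for every parameter (a,b) lying on any of these arcs the Hénon map F_{a,b} has a period doubling Cantor attractor. -/

import Mathlib

open Filter Set

/-- The Hénon family: `F_{a,b}(x,y) = (a + x² - b·y, x)`. -/
def henon (a b : ℝ) : ℝ × ℝ → ℝ × ℝ := fun p => (a + p.1 ^ 2 - b * p.2, p.1)

/-- `A` is a period doubling Cantor attractor of `f`. -/
def IsPDCantorAttractor (f : ℝ × ℝ → ℝ × ℝ) (A : Set (ℝ × ℝ)) : Prop :=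
  IsCompact A ∧ f '' A = A ∧
    (∃ e : A ≃ₜ ℤ_[2], ∀ (x : A) (hx : f ↑x ∈ A), e ⟨f ↑x, hx⟩ = e x + 1) ∧
    ∃ U : Set (ℝ × ℝ), IsOpen U ∧ A ⊆ U ∧
      ∀ᵐ x ∂MeasureTheory.volume, x ∈ U →
        (omegaLimit atTop (fun n : ℕ => f^[n]) {x} ∩ A).Nonempty

/-- `c` is a nondegenerate real-analytic arc: injective and non-constant on `[0,1]`, and
real-analytic on an open set containing `[0,1]`. -/
def IsAnalyticArc (c : ℝ → ℝ × ℝ) : Prop :=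
  (∃ U : Set ℝ, IsOpen U ∧ Icc (0 : ℝ) 1 ⊆ U ∧ AnalyticOnNhd ℝ c U) ∧
    InjOn c (Icc (0 : ℝ) 1) ∧
    ∃ s ∈ Icc (0 : ℝ) 1, ∃ t ∈ Icc (0 : ℝ) 1, c s ≠ c t

open Filter Set
namespace HN
def padd : List ℤ -> List ℤ -> List ℤ
  | [], b => b
  | x :: a, [] => x :: a
  | x :: a, y :: b => (x + y) :: padd a b
def pscale (c : ℤ) : List ℤ -> List ℤ
  | [] => []
  | x :: a => (c * x) :: pscale c a
def pmul : List ℤ -> List ℤ -> List ℤ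
  | [], _ => []
  | x :: a, b => padd (pscale x b) (0 :: pmul a b)
def l1 : List ℤ -> ℕ
  | [] => 0
  | x :: a => x.natAbs + l1 a
def pround : List ℤ -> List ℤ
  | [] => []
  | x :: a => (x / 1000000000000) :: pround a
def ptake : ℕ -> List ℤ -> List ℤ
  | 0, _ => []
  | _ + 1, [] => []
  | n + 1, x :: a => x :: ptake n a
def pdrop : ℕ -> List ℤ -> List ℤ
  | 0, a => a
  | _ + 1, [] => []
  | n + 1, _ :: a => pdrop n a
structure TM where
  c : List ℤ
  d : List (List ℤ)
  e : ℕ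
def dadd : List (List ℤ) -> List (List ℤ) -> List (List ℤ)
  | [], b => b
  | x :: a, [] => x :: a
  | x :: a, y :: b => padd x y :: dadd a b
def dscale (p : List ℤ) : List (List ℤ) -> List (List ℤ)
  | [] => []
  | x :: a => pmul p x :: dscale p a
def dl1 : List (List ℤ) -> ℕ
  | [] => 0
  | x :: a => l1 x + dl1 a
def dround : List (List ℤ) -> List (List ℤ)
  | [] => []
  | x :: a => ptake 13 (pround x) :: dround a
def rerr (x : List ℤ) : ℕ := x.length + l1 (pdrop 13 (pround x))
def drerr : List (List ℤ) -> ℕ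
  | [] => 0
  | x :: a => rerr x + drerr a
namespace TM
def nrm (A : TM) : ℕ := l1 A.c + dl1 A.d + A.e
def add (A B : TM) : TM := ⟨padd A.c B.c, dadd A.d B.d, A.e + B.e⟩
def mul (A B : TM) : TM :=
  let pc := pmul A.c B.c
  let pd := dadd (dscale A.c B.d) (dscale B.c A.d)
  ⟨ptake 13 (pround pc), dround pd,
    rerr pc + drerr pd + ((A.e * B.nrm + B.e * A.nrm + dl1 A.d * dl1 B.d) / 1000000000000 + 1)⟩
def con (x : ℤ) : TM := ⟨[x], [], 0⟩
end TM
def evalP (τ : ℂ) : List ℤ -> ℂ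
  | [] => 0
  | x :: a => (x : ℂ) + τ * evalP τ a
def evalD (τ : ℂ) (δ : ℕ -> ℂ) : List (List ℤ) -> ℕ -> ℂ
  | [], _ => 0
  | p :: a, i => δ i * evalP τ p + evalD τ δ a (i + 1)
def Rep (τ : ℂ) (δ : ℕ -> ℂ) (T : TM) (v : ℂ) : Prop :=
  ‖1000000000000 * v - (evalP τ T.c + evalD τ δ T.d 0)‖ <= (T.e : ℝ)
section
variable {τ : ℂ} {δ : ℕ -> ℂ}
lemma evalP_padd (a b : List ℤ) : evalP τ (padd a b) = evalP τ a + evalP τ b := by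
  induction a generalizing b with
  | nil => simp [padd, evalP]
  | cons x a ih =>
    cases b with
    | nil => simp [padd, evalP]
    | cons y b => simp only [padd, evalP, ih]; push_cast; ring
lemma evalP_pscale (c : ℤ) (a : List ℤ) : evalP τ (pscale c a) = c * evalP τ a := by
  induction a with
  | nil => simp [pscale, evalP]
  | cons x a ih => simp only [pscale, evalP, ih]; push_cast; ring
lemma evalP_pmul (a b : List ℤ) : evalP τ (pmul a b) = evalP τ a * evalP τ b := by
  induction a with
  | nil => simp [pmul, evalP]
  | cons x a ih =>
    simp only [pmul, evalP, ih, evalP_padd, evalP_pscale]; push_cast; ring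
lemma norm_evalP (hτ : ‖τ‖ <= 1) (a : List ℤ) : ‖evalP τ a‖ <= (l1 a : ℝ) := by
  induction a with
  | nil => simp [evalP, l1]
  | cons x a ih =>
    simp only [evalP, l1]
    refine (norm_add_le _ _).trans ?_
    push_cast
    have h1 : ‖(x : ℂ)‖ <= (x.natAbs : ℝ) := by
      rw [Complex.norm_intCast, Nat.cast_natAbs, Int.cast_abs]
    have h2 : ‖τ * evalP τ a‖ <= (l1 a : ℝ) := by
      rw [norm_mul]
      calc _ <= 1 * (l1 a : ℝ) := by gcongr
        _ = _ := one_mul _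
    have h3 : ((x.natAbs : ℕ) : ℝ) = |(x : ℝ)| := by rw [Nat.cast_natAbs, Int.cast_abs]
    rw [h3] at h1
    linarith
lemma evalP_take_drop (n : ℕ) (a : List ℤ) :
    evalP τ a = evalP τ (ptake n a) + τ ^ n * evalP τ (pdrop n a) := by
  induction n generalizing a with
  | zero => simp [ptake, pdrop, evalP]
  | succ n ih =>
    cases a with
    | nil => simp [ptake, pdrop, evalP]
    | cons x a => simp only [ptake, pdrop, evalP]; rw [ih a]; ring
lemma norm_pround (hτ : ‖τ‖ <= 1) (a : List ℤ) :
    ‖evalP τ a - 1000000000000 * evalP τ (pround a)‖ <= 1000000000000 * (a.length : ℝ) := by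
  induction a with
  | nil => simp [evalP, pround]
  | cons x a ih =>
    simp only [evalP, pround, List.length_cons]
    have e : (x : ℂ) + τ * evalP τ a - 1000000000000 * (((x / 1000000000000 : ℤ) : ℂ) + τ * evalP τ (pround a))
      = ((x % 1000000000000 : ℤ) : ℂ) + τ * (evalP τ a - 1000000000000 * evalP τ (pround a)) := by
      have := Int.emod_add_mul_ediv x 1000000000000
      have h : (x : ℂ) = ((x % 1000000000000 : ℤ) : ℂ) + 1000000000000 * ((x / 1000000000000 : ℤ) : ℂ) := by
        exact_mod_cast this.symm
      rw [h]
      have h2 : (((x % 1000000000000 : ℤ) : ℂ) + 1000000000000 * ((x / 1000000000000 : ℤ) : ℂ)) = x := h.symm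
      ring_nf
    rw [e]
    refine (norm_add_le _ _).trans ?_
    have h1 : ‖((x % 1000000000000 : ℤ) : ℂ)‖ <= 1000000000000 := by
      rw [Complex.norm_intCast]
      have a1 := Int.emod_nonneg x (b := 1000000000000) (by norm_num)
      have a2 := Int.emod_lt_of_pos x (b := 1000000000000) (by norm_num)
      rw [abs_of_nonneg (by exact_mod_cast a1)]
      exact_mod_cast a2.le
    have h2 : ‖τ * (evalP τ a - 1000000000000 * evalP τ (pround a))‖ <= 1000000000000 * (a.length : ℝ) := by
      rw [norm_mul]
      calc _ <= 1 * (1000000000000 * (a.length : ℝ)) := by gcongr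
        _ = _ := one_mul _
    push_cast
    linarith
lemma norm_round (hτ : ‖τ‖ <= 1) (a : List ℤ) :
    ‖evalP τ a - 1000000000000 * evalP τ (ptake 13 (pround a))‖ <= 1000000000000 * (rerr a : ℝ) := by
  have h1 := norm_pround hτ a
  have h2 := evalP_take_drop (τ := τ) 13 (pround a)
  have h3 : ‖τ ^ 13 * evalP τ (pdrop 13 (pround a))‖ <= (l1 (pdrop 13 (pround a)) : ℝ) := by
    rw [norm_mul, norm_pow]
    calc _ <= 1 * (l1 (pdrop 13 (pround a)) : ℝ) := by
          gcongr
          · exact pow_le_one₀ (norm_nonneg _) hτ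
          · exact norm_evalP hτ _
      _ = _ := one_mul _
  have e : evalP τ a - 1000000000000 * evalP τ (ptake 13 (pround a))
    = (evalP τ a - 1000000000000 * evalP τ (pround a)) + 1000000000000 * (τ ^ 13 * evalP τ (pdrop 13 (pround a))) := by
    rw [h2]; ring
  rw [e]
  refine (norm_add_le _ _).trans ?_
  rw [norm_mul]
  simp only [rerr]; push_cast
  have : ‖(1000000000000 : ℂ)‖ = 1000000000000 := by simp
  rw [this]; linarith
lemma evalD_dadd (a b : List (List ℤ)) (i : ℕ) :
    evalD τ δ (dadd a b) i = evalD τ δ a i + evalD τ δ b i := by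
  induction a generalizing b i with
  | nil => simp [dadd, evalD]
  | cons x a ih =>
    cases b with
    | nil => simp [dadd, evalD]
    | cons y b => simp only [dadd, evalD, ih, evalP_padd]; ring
lemma evalD_dscale (p : List ℤ) (a : List (List ℤ)) (i : ℕ) :
    evalD τ δ (dscale p a) i = evalP τ p * evalD τ δ a i := by
  induction a generalizing i with
  | nil => simp [dscale, evalD]
  | cons x a ih => simp only [dscale, evalD, ih, evalP_pmul]; ring
lemma norm_evalD (hτ : ‖τ‖ <= 1) (hδ : ∀ i, ‖δ i‖ <= 1) (a : List (List ℤ)) (i : ℕ) :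
    ‖evalD τ δ a i‖ <= (dl1 a : ℝ) := by
  induction a generalizing i with
  | nil => simp [evalD, dl1]
  | cons x a ih =>
    simp only [evalD, dl1]; push_cast
    refine (norm_add_le _ _).trans (add_le_add ?_ (ih _))
    rw [norm_mul]
    calc _ <= 1 * (l1 x : ℝ) := by
          gcongr
          · exact hδ i
          · exact norm_evalP hτ _
      _ = _ := one_mul _
lemma norm_dround (hτ : ‖τ‖ <= 1) (hδ : ∀ i, ‖δ i‖ <= 1) (a : List (List ℤ)) (i : ℕ) :
    ‖evalD τ δ a i - 1000000000000 * evalD τ δ (dround a) i‖ <= 1000000000000 * (drerr a : ℝ) := by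
  induction a generalizing i with
  | nil => simp [evalD, dround]
  | cons x a ih =>
    simp only [evalD, dround, drerr]; push_cast
    have e : δ i * evalP τ x + evalD τ δ a (i + 1) -
        1000000000000 * (δ i * evalP τ (ptake 13 (pround x)) + evalD τ δ (dround a) (i + 1))
      = δ i * (evalP τ x - 1000000000000 * evalP τ (ptake 13 (pround x))) +
        (evalD τ δ a (i + 1) - 1000000000000 * evalD τ δ (dround a) (i + 1)) := by ring
    rw [e, mul_add]
    refine (norm_add_le _ _).trans (add_le_add ?_ (ih _))
    rw [norm_mul]
    calc _ <= 1 * (1000000000000 * (rerr x : ℝ)) := by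
          gcongr
          · exact hδ i
          · exact norm_round hτ _
      _ = _ := one_mul _
lemma Rep.add {A B : TM} {u v : ℂ} (hA : Rep τ δ A u) (hB : Rep τ δ B v) :
    Rep τ δ (A.add B) (u + v) := by
  unfold Rep at *
  simp only [TM.add, evalP_padd, evalD_dadd]
  push_cast
  refine le_trans (le_of_eq ?_) ((norm_add_le _ _).trans (add_le_add hA hB))
  congr 1; ring
lemma Rep.norm_le (hτ : ‖τ‖ <= 1) (hδ : ∀ i, ‖δ i‖ <= 1) {A : TM} {u : ℂ} (hA : Rep τ δ A u) :
    ‖1000000000000 * u‖ <= (A.nrm : ℝ) := by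
  unfold Rep at hA
  have h1 := norm_evalP hτ A.c
  have h2 := norm_evalD hτ hδ A.d 0
  have e : 1000000000000 * u = (1000000000000 * u - (evalP τ A.c + evalD τ δ A.d 0)) + (evalP τ A.c + evalD τ δ A.d 0) := by ring
  rw [e]
  have h3 := norm_add_le (1000000000000 * u - (evalP τ A.c + evalD τ δ A.d 0)) (evalP τ A.c + evalD τ δ A.d 0)
  have h4 := norm_add_le (evalP τ A.c) (evalD τ δ A.d 0)
  simp only [TM.nrm]; push_cast; linarith
lemma Rep.mul (hτ : ‖τ‖ <= 1) (hδ : ∀ i, ‖δ i‖ <= 1) {A B : TM} {u v : ℂ} (hA : Rep τ δ A u)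
    (hB : Rep τ δ B v) : Rep τ δ (A.mul B) (u * v) := by
  have nA := hA.norm_le hτ hδ
  have nB := hB.norm_le hτ hδ
  have dA := norm_evalD hτ hδ A.d 0
  have dB := norm_evalD hτ hδ B.d 0
  unfold Rep at *
  simp only [TM.mul]
  set pc := pmul A.c B.c with hpc
  set pd := dadd (dscale A.c B.d) (dscale B.c A.d) with hpd
  have r1 := norm_round hτ pc
  have r2 := norm_dround hτ hδ pd 0
  have ec : evalP τ pc = evalP τ A.c * evalP τ B.c := evalP_pmul _ _
  have ed : evalD τ δ pd 0 = evalP τ A.c * evalD τ δ B.d 0 + evalP τ B.c * evalD τ δ A.d 0 := by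
    rw [hpd, evalD_dadd, evalD_dscale, evalD_dscale]
  set a0 := evalP τ A.c
  set a1 := evalD τ δ A.d 0
  set b0 := evalP τ B.c
  set b1 := evalD τ δ B.d 0
  set P := evalP τ (ptake 13 (pround pc))
  set Q := evalD τ δ (dround pd) 0
  set N : ℕ := A.e * B.nrm + B.e * A.nrm + dl1 A.d * dl1 B.d with hN
  have hNq : (N : ℝ) <= 1000000000000 * ((N / 1000000000000 + 1 : ℕ) : ℝ) := by
    have := Nat.div_add_mod N 1000000000000
    have h2 := Nat.mod_lt N (y := 1000000000000) (by norm_num)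
    have h3 : N <= 1000000000000 * (N / 1000000000000 + 1) := by omega
    exact_mod_cast h3
  set ea := 1000000000000 * u - (a0 + a1)
  set eb := 1000000000000 * v - (b0 + b1)
  have key : 1000000000000 * (1000000000000 * (u * v) - (P + Q)) =
      (evalP τ pc - 1000000000000 * P) + (evalD τ δ pd 0 - 1000000000000 * Q)
       + (ea * (1000000000000 * v) + eb * (1000000000000 * u - ea) + a1 * b1) := by
    rw [ec, ed]; simp only [ea, eb]; ring
  have hea : ‖(1000000000000 * u - ea)‖ <= (A.nrm : ℝ) := by
    have : 1000000000000 * u - ea = a0 + a1 := by simp only [ea]; ring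
    rw [this]
    have h1 := norm_evalP hτ A.c
    have h4 := norm_add_le a0 a1
    have h5 : (0 : ℝ) <= A.e := Nat.cast_nonneg _
    simp only [TM.nrm]; push_cast; linarith
  have h3 : ‖ea * (1000000000000 * v) + eb * (1000000000000 * u - ea) + a1 * b1‖ <= (N : ℝ) := by
    refine (norm_add_le _ _).trans ?_
    rw [hN]; push_cast
    refine add_le_add ((norm_add_le _ _).trans (add_le_add ?_ ?_)) ?_
    · rw [norm_mul]; gcongr
    · rw [norm_mul]; gcongr
    · rw [norm_mul]; gcongr
  have h4 : ‖1000000000000 * (1000000000000 * (u * v) - (P + Q))‖ <=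
      1000000000000 * (rerr pc : ℝ) + 1000000000000 * (drerr pd : ℝ) + N := by
    rw [key]
    exact (norm_add_le _ _).trans (add_le_add ((norm_add_le _ _).trans (add_le_add r1 r2)) h3)
  rw [norm_mul] at h4
  have : ‖(1000000000000 : ℂ)‖ = 1000000000000 := by simp
  rw [this] at h4
  push_cast at hNq ⊢
  linarith
lemma Rep.con (x : ℤ) (v : ℂ) (h : 1000000000000 * v = x) : Rep τ δ (TM.con x) v := by
  unfold Rep; simp [TM.con, evalP, evalD, h]
end
def fN {α : Type} (n : ℕ) (k : ℕ -> α) : α :=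
  match n with
  | 0 => k 0
  | m + 1 => k (Nat.succ m)
def fI {α : Type} (x : ℤ) (k : ℤ -> α) : α :=
  match x with
  | Int.ofNat n => fN n fun m => k (Int.ofNat m)
  | Int.negSucc n => fN n fun m => k (Int.negSucc m)
def fL {α : Type} : List ℤ -> (List ℤ -> α) -> α
  | [], k => k []
  | x :: a, k => fI x fun y => fL a fun b => k (y :: b)
def fD {α : Type} : List (List ℤ) -> (List (List ℤ) -> α) -> α
  | [], k => k []
  | x :: a, k => fL x fun y => fD a fun b => k (y :: b)
lemma fN_eq {α : Type} (n : ℕ) (k : ℕ -> α) : fN n k = k n := by cases n <;> rfl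
lemma fI_eq {α : Type} (n : ℤ) (k : ℤ -> α) : fI n k = k n := by cases n <;> simp [fI, fN_eq]
lemma fL_eq {α : Type} (a : List ℤ) (k : List ℤ -> α) : fL a k = k a := by
  induction a generalizing k with
  | nil => rfl
  | cons x a ih => simp [fL, fI_eq, ih]
lemma fD_eq {α : Type} (a : List (List ℤ)) (k : List (List ℤ) -> α) : fD a k = k a := by
  induction a generalizing k with
  | nil => rfl
  | cons x a ih => simp [fD, fL_eq, ih]
namespace TM
def mulF {α : Type} (A B : TM) (k : TM -> α) : α :=
  fL (pmul A.c B.c) fun pc =>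
  fD (dadd (dscale A.c B.d) (dscale B.c A.d)) fun pd =>
  fL (ptake 13 (pround pc)) fun c =>
  fD (dround pd) fun d =>
  fN (rerr pc + drerr pd + ((A.e * B.nrm + B.e * A.nrm + dl1 A.d * dl1 B.d) / 1000000000000 + 1)) fun e =>
  k ⟨c, d, e⟩
lemma mulF_eq {α : Type} (A B : TM) (k : TM -> α) : mulF A B k = k (mul A B) := by
  simp only [mulF, fL_eq, fD_eq, fN_eq, mul]
def addF {α : Type} (A B : TM) (k : TM -> α) : α :=
  fL (padd A.c B.c) fun c => fD (dadd A.d B.d) fun d => fN (A.e + B.e) fun e => k ⟨c, d, e⟩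
lemma addF_eq {α : Type} (A B : TM) (k : TM -> α) : addF A B k = k (add A B) := by
  simp only [addF, fL_eq, fD_eq, fN_eq, add]
end TM
structure Box where
  a : ℤ
  η : ℕ
  l : List (ℤ × ℤ × ℕ)
  et : ℕ
def coefT (i : ℕ) (s : ℤ × ℤ × ℕ) : TM :=
  ⟨[s.1], [s.2.1] :: (List.replicate i [] ++ [[(s.2.2 : ℤ)]]), 0⟩
def sigF {α : Type} (et : ℕ) : List (ℤ × ℤ × ℕ) -> ℕ -> TM -> (TM -> α) -> α
  | [], _, _, k => k ⟨[], [], et⟩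
  | s :: l, i, w, k => sigF et l (i + 1) w fun r => TM.mulF w r fun p => TM.addF (coefT i s) p k
def sigT (et : ℕ) : List (ℤ × ℤ × ℕ) -> ℕ -> TM -> TM
  | [], _, _ => ⟨[], [], et⟩
  | s :: l, i, w => (coefT i s).add (w.mul (sigT et l (i + 1) w))
lemma sigF_eq {α : Type} (et : ℕ) (l : List (ℤ × ℤ × ℕ)) (i : ℕ) (w : TM) (k : TM -> α) :
    sigF et l i w k = k (sigT et l i w) := by
  induction l generalizing i k with
  | nil => rfl
  | cons s l ih => simp only [sigF, ih, TM.mulF_eq, TM.addF_eq, sigT]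
def tT : TM := ⟨[720000000000, 1400000000000], [], 0⟩
def iR : TM := ⟨[714285714286], [], 1⟩
def mm : TM := ⟨[-720000000000], [], 0⟩
def one : TM := ⟨[1000000000000], [], 0⟩
def mone : TM := ⟨[-1000000000000], [], 0⟩
structure StepR where
  lam : TM
  w1 : TM
  w2 : TM
  k : TM
def stepF {α : Type} (B : Box) (k : StepR -> α) : α :=
  let a0 : TM := ⟨[B.a], [[(B.η : ℤ)]], 0⟩
  TM.addF one a0 fun lam =>
  TM.mulF lam lam fun l2 =>
  TM.mulF l2 tT fun l2t =>
  TM.addF l2t mm fun x1 =>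
  TM.mulF x1 iR fun w1 =>
  sigF B.et B.l 0 w1 fun s1 =>
  TM.addF l2t mone fun l2tm =>
  TM.mulF l2tm s1 fun p1 =>
  TM.addF a0 p1 fun kap =>
  TM.mulF l2t kap fun al =>
  TM.addF one al fun oa =>
  TM.mulF oa oa fun Y =>
  TM.addF Y mm fun x2 =>
  TM.mulF x2 iR fun w2 =>
  sigF B.et B.l 0 w2 fun s2 =>
  TM.mulF Y s2 fun p2 =>
  TM.addF a0 p2 fun D =>
  TM.addF one oa fun ta =>
  TM.mulF kap ta fun q1 =>
  TM.mulF lam q1 fun q2 =>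
  TM.mulF q2 D fun r =>
  k ⟨lam, w1, w2, ⟨r.c, r.d, r.e + 1000⟩⟩
def sd : List ℤ -> List ℤ × ℤ
  | [] => ([], 0)
  | x :: a => match a with
    | [] => ([], x)
    | _ :: _ => match sd a with
      | (q, r) => fI r fun r => fI (r * 5 / 7) fun y => (y :: q, x + r / 5)
def resid (p q : List ℤ) (r : ℤ) : List ℤ :=
  padd (padd (pscale 25 p) [-25 * r]) (padd (pscale (-35) (0 :: q)) (pscale 7 q))
structure DivR where
  r : ℤ
  q : List ℤ
  e : ℕ
def divP (p : List ℤ) : DivR :=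
  match sd p with
  | (q, r) => fL q fun q => fI r fun r => fN (l1 (resid p q r)) fun e => ⟨r, q, e⟩
def divDF {α : Type} : List (List ℤ) -> (List DivR -> α) -> α
  | [], k => k []
  | p :: d, k => match divP p with
    | ⟨r, q, e⟩ => fL q fun q => fI r fun r => fN e fun e => divDF d fun l => k (⟨r, q, e⟩ :: l)
lemma divDF_eq {α : Type} (d : List (List ℤ)) (k : List DivR -> α) :
    divDF d k = k (d.map divP) := by
  induction d generalizing k with
  | nil => rfl
  | cons p d ih =>
    rw [divDF]
    simp only [fL_eq, fI_eq, fN_eq, ih, List.map_cons]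
def sumE : List DivR -> ℕ
  | [] => 0
  | x :: l => x.e + sumE l
def sumR : List DivR -> ℕ
  | [] => 0
  | x :: l => x.r.natAbs + sumR l
def sumH (η s1 : ℤ) : List DivR -> ℕ
  | [] => 0
  | x :: l => (η * x.q.headD 0 - x.r * s1).natAbs + sumH η s1 l
def sumQ : List DivR -> ℕ
  | [] => 0
  | x :: l => l1 x.q + sumQ l
def tl (x : DivR) : DivR := ⟨x.r, x.q.tail, x.e⟩
def heads (η : ℕ) (et eT : ℕ) : List (ℤ × ℤ × ℕ) -> DivR -> List DivR -> Bool
  | [], c, ds => decide (5 * (l1 c.q + sumQ ds) + 81 * eT <= 5 * et)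
  | s :: l, c, ds =>
    decide (5 * ((η * (c.q.headD 0 - s.1) - c.r * s.2.1).natAbs + sumH η s.2.1 ds)
      + eT * (9 * η + 5 * s.2.1.natAbs) <= 5 * (η * s.2.2)) &&
    heads η et eT l (tl c) (ds.map tl)
def stepOK (A B : Box) : Bool :=
  stepF A fun R =>
  divDF (R.k.c :: R.k.d) fun ds =>
  fN (R.k.e + sumE ds / 25 + 1) fun eT =>
  match ds with
  | c :: z :: hs =>
    decide (A.l.length = 8) && decide (B.l.length = 8) && decide (0 < B.η) &&
    decide (R.w1.nrm <= 620000000000) && decide (R.w2.nrm <= 620000000000) &&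
    decide ((A.a + 1400000000000).natAbs + A.η <= 5000000000) &&
    (B.l.all fun s => decide (0 < s.2.2)) &&
    decide (100 * ((B.η + (c.r - B.a).natAbs + sumR hs + eT : ℕ) : ℤ) <= 47 * z.r) &&
    heads B.η B.et eT B.l ⟨c.r - B.a, c.q, 0⟩ (z :: hs)
  | _ => false
def boundOK (A : Box) : Bool :=
  let a0 : TM := ⟨[A.a], [[(A.η : ℤ)]], 0⟩
  sigF A.et A.l 0 ⟨[0, 1000000000000], [], 0⟩ fun s =>
  TM.addF tT mone fun t1 =>
  TM.mulF t1 s fun p =>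
  TM.addF a0 p fun k =>
  TM.addF k ⟨[1420000000000, -126000000000], [], 0⟩ fun k =>
  decide (k.nrm <= 155000000000)
def bx0 : Box := ⟨-1401155189092, 200000000, [(0, 0, 0), (0, 0, 0), (0, 0, 0), (0, 0, 0), (0, 0, 0), (0, 0, 0), (0, 0, 0), (0, 0, 0)], 0⟩
def bx1 : Box := ⟨-1397543727492, 200000000, [(177580780954, -76490101, 1369586), (0, 0, 1127998), (0, 0, 1127998), (0, 0, 1127998), (0, 0, 1127998), (0, 0, 1127998), (0, 0, 1127998), (0, 0, 1127998)], 10151942⟩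
def bx2 : Box := ⟨-1399457213488, 200000000, [(142500109151, -62601516, 5372378), (24623168655, -16344942, 4680445), (-5321879423, 5083756, 4186703), (372006675, -458852, 3910093), (-12473375, 18824, 3814992), (203791, -364, 3765304), (-1303, 2, 3738564), (0, 0, 3723071)], 33352328⟩
def bx3 : Box := ⟨-1399495747800, 200000000, [(143745397331, -63496275, 10189045), (25441380401, -16762030, 8695073), (-6049513293, 5795849, 7012281), (450511348, -576059, 6051494), (37257971, -52603, 5711317), (-12891955, 22979, 5547063), (780053, -1661, 5463807), (91277, -209, 5418464)], 48354453⟩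
def bx4 : Box := ⟨-1399532186570, 200000000, [(143143336620, -63265390, 14841856), (25917343215, -17085053, 12582357), (-6128559950, 5879185, 9503378), (426544086, -548959, 7800044), (48225862, -69226, 7205271), (-13800367, 24798, 6935782), (418426, -959, 6804851), (201476, -466, 6735901)], 60016675⟩
def bx5 : Box := ⟨-1399535280523, 200000000, [(143131061736, -63269075, 37239212), (25963817503, -17113692, 31252667), (-6149364453, 5899908, 20400387), (427101832, -550284, 14729833), (50011677, -71828, 12827698), (-14205758, 25538, 12079608), (416681, -963, 11752199), (216658, -500, 11592837)], 102980878⟩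
lemma b0 : boundOK bx0 = true := by decide +kernel
lemma b1 : boundOK bx1 = true := by decide +kernel
lemma b2 : boundOK bx2 = true := by decide +kernel
lemma b3 : boundOK bx3 = true := by decide +kernel
lemma b4 : boundOK bx4 = true := by decide +kernel
lemma b5 : boundOK bx5 = true := by decide +kernel
lemma c01 : stepOK bx0 bx1 = true := by decide +kernel
lemma c12 : stepOK bx1 bx2 = true := by decide +kernel
lemma c23 : stepOK bx2 bx3 = true := by decide +kernel
lemma c34 : stepOK bx3 bx4 = true := by decide +kernel
lemma c45 : stepOK bx4 bx5 = true := by decide +kernel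
lemma c55 : stepOK bx5 bx5 = true := by decide +kernel
open Metric
lemma max_near {q : ℂ -> ℂ} {c : ℂ} {R r M : ℝ} (hr : r < R) (hq : DifferentiableOn ℂ q (ball c R))
    (h : ∀ t ∈ ball c R, r <= dist t c -> ‖q t‖ <= M) : ∀ t ∈ ball c R, ‖q t‖ <= M := by
  intro t ht
  rw [mem_ball] at ht
  have hR : 0 < R := dist_nonneg.trans_lt ht
  obtain ⟨s, hs1, hs2⟩ := exists_between (max_lt (max_lt hr ht) hR)
  have a1 : r < s := (le_max_left _ _).trans_lt ((le_max_left _ _).trans_lt hs1)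
  have a2 : dist t c < s := (le_max_right _ _).trans_lt ((le_max_left _ _).trans_lt hs1)
  have a3 : 0 < s := (le_max_right _ _).trans_lt hs1
  refine Complex.norm_le_of_forall_mem_frontier_norm_le (U := ball c s) isBounded_ball ?_ ?_ ?_
  · refine (hq.mono ?_).diffContOnCl
    rw [closure_ball _ a3.ne']
    exact closedBall_subset_ball hs2
  · intro z hz
    rw [frontier_ball _ a3.ne', mem_sphere] at hz
    exact h z (by rw [mem_ball, hz]; exact hs2) (by rw [hz]; exact a1.le)
  · exact subset_closure a2
lemma max_lim {q : ℂ -> ℂ} {c : ℂ} {R M : ℝ} (hq : DifferentiableOn ℂ q (ball c R))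
    (h : ∀ C > M, ∃ r < R, ∀ t ∈ ball c R, r <= dist t c -> ‖q t‖ <= C) : ∀ t ∈ ball c R, ‖q t‖ <= M := by
  intro t ht
  refine le_of_forall_gt_imp_ge_of_dense fun C hC => ?_
  obtain ⟨r, hr, h1⟩ := h C hC
  exact max_near hr hq h1 t ht
noncomputable def ds (E : ℂ -> ℂ) : ℕ -> ℂ -> ℂ
  | 0 => E
  | n + 1 => dslope (ds E n) 0
lemma ds_eq (E : ℂ -> ℂ) (n : ℕ) : ds E n = (Function.swap dslope 0)^[n] E := by
  induction n with
  | zero => rfl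
  | succ n ih => rw [Function.iterate_succ_apply', ds, ih]
lemma ds_diff {E : ℂ -> ℂ} (hE : DifferentiableOn ℂ E (ball 0 1)) (n : ℕ) :
    DifferentiableOn ℂ (ds E n) (ball 0 1) := by
  induction n with
  | zero => exact hE
  | succ n ih =>
    exact (Complex.differentiableOn_dslope (ball_mem_nhds _ one_pos)).2 ih
lemma ds_succ (E : ℂ -> ℂ) (n : ℕ) (τ : ℂ) : ds E n τ = ds E n 0 + τ * ds E (n + 1) τ := by
  have := sub_smul_dslope (ds E n) 0 τ
  simp only [sub_zero, smul_eq_mul] at this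
  rw [ds, this]; ring
lemma ds_zero_le {E : ℂ -> ℂ} {M : ℝ} (hE : DifferentiableOn ℂ E (ball 0 1))
    (hM : ∀ τ ∈ ball (0 : ℂ) 1, ‖E τ‖ <= M) (n : ℕ) : ‖ds E n 0‖ <= M := by
  have han : AnalyticAt ℂ E 0 := hE.analyticAt (ball_mem_nhds _ one_pos)
  have h1 := han.hasFPowerSeriesAt.has_fpower_series_iterate_dslope_fslope n
  have h2 := h1.coeff_zero 1
  rw [<- ds_eq, <- FormalMultilinearSeries.coeff,
    FormalMultilinearSeries.coeff_iterate_fslope, zero_add,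
    FormalMultilinearSeries.coeff_ofScalars] at h2
  rw [<- h2]
  have key : ∀ r : ℝ, 0 < r -> r < 1 -> ‖iteratedDeriv n E 0‖ * r ^ n <= n.factorial * M := by
    intro r h0 h1
    have := Complex.norm_iteratedDeriv_le_of_forall_mem_sphere_norm_le (f := E) (c := 0) (C := M) n h0
      ((hE.mono (by rw [closure_ball _ h0.ne']; exact closedBall_subset_ball h1)).diffContOnCl)
      (fun z hz => hM z (by rw [mem_ball, mem_sphere.1 hz]; exact h1))
    rwa [le_div_iff₀ (pow_pos h0 n)] at this
  have h3 : ‖iteratedDeriv n E 0‖ <= n.factorial * M := by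
    have ht : Tendsto (fun r : ℝ => ‖iteratedDeriv n E 0‖ * r ^ n) (nhdsWithin 1 (Iio 1))
        (nhds (‖iteratedDeriv n E 0‖ * 1 ^ n)) :=
      (Continuous.tendsto (by fun_prop) 1).mono_left nhdsWithin_le_nhds
    rw [one_pow, mul_one] at ht
    refine le_of_tendsto ht ?_
    filter_upwards [Ioo_mem_nhdsLT (show (0 : ℝ) < 1 by norm_num)] with r hr
    exact key r hr.1 hr.2
  rw [norm_div, Complex.norm_natCast, div_le_iff₀ (by positivity)]
  linarith
lemma ds_le {E : ℂ -> ℂ} {M : ℝ} (hE : DifferentiableOn ℂ E (ball 0 1))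
    (hM : ∀ τ ∈ ball (0 : ℂ) 1, ‖E τ‖ <= M) (n : ℕ) : ∀ τ ∈ ball (0 : ℂ) 1, ‖ds E n τ‖ <= (n + 1) * M := by
  have hM0 : 0 <= M := (norm_nonneg _).trans (hM 0 (mem_ball_self one_pos))
  have key : ∀ n : ℕ, ∀ τ ∈ ball (0 : ℂ) 1, ‖τ ^ n * ds E n τ‖ <= (n + 1) * M := by
    intro n
    induction n with
    | zero => intro τ hτ; simpa [ds] using hM τ hτ
    | succ n ih =>
      intro τ hτ
      have e : τ ^ (n + 1) * ds E (n + 1) τ = τ ^ n * ds E n τ - τ ^ n * ds E n 0 := by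
        rw [ds_succ E n τ]; ring
      rw [e]
      have h1 : ‖τ ^ n * ds E n 0‖ <= M := by
        rw [norm_mul, norm_pow]
        calc _ <= 1 * M := by
              gcongr
              · exact pow_le_one₀ (norm_nonneg _) (mem_ball_zero_iff.1 hτ).le
              · exact ds_zero_le hE hM n
          _ = M := one_mul M
      have h2 := ih τ hτ
      have h3 := norm_sub_le (τ ^ n * ds E n τ) (τ ^ n * ds E n 0)
      push_cast; linarith
  refine max_lim (ds_diff hE n) fun C hC => ?_
  have hC0 : 0 < C := lt_of_le_of_lt (by positivity) hC
  have ht : Tendsto (fun r : ℝ => C * r ^ n) (nhdsWithin 1 (Iio 1)) (nhds (C * 1 ^ n)) :=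
      (Continuous.tendsto (by fun_prop) 1).mono_left nhdsWithin_le_nhds
  rw [one_pow, mul_one] at ht
  obtain ⟨r, hr1, hr2⟩ := ((ht.eventually (lt_mem_nhds hC)).and
    (Ioo_mem_nhdsLT (show (0 : ℝ) < 1 by norm_num))).exists
  refine ⟨r, hr2.2, fun t ht1 ht2 => ?_⟩
  have h1 := key n t ht1
  rw [norm_mul, norm_pow] at h1
  rw [dist_zero_right] at ht2
  have h2 : r ^ n <= ‖t‖ ^ n := pow_le_pow_left₀ hr2.1.le ht2 n
  have hp : 0 < r ^ n := pow_pos hr2.1 n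
  have h3 : r ^ n * ‖ds E n t‖ <= C * r ^ n := by
    have : r ^ n * ‖ds E n t‖ <= ‖t‖ ^ n * ‖ds E n t‖ := by gcongr
    linarith
  nlinarith [norm_nonneg (ds E n t)]
noncomputable def sigS (z : ℂ) : (ℕ -> ℂ) -> List (ℤ × ℤ × ℕ) -> ℂ -> ℂ -> ℂ
  | _, [], ρ, _ => ρ
  | hd, s :: l, ρ, τ => (s.1 + z * s.2.1 + hd 0 * s.2.2) + τ * sigS z (fun j => hd (j + 1)) l ρ τ
def InBox (B : Box) (z : ℂ) (k : ℂ -> ℂ) : Prop :=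
  ∃ hd : ℕ -> ℂ, ∃ ρ : ℂ -> ℂ, (∀ i, ‖hd i‖ <= 1) ∧ (∀ τ ∈ ball (0 : ℂ) 1, ‖ρ τ‖ <= B.et) ∧
    ∀ τ ∈ ball (0 : ℂ) 1, 1000000000000 * k (18 / 25 + 7 / 5 * τ) =
      B.a + B.η * z + (7 / 5 * τ - 7 / 25) * sigS z hd B.l (ρ τ) τ
lemma evalD_repl (τ : ℂ) (δ : ℕ -> ℂ) (i j : ℕ) (r : ℤ) :
    evalD τ δ (List.replicate i [] ++ [[r]]) j = δ (j + i) * r := by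
  induction i generalizing j with
  | zero => simp [evalD, evalP]
  | succ i ih =>
    simp only [List.replicate_succ, List.cons_append, evalD, evalP, ih]
    rw [mul_zero, zero_add]; congr 2; ring
section
variable {τ : ℂ} {δ : ℕ -> ℂ}
lemma Rep_coef (i : ℕ) (s : ℤ × ℤ × ℕ) :
    Rep τ δ (coefT i s) ((s.1 + δ 0 * s.2.1 + δ (i + 1) * s.2.2) / 1000000000000) := by
  unfold Rep
  simp only [coefT, evalP, evalD, evalD_repl]
  have : (1000000000000 : ℂ) * ((s.1 + δ 0 * s.2.1 + δ (i + 1) * s.2.2) / 1000000000000) -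
    (s.1 + τ * 0 + (δ 0 * (s.2.1 + τ * 0) + δ (0 + 1 + i) * ((s.2.2 : ℤ) : ℂ))) = 0 := by
    rw [show 0 + 1 + i = i + 1 by ring]; push_cast; ring
  rw [this]; simp
lemma Rep_sig (hτ : ‖τ‖ <= 1) (hδ : ∀ i, ‖δ i‖ <= 1) {et : ℕ} {ρ : ℂ} (hρ : ‖ρ‖ <= et) {W : TM} {w : ℂ}
    (hw : Rep τ δ W w) (l : List (ℤ × ℤ × ℕ)) :
    ∀ (i : ℕ) (hd : ℕ -> ℂ), (∀ j, δ (i + 1 + j) = hd j) ->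
      Rep τ δ (sigT et l i W) (sigS (δ 0) hd l ρ w / 1000000000000) := by
  induction l with
  | nil =>
    intro i hd h
    unfold Rep
    simp only [sigT, sigS, evalP, evalD]
    have : (1000000000000 : ℂ) * (ρ / 1000000000000) - (0 + 0) = ρ := by ring
    rw [this]; exact hρ
  | cons s l ih =>
    intro i hd h
    have h1 := ih (i + 1) (fun j => hd (j + 1)) (fun j => by rw [<- h]; congr 1; ring)
    have h2 := (Rep_coef (τ := τ) (δ := δ) i s).add (hw.mul hτ hδ h1)
    simp only [sigT, sigS]
    convert h2 using 1
    rw [show hd 0 = δ (i + 1) from (h 0).symm]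
    ring
lemma Rep_lin (a b : ℤ) (v : ℂ) (h : 1000000000000 * v = a + b * τ) : Rep τ δ ⟨[a, b], [], 0⟩ v := by
  unfold Rep
  simp only [evalP, evalD]
  rw [h]; simp; ring_nf
lemma Rep_one (a : ℤ) (v : ℂ) (h : 1000000000000 * v = a) : Rep τ δ ⟨[a], [], 0⟩ v :=
  Rep.con a v h
lemma Rep_a0 (a : ℤ) (η : ℕ) : Rep τ δ ⟨[a], [[(η : ℤ)]], 0⟩ ((a + η * δ 0) / 1000000000000) := by
  unfold Rep
  simp only [evalP, evalD]
  have : (1000000000000 : ℂ) * ((a + η * δ 0) / 1000000000000) - (a + τ * 0 + (δ 0 * (((η : ℤ) : ℂ) + τ * 0) + 0)) = 0 := by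
    push_cast; ring
  rw [this]; simp
lemma Rep_iR : Rep τ δ iR (5 / 7) := by
  unfold Rep
  simp only [iR, evalP, evalD]
  have : (1000000000000 : ℂ) * (5 / 7) - (((714285714286 : ℤ) : ℂ) + τ * 0 + 0) = -2 / 7 := by
    push_cast; ring
  rw [this]; norm_num
def stepT (B : Box) : StepR :=
  let a0 : TM := ⟨[B.a], [[(B.η : ℤ)]], 0⟩
  let lam := one.add a0
  let l2t := (lam.mul lam).mul tT
  let w1 := (l2t.add mm).mul iR
  let s1 := sigT B.et B.l 0 w1
  let kap := a0.add ((l2t.add mone).mul s1)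
  let al := l2t.mul kap
  let oa := one.add al
  let Y := oa.mul oa
  let w2 := (Y.add mm).mul iR
  let s2 := sigT B.et B.l 0 w2
  let D := a0.add (Y.mul s2)
  let r := (lam.mul (kap.mul (one.add oa))).mul D
  ⟨lam, w1, w2, ⟨r.c, r.d, r.e + 1000⟩⟩
lemma stepF_eq {α : Type} (B : Box) (k : StepR -> α) : stepF B k = k (stepT B) := by
  simp only [stepF, TM.addF_eq, TM.mulF_eq, sigF_eq, stepT]
lemma nrm_small (hτ : ‖τ‖ <= 1) (hδ : ∀ i, ‖δ i‖ <= 1) {A : TM} {u : ℂ} (hA : Rep τ δ A u)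
    {N : ℕ} (h : A.nrm <= N) : ‖u‖ <= (N : ℝ) / 1000000000000 := by
  have h1 := hA.norm_le hτ hδ
  have h2 : (A.nrm : ℝ) <= N := by exact_mod_cast h
  rw [norm_mul] at h1
  have : ‖(1000000000000 : ℂ)‖ = 1000000000000 := by simp
  rw [this] at h1
  rw [le_div_iff₀ (by norm_num)]; linarith
end
lemma InBox.k_one {B : Box} {z : ℂ} {k : ℂ -> ℂ} (h : InBox B z k) :
    1000000000000 * k 1 = B.a + B.η * z := by
  obtain ⟨hd, ρ, _, _, h⟩ := h
  have := h (1 / 5) (by rw [mem_ball_zero_iff]; norm_num)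
  rw [show (18 / 25 + 7 / 5 * (1 / 5) : ℂ) = 1 by norm_num] at this
  rw [this]; ring
def dlt (z : ℂ) (hd : ℕ -> ℂ) : ℕ -> ℂ
  | 0 => z
  | n + 1 => hd n
structure StepFacts (A : Box) (z : ℂ) (k : ℂ -> ℂ) : Prop where
  lam : ‖(1 + k 1) + 2 / 5‖ <= 1 / 200
  w1 : ∀ t ∈ ball (18 / 25 : ℂ) (7 / 5), ‖(1 + k 1) ^ 2 * t - 18 / 25‖ <= 62 / 100 * (7 / 5)
  w2 : ∀ t ∈ ball (18 / 25 : ℂ) (7 / 5),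
    ‖(1 + (1 + k 1) ^ 2 * t * k ((1 + k 1) ^ 2 * t)) ^ 2 - 18 / 25‖ <= 62 / 100 * (7 / 5)
lemma step_facts {A : Box} {z : ℂ} {k : ℂ -> ℂ} (hz : ‖z‖ <= 1) (hk : InBox A z k)
    (hlam : (A.a + 1400000000000).natAbs + A.η <= 5000000000)
    (h1 : (stepT A).w1.nrm <= 620000000000) (h2 : (stepT A).w2.nrm <= 620000000000) :
    StepFacts A z k ∧ ∃ δ : ℕ -> ℂ, (∀ i, ‖δ i‖ <= 1) ∧ δ 0 = z ∧ ∀ khat : ℂ -> ℂ,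
      (∀ t ∈ ball (18 / 25 : ℂ) (7 / 5), 95 / 100 * (7 / 5) <= dist t (18 / 25) ->
        ‖(1 + t * khat t) * (1 + k 1) - (1 + (1 + (1 + k 1) ^ 2 * t * k ((1 + k 1) ^ 2 * t)) ^ 2 *
          k ((1 + (1 + k 1) ^ 2 * t * k ((1 + k 1) ^ 2 * t)) ^ 2))‖ <= 2 / 10 ^ 10) ->
      ∀ τ ∈ ball (0 : ℂ) 1, 95 / 100 <= ‖τ‖ -> Rep τ δ (stepT A).k (khat (18 / 25 + 7 / 5 * τ)) := by
  have hk1 := hk.k_one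
  obtain ⟨hd, ρ, hhd, hρ, hk⟩ := hk
  set δ := dlt z hd with hδdef
  have hδ : ∀ i, ‖δ i‖ <= 1 := by
    intro i; cases i with
    | zero => exact hz
    | succ n => exact hhd n
  have hδ0 : δ 0 = z := rfl
  have e1 : k 1 = (A.a + A.η * δ 0) / 1000000000000 := by
    rw [hδ0, <- hk1]; ring
  have hl : ‖(1 + k 1) + 2 / 5‖ <= 1 / 200 := by
    have e : (1 + k 1) + 2 / 5 = (((A.a + 1400000000000 : ℤ) : ℂ) + (A.η : ℂ) * z) / 1000000000000 := by
      rw [e1, hδ0]; push_cast; ring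
    rw [e, norm_div]
    have n1 : ‖(((A.a + 1400000000000 : ℤ) : ℂ) + (A.η : ℂ) * z)‖ <= 5000000000 := by
      refine (norm_add_le _ _).trans ?_
      rw [Complex.norm_intCast, norm_mul, Complex.norm_natCast]
      have : ((A.a + 1400000000000).natAbs : ℝ) + A.η <= 5000000000 := by exact_mod_cast hlam
      rw [Nat.cast_natAbs, Int.cast_abs] at this
      have h3 : (A.η : ℝ) * ‖z‖ <= A.η := mul_le_of_le_one_right (Nat.cast_nonneg _) hz
      linarith
    have : ‖(1000000000000 : ℂ)‖ = 1000000000000 := by simp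
    rw [this, div_le_iff₀ (by norm_num)]; linarith
  set lm := 1 + k 1 with hlm
  have hln : 39 / 100 <= ‖lm‖ := by
    have h3 := norm_sub_le (lm + 2 / 5) (lm)
    rw [show lm + 2 / 5 - lm = (2 / 5 : ℂ) by ring] at h3
    have : ‖(2 / 5 : ℂ)‖ = 2 / 5 := by norm_num
    rw [this] at h3; linarith
  have main : ∀ τ ∈ ball (0 : ℂ) 1, ∀ t, t = 18 / 25 + 7 / 5 * τ ->
      ‖(lm ^ 2 * t - 18 / 25) * (5 / 7)‖ <= 62 / 100 ∧
      ‖((1 + lm ^ 2 * t * k (lm ^ 2 * t)) ^ 2 - 18 / 25) * (5 / 7)‖ <= 62 / 100 ∧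
      ∃ r : TM, (stepT A).k = ⟨r.c, r.d, r.e + 1000⟩ ∧ ∃ v : ℂ, Rep τ δ r v ∧
        (1 + t * v) * lm = 1 + (1 + lm ^ 2 * t * k (lm ^ 2 * t)) ^ 2 * k ((1 + lm ^ 2 * t * k (lm ^ 2 * t)) ^ 2) := by
    intro τ hτ0 t ht
    have hτ : ‖τ‖ <= 1 := (mem_ball_zero_iff.1 hτ0).le
    have kform : ∀ s : ℂ, ‖(s - 18 / 25) * (5 / 7)‖ <= 62 / 100 ->
        ‖ρ ((s - 18 / 25) * (5 / 7))‖ <= A.et ∧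
        k s = k 1 + (s - 1) * (sigS (δ 0) hd A.l (ρ ((s - 18 / 25) * (5 / 7))) ((s - 18 / 25) * (5 / 7)) / 1000000000000) := by
      intro s hs
      have hb : (s - 18 / 25) * (5 / 7) ∈ ball (0 : ℂ) 1 := by
        rw [mem_ball_zero_iff]; linarith
      refine ⟨hρ _ hb, ?_⟩
      have := hk _ hb
      rw [show 18 / 25 + 7 / 5 * ((s - 18 / 25) * (5 / 7)) = s by ring] at this
      rw [e1, hδ0]
      have h5 : k s = (1000000000000 * k s) / 1000000000000 := by ring
      rw [h5, this]; ring
    have ra0 := Rep_a0 (τ := τ) (δ := δ) A.a A.η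
    rw [<- e1] at ra0
    have rone : Rep τ δ one 1 := Rep_one _ _ (by norm_num)
    have rmm : Rep τ δ mm (-(18 / 25)) := Rep_one _ _ (by norm_num)
    have rmone : Rep τ δ mone (-1) := Rep_one _ _ (by norm_num)
    have rt : Rep τ δ tT t := Rep_lin _ _ _ (by rw [ht]; push_cast; ring)
    have rlam := rone.add ra0
    have rl2t := (rlam.mul hτ hδ rlam).mul hτ hδ rt
    have rw1 := (rl2t.add rmm).mul hτ hδ Rep_iR
    have n1 := nrm_small hτ hδ rw1 h1
    rw [show ((1 + k 1) * (1 + k 1) * t + -(18 / 25)) * (5 / 7) = (lm ^ 2 * t - 18 / 25) * (5 / 7) by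
      rw [hlm]; ring] at n1 rw1
    rw [show ((620000000000 : ℕ) : ℝ) / 1000000000000 = 62 / 100 by norm_num] at n1
    obtain ⟨b1, f1⟩ := kform _ n1
    have rs1 := Rep_sig hτ hδ b1 rw1 A.l 0 hd (fun j => by
      rw [show 0 + 1 + j = j + 1 by ring]; rfl)
    have rkap := ra0.add ((rl2t.add rmone).mul hτ hδ rs1)
    rw [show k 1 + ((1 + k 1) * (1 + k 1) * t + -1) *
      (sigS (δ 0) hd A.l (ρ ((lm ^ 2 * t - 18 / 25) * (5 / 7))) ((lm ^ 2 * t - 18 / 25) * (5 / 7)) / 1000000000000)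
      = k (lm ^ 2 * t) by rw [f1, hlm]; ring] at rkap
    have ral := rl2t.mul hτ hδ rkap
    have roa := rone.add ral
    have rY := roa.mul hτ hδ roa
    have rw2 := (rY.add rmm).mul hτ hδ Rep_iR
    have n2 := nrm_small hτ hδ rw2 h2
    set Y := (1 + lm ^ 2 * t * k (lm ^ 2 * t)) ^ 2 with hY
    have eY : (1 + (1 + k 1) * (1 + k 1) * t * k (lm ^ 2 * t)) * (1 + (1 + k 1) * (1 + k 1) * t * k (lm ^ 2 * t)) = Y := by
      rw [hY, hlm]; ring
    rw [eY] at n2 rw2 rY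
    rw [<- sub_eq_add_neg] at n2 rw2
    rw [show ((620000000000 : ℕ) : ℝ) / 1000000000000 = 62 / 100 by norm_num] at n2
    obtain ⟨b2, f2⟩ := kform _ n2
    have rs2 := Rep_sig hτ hδ b2 rw2 A.l 0 hd (fun j => by
      rw [show 0 + 1 + j = j + 1 by ring]; rfl)
    have rD := ra0.add (rY.mul hτ hδ rs2)
    have rr := (rlam.mul hτ hδ (rkap.mul hτ hδ (rone.add roa))).mul hτ hδ rD
    refine ⟨n1, n2, _, rfl, _, rr, ?_⟩
    rw [f2]
    set σ := sigS (δ 0) hd A.l (ρ ((Y - 18 / 25) * (5 / 7))) ((Y - 18 / 25) * (5 / 7)) / 1000000000000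
    set κ := k (lm ^ 2 * t)
    rw [hY]
    rw [show k 1 = lm - 1 by rw [hlm]; ring]
    ring
  have conv : ∀ t ∈ ball (18 / 25 : ℂ) (7 / 5), (t - 18 / 25) * (5 / 7) ∈ ball (0 : ℂ) 1 ∧
      t = 18 / 25 + 7 / 5 * ((t - 18 / 25) * (5 / 7)) := by
    intro t ht
    refine ⟨?_, by ring⟩
    rw [mem_ball_iff_norm] at ht
    rw [mem_ball_zero_iff, norm_mul]
    have : ‖(5 / 7 : ℂ)‖ = 5 / 7 := by norm_num
    rw [this]; linarith
  have n57 : ‖(5 / 7 : ℂ)‖ = 5 / 7 := by norm_num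
  refine ⟨⟨hl, ?_, ?_⟩, δ, hδ, rfl, ?_⟩
  · intro t ht
    obtain ⟨c1, c2⟩ := conv t ht
    have := (main _ c1 t c2).1
    rw [norm_mul, n57] at this
    linarith
  · intro t ht
    obtain ⟨c1, c2⟩ := conv t ht
    have := (main _ c1 t c2).2.1
    rw [norm_mul, n57] at this
    linarith
  · intro khat hh τ hτ hτ2
    obtain ⟨_, _, r, hr, v, hv, hid⟩ := main τ hτ _ rfl
    set t := 18 / 25 + 7 / 5 * τ with ht
    have n75 : ‖(7 / 5 : ℂ)‖ = 7 / 5 := by norm_num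
    have htb : t ∈ ball (18 / 25 : ℂ) (7 / 5) := by
      rw [mem_ball_iff_norm, ht, add_sub_cancel_left, norm_mul, n75]
      have := mem_ball_zero_iff.1 hτ; linarith
    have htd : dist t (18 / 25) = 7 / 5 * ‖τ‖ := by
      rw [dist_eq_norm, ht, add_sub_cancel_left, norm_mul, n75]
    have hb := hh t htb (by rw [htd]; linarith)
    rw [<- hid] at hb
    have e2 : (1 + t * khat t) * lm - (1 + t * v) * lm = t * lm * (khat t - v) := by ring
    rw [e2, norm_mul, norm_mul] at hb
    have htn : 6 / 10 <= ‖t‖ := by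
      have h3 := norm_sub_le t (18 / 25)
      rw [<- dist_eq_norm, htd] at h3
      have : ‖(18 / 25 : ℂ)‖ = 18 / 25 := by norm_num
      rw [this] at h3; linarith
    have h6 : 6 / 10 * (39 / 100) <= ‖t‖ * ‖lm‖ := by gcongr
    have h7 : ‖khat t - v‖ <= 1 / 10 ^ 9 := by
      by_contra hc
      push Not at hc
      have : 6 / 10 * (39 / 100) * (1 / 10 ^ 9) <= ‖t‖ * ‖lm‖ * ‖khat t - v‖ := by gcongr
      norm_num at this hb
      linarith
    unfold Rep at hv ⊢
    rw [hr]
    simp only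
    have e3 : 1000000000000 * khat t - (evalP τ r.c + evalD τ δ r.d 0) =
      (1000000000000 * v - (evalP τ r.c + evalD τ δ r.d 0)) + 1000000000000 * (khat t - v) := by ring
    rw [e3]
    refine (norm_add_le _ _).trans ?_
    rw [norm_mul]
    have : ‖(1000000000000 : ℂ)‖ = 1000000000000 := by simp
    rw [this]
    push_cast
    norm_num at h7
    linarith
noncomputable def evR (δ : ℕ -> ℂ) : List DivR -> ℕ -> ℂ
  | [], _ => 0
  | x :: l, j => δ j * x.r + evR δ l (j + 1)
noncomputable def evQ (τ : ℂ) (δ : ℕ -> ℂ) : List DivR -> ℕ -> ℂ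
  | [], _ => 0
  | x :: l, j => δ j * evalP τ x.q + evQ τ δ l (j + 1)
noncomputable def evH (δ : ℕ -> ℂ) : List DivR -> ℕ -> ℂ
  | [], _ => 0
  | x :: l, j => δ j * ((x.q.headD 0 : ℤ) : ℂ) + evH δ l (j + 1)
lemma divP_spec (τ : ℂ) (hτ : ‖τ‖ <= 1) (p : List ℤ) :
    ‖evalP τ p - ((divP p).r + (7 / 5 * τ - 7 / 25) * evalP τ (divP p).q)‖ <= ((divP p).e : ℝ) / 25 := by
  have h : (divP p).e = l1 (resid p (divP p).q (divP p).r) := by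
    unfold divP
    simp only [fL_eq, fI_eq, fN_eq]
  have h1 := norm_evalP hτ (resid p (divP p).q (divP p).r)
  rw [<- h] at h1
  set q := (divP p).q
  set r := (divP p).r
  have e : evalP τ (resid p q r) = 25 * (evalP τ p - (r + (7 / 5 * τ - 7 / 25) * evalP τ q)) := by
    simp only [resid, evalP_padd, evalP_pscale, evalP]; push_cast; ring
  rw [e, norm_mul] at h1
  have : ‖(25 : ℂ)‖ = 25 := by norm_num
  rw [this] at h1
  rw [le_div_iff₀ (by norm_num)]; linarith
lemma divD_spec (τ : ℂ) (hτ : ‖τ‖ <= 1) (δ : ℕ -> ℂ) (hδ : ∀ i, ‖δ i‖ <= 1) (d : List (List ℤ)) (j : ℕ) :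
    ‖evalD τ δ d j - (evR δ (d.map divP) j + (7 / 5 * τ - 7 / 25) * evQ τ δ (d.map divP) j)‖
      <= (sumE (d.map divP) : ℝ) / 25 := by
  induction d generalizing j with
  | nil => simp [evalD, evR, evQ, sumE]
  | cons p d ih =>
    simp only [List.map_cons, evalD, evR, evQ, sumE]
    have h1 := divP_spec τ hτ p
    have h2 := ih (j + 1)
    have e : δ j * evalP τ p + evalD τ δ d (j + 1) -
      (δ j * (divP p).r + evR δ (d.map divP) (j + 1) + (7 / 5 * τ - 7 / 25) *
        (δ j * evalP τ (divP p).q + evQ τ δ (d.map divP) (j + 1))) =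
      δ j * (evalP τ p - ((divP p).r + (7 / 5 * τ - 7 / 25) * evalP τ (divP p).q)) +
      (evalD τ δ d (j + 1) - (evR δ (d.map divP) (j + 1) + (7 / 5 * τ - 7 / 25) * evQ τ δ (d.map divP) (j + 1))) := by
      ring
    rw [e]
    refine (norm_add_le _ _).trans ?_
    rw [norm_mul]
    have h3 := mul_le_mul (hδ j) h1 (norm_nonneg _) zero_le_one
    push_cast; linarith
lemma evQ_split (τ : ℂ) (δ : ℕ -> ℂ) (l : List DivR) (j : ℕ) :
    evQ τ δ l j = evH δ l j + τ * evQ τ δ (l.map tl) j := by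
  induction l generalizing j with
  | nil => simp [evQ, evH]
  | cons x l ih =>
    simp only [List.map_cons, evQ, evH, ih]
    have : evalP τ x.q = ((x.q.headD 0 : ℤ) : ℂ) + τ * evalP τ (tl x).q := by
      unfold tl; cases x.q <;> simp [evalP]
    rw [this]; ring
lemma evR_tl (δ : ℕ -> ℂ) (l : List DivR) (j : ℕ) : evR δ (l.map tl) j = evR δ l j := by
  induction l generalizing j with
  | nil => rfl
  | cons x l ih => simp only [List.map_cons, evR, ih]; rfl
lemma natAbs_norm (x : ℤ) : ‖(x : ℂ)‖ = (x.natAbs : ℝ) := by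
  rw [Complex.norm_intCast, Nat.cast_natAbs, Int.cast_abs]
lemma evQ_norm {τ : ℂ} (hτ : ‖τ‖ <= 1) {δ : ℕ -> ℂ} (hδ : ∀ i, ‖δ i‖ <= 1) (l : List DivR) (j : ℕ) :
    ‖evQ τ δ l j‖ <= sumQ l := by
  induction l generalizing j with
  | nil => simp [evQ, sumQ]
  | cons x l ih =>
    simp only [evQ, sumQ]; push_cast
    refine (norm_add_le _ _).trans (add_le_add ?_ (ih _))
    rw [norm_mul]
    have := mul_le_mul (hδ j) (norm_evalP hτ x.q) (norm_nonneg _) zero_le_one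
    linarith
lemma evR_norm {δ : ℕ -> ℂ} (hδ : ∀ i, ‖δ i‖ <= 1) (l : List DivR) (j : ℕ) :
    ‖evR δ l j‖ <= sumR l := by
  induction l generalizing j with
  | nil => simp [evR, sumR]
  | cons x l ih =>
    simp only [evR, sumR]; push_cast
    refine (norm_add_le _ _).trans (add_le_add ?_ (ih _))
    rw [norm_mul, natAbs_norm]
    have := mul_le_mul (hδ j) (le_refl (x.r.natAbs : ℝ)) (Nat.cast_nonneg _) zero_le_one
    linarith
lemma evH_norm {δ : ℕ -> ℂ} (hδ : ∀ i, ‖δ i‖ <= 1) (η s : ℤ) (l : List DivR) (j : ℕ) :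
    ‖η * evH δ l j - evR δ l j * s‖ <= sumH η s l := by
  induction l generalizing j with
  | nil => simp [evH, evR, sumH]
  | cons x l ih =>
    simp only [evH, evR, sumH]; push_cast
    have e : (η : ℂ) * (δ j * ((x.q.headD 0 : ℤ) : ℂ) + evH δ l (j + 1)) - (δ j * x.r + evR δ l (j + 1)) * s
      = δ j * ((η * x.q.headD 0 - x.r * s : ℤ) : ℂ) + (η * evH δ l (j + 1) - evR δ l (j + 1) * s) := by
      push_cast; ring
    rw [e]
    refine (norm_add_le _ _).trans (add_le_add ?_ (ih _))
    rw [norm_mul, natAbs_norm]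
    have := mul_le_mul (hδ j) (le_refl ((η * x.q.headD 0 - x.r * s).natAbs : ℝ)) (Nat.cast_nonneg _) zero_le_one
    linarith
lemma heads_sound {δ : ℕ -> ℂ} (hδ : ∀ i, ‖δ i‖ <= 1) {η et eT : ℕ} (hη : 0 < η) {E : ℂ -> ℂ} {z' e5 : ℂ}
    (he5 : ‖e5‖ <= eT) (hE : DifferentiableOn ℂ E (ball 0 1)) (hE1 : ∀ τ ∈ ball (0 : ℂ) 1, ‖E τ‖ <= 9 / 5 * eT)
    (l : List (ℤ × ℤ × ℕ)) :
    ∀ (i : ℕ) (c : DivR) (D : List DivR), i + l.length = 8 -> (∀ s ∈ l, 0 < s.2.2) ->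
      heads η et eT l c D = true -> η * z' = c.r + evR δ D 0 + e5 ->
      ∃ hd : ℕ -> ℂ, ∃ ρ : ℂ -> ℂ, (∀ i, ‖hd i‖ <= 1) ∧ (∀ τ ∈ ball (0 : ℂ) 1, ‖ρ τ‖ <= et) ∧
        ∀ τ ∈ ball (0 : ℂ) 1, evalP τ c.q + evQ τ δ D 0 + ds E i τ = sigS z' hd l (ρ τ) τ := by
  induction l with
  | nil =>
    intro i c D hi _ hh hz
    simp only [heads, decide_eq_true_eq] at hh
    have hi8 : i = 8 := by simpa using hi
    refine ⟨fun _ => 0, fun τ => evalP τ c.q + evQ τ δ D 0 + ds E i τ, by simp, ?_, fun τ hτ => rfl⟩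
    intro τ hτ
    have hτ1 : ‖τ‖ <= 1 := (mem_ball_zero_iff.1 hτ).le
    have h1 := norm_evalP hτ1 c.q
    have h2 := evQ_norm hτ1 hδ D 0
    have h3 := ds_le hE hE1 i τ hτ
    have h4 := norm_add₃_le (a := evalP τ c.q) (b := evQ τ δ D 0) (c := ds E i τ)
    have hh' : 5 * ((l1 c.q : ℝ) + sumQ D) + 81 * eT <= 5 * et := by exact_mod_cast hh
    rw [hi8] at h3 h4 ⊢
    push_cast at h3
    linarith
  | cons s l ih =>
    intro i c D hi hpos hh hz
    simp only [heads, Bool.and_eq_true, decide_eq_true_eq] at hh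
    obtain ⟨hh1, hh2⟩ := hh
    obtain ⟨hd, ρ, h1, h2, h3⟩ := ih (i + 1) (tl c) (D.map tl) (by simp at hi; omega)
      (fun s hs => hpos s (List.mem_cons_of_mem _ hs)) hh2 (by rw [evR_tl]; exact hz)
    have hr : (0 : ℝ) < s.2.2 := by exact_mod_cast hpos s List.mem_cons_self
    have hrC : (s.2.2 : ℂ) ≠ 0 := by exact_mod_cast hr.ne'
    have hηR : (0 : ℝ) < η := by exact_mod_cast hη
    set v : ℂ := ((c.q.headD 0 : ℤ) : ℂ) + evH δ D 0 + ds E i 0 - s.1 - z' * s.2.1 with hv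
    refine ⟨fun n => Nat.casesOn n (v / s.2.2) hd, ρ, ?_, h2, ?_⟩
    · intro n
      cases n with
      | succ n => exact h1 n
      | zero =>
        change ‖v / s.2.2‖ <= 1
        rw [norm_div, Complex.norm_natCast, div_le_one hr]
        have e : (η : ℂ) * v = ((η * (c.q.headD 0 - s.1) - c.r * s.2.1 : ℤ) : ℂ) +
            (((η : ℤ) : ℂ) * evH δ D 0 - evR δ D 0 * s.2.1) + (η * ds E i 0 - e5 * s.2.1) := by
          have : (η : ℂ) * v = η * (((c.q.headD 0 : ℤ) : ℂ) + evH δ D 0 + ds E i 0 - s.1) - (η * z') * s.2.1 := by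
            rw [hv]; ring
          rw [this, hz]; push_cast; ring
        have n1 := norm_add₃_le (a := ((η * (c.q.headD 0 - s.1) - c.r * s.2.1 : ℤ) : ℂ))
          (b := (((η : ℤ) : ℂ) * evH δ D 0 - evR δ D 0 * s.2.1)) (c := (η * ds E i 0 - e5 * s.2.1))
        rw [<- e, norm_mul, Complex.norm_natCast, natAbs_norm] at n1
        have n2 := evH_norm hδ η s.2.1 D 0
        have n3 : ‖(η * ds E i 0 - e5 * s.2.1)‖ <= η * (9 / 5 * eT) + eT * s.2.1.natAbs := by
          refine (norm_sub_le _ _).trans ?_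
          rw [norm_mul, norm_mul, Complex.norm_natCast, natAbs_norm]
          have := ds_zero_le hE hE1 i
          gcongr
        have hh' : 5 * (((η * (c.q.headD 0 - s.1) - c.r * s.2.1).natAbs : ℝ) + sumH η s.2.1 D)
          + eT * (9 * η + 5 * s.2.1.natAbs) <= 5 * (η * s.2.2) := by exact_mod_cast hh1
        have n4 : (η : ℝ) * ‖v‖ <= η * s.2.2 := by linarith
        exact le_of_mul_le_mul_left n4 hηR
    · intro τ hτ
      have h4 := h3 τ hτ
      change _ = (s.1 + z' * s.2.1 + (v / s.2.2) * s.2.2) + τ * sigS z' hd l (ρ τ) τ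
      rw [<- h4, div_mul_cancel₀ _ hrC, hv, ds_succ E i τ, evQ_split τ δ D 0]
      have : evalP τ c.q = ((c.q.headD 0 : ℤ) : ℂ) + τ * evalP τ (tl c).q := by
        unfold tl; cases c.q <;> simp [evalP]
      rw [this]; ring
lemma evalP_diff (p : List ℤ) : Differentiable ℂ (fun τ => evalP τ p) := by
  induction p with
  | nil => simp only [evalP]; fun_prop
  | cons x p ih => simp only [evalP]; fun_prop
lemma evQ_diff (δ : ℕ -> ℂ) (l : List DivR) (j : ℕ) : Differentiable ℂ (fun τ => evQ τ δ l j) := by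
  induction l generalizing j with
  | nil => simp only [evQ]; fun_prop
  | cons x p ih =>
    simp only [evQ]
    have := evalP_diff x.q
    have := ih (j + 1)
    fun_prop
theorem step_sound {A B : Box} (hok : stepOK A B = true) :
    0 < B.η ∧ ∃ D : ℝ, 0 < D ∧ ∀ (z : ℂ) (k : ℂ -> ℂ), ‖z‖ <= 1 -> InBox A z k -> StepFacts A z k ∧
      ∀ khat : ℂ -> ℂ, DifferentiableOn ℂ khat (ball (18 / 25 : ℂ) (7 / 5)) ->
      (∀ t ∈ ball (18 / 25 : ℂ) (7 / 5), 95 / 100 * (7 / 5) <= dist t (18 / 25) ->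
        ‖(1 + t * khat t) * (1 + k 1) - (1 + (1 + (1 + k 1) ^ 2 * t * k ((1 + k 1) ^ 2 * t)) ^ 2 *
          k ((1 + (1 + k 1) ^ 2 * t * k ((1 + k 1) ^ 2 * t)) ^ 2))‖ <= 2 / 10 ^ 10) ->
      ∀ z' : ℂ, z' = (1000000000000 * khat 1 - B.a) / B.η ->
        ‖z' - D * z‖ <= 47 / 100 * D - 1 ∧ InBox B z' khat := by
  unfold stepOK at hok
  rw [stepF_eq, divDF_eq, fN_eq] at hok
  rw [List.map_cons] at hok
  rcases hds : (stepT A).k.d.map divP with _ | ⟨zc, hs⟩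
  · rw [hds] at hok; simp at hok
  rw [hds] at hok
  set eT := (stepT A).k.e + sumE (divP (stepT A).k.c :: zc :: hs) / 25 + 1 with heT
  simp only [Bool.and_eq_true, decide_eq_true_eq] at hok
  obtain ⟨⟨⟨⟨⟨⟨⟨⟨hlA, hlB⟩, hη⟩, hw1⟩, hw2⟩, hlam⟩, hall⟩, hun⟩, hheads⟩ := hok
  set c := divP (stepT A).k.c with hc
  have hηR : (0 : ℝ) < B.η := by exact_mod_cast hη
  have hηC : (B.η : ℂ) ≠ 0 := by exact_mod_cast hηR.ne'
  have hunR : 100 * ((B.η : ℝ) + (c.r - B.a).natAbs + sumR hs + eT) <= 47 * zc.r := by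
    generalize (c.r - B.a).natAbs = N at hun
    have h := (Int.cast_le (R := ℝ)).2 hun
    push_cast at h
    linarith
  have hzr : (0 : ℝ) < zc.r := by
    have h1 : (0 : ℝ) <= (c.r - B.a).natAbs := Nat.cast_nonneg _
    have h2 : (0 : ℝ) <= sumR hs := Nat.cast_nonneg _
    have h3 : (0 : ℝ) <= eT := Nat.cast_nonneg _
    linarith
  refine ⟨hη, zc.r / B.η, by positivity, ?_⟩
  intro z k hz hk
  obtain ⟨hfacts, δ, hδ, hδ0, hrep⟩ := step_facts hz hk hlam hw1 hw2
  refine ⟨hfacts, ?_⟩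
  intro khat hkd hkh z' hz'
  have hR := hrep khat hkh
  set ev : ℂ -> ℂ := fun τ => 1000000000000 * khat (18 / 25 + 7 / 5 * τ) -
    (c.r + evR δ (zc :: hs) 0 + (7 / 5 * τ - 7 / 25) * (evalP τ c.q + evQ τ δ (zc :: hs) 0)) with hev
  have hmaps : MapsTo (fun τ : ℂ => 18 / 25 + 7 / 5 * τ) (ball 0 1) (ball (18 / 25 : ℂ) (7 / 5)) := by
    intro τ hτ
    have n75 : ‖(7 / 5 : ℂ)‖ = 7 / 5 := by norm_num
    simp only
    rw [mem_ball_iff_norm, add_sub_cancel_left, norm_mul, n75]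
    have := mem_ball_zero_iff.1 hτ; linarith
  have hevd : DifferentiableOn ℂ ev (ball 0 1) := by
    have d1 : DifferentiableOn ℂ (fun τ : ℂ => khat (18 / 25 + 7 / 5 * τ)) (ball 0 1) :=
      hkd.comp (by fun_prop) hmaps
    have d2 := (evalP_diff c.q).differentiableOn (s := ball (0 : ℂ) 1)
    have d3 := (evQ_diff δ (zc :: hs) 0).differentiableOn (s := ball (0 : ℂ) 1)
    simp only [hev]
    fun_prop
  have hevb : ∀ τ ∈ ball (0 : ℂ) 1, ‖ev τ‖ <= eT := by
    refine max_near (r := 95 / 100) (by norm_num) hevd ?_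
    intro τ hτ hτ2
    rw [dist_zero_right] at hτ2
    have hτ1 : ‖τ‖ <= 1 := (mem_ball_zero_iff.1 hτ).le
    have r1 := hR τ hτ hτ2
    unfold Rep at r1
    have r2 := divP_spec τ hτ1 (stepT A).k.c
    have r3 := divD_spec τ hτ1 δ hδ (stepT A).k.d 0
    rw [hds] at r3
    rw [<- hc] at r2
    have e : ev τ = (1000000000000 * khat (18 / 25 + 7 / 5 * τ) - (evalP τ (stepT A).k.c + evalD τ δ (stepT A).k.d 0))
      + (evalP τ (stepT A).k.c - (c.r + (7 / 5 * τ - 7 / 25) * evalP τ c.q))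
      + (evalD τ δ (stepT A).k.d 0 - (evR δ (zc :: hs) 0 + (7 / 5 * τ - 7 / 25) * evQ τ δ (zc :: hs) 0)) := by
      rw [hev]; ring
    have n := norm_add₃_le (a := (1000000000000 * khat (18 / 25 + 7 / 5 * τ) - (evalP τ (stepT A).k.c + evalD τ δ (stepT A).k.d 0)))
      (b := (evalP τ (stepT A).k.c - (c.r + (7 / 5 * τ - 7 / 25) * evalP τ c.q)))
      (c := (evalD τ δ (stepT A).k.d 0 - (evR δ (zc :: hs) 0 + (7 / 5 * τ - 7 / 25) * evQ τ δ (zc :: hs) 0)))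
    rw [<- e] at n
    have s1 : ((sumE (c :: zc :: hs) : ℕ) : ℝ) <= 25 * ((sumE (c :: zc :: hs) / 25 + 1 : ℕ) : ℝ) := by
      have : sumE (c :: zc :: hs) <= 25 * (sumE (c :: zc :: hs) / 25 + 1) := by omega
      exact_mod_cast this
    have s2 : ((sumE (c :: zc :: hs) : ℕ) : ℝ) = c.e + sumE (zc :: hs) := by
      rw [sumE]; push_cast; rfl
    rw [heT]
    push_cast at s1 ⊢
    linarith
  set e5 := ev (1 / 5) with he5d
  have h15 : (1 / 5 : ℂ) ∈ ball (0 : ℂ) 1 := by rw [mem_ball_zero_iff]; norm_num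
  have he5 : ‖e5‖ <= eT := hevb _ h15
  set E : ℂ -> ℂ := fun τ => dslope ev (1 / 5) τ * (5 / 7) with hEd
  have hEdiff : DifferentiableOn ℂ E (ball 0 1) :=
    ((Complex.differentiableOn_dslope (isOpen_ball.mem_nhds h15)).2 hevd).mul_const _
  have hEe : ∀ τ, (7 / 5 * τ - 7 / 25) * E τ = ev τ - e5 := by
    intro τ
    have := sub_smul_dslope ev (1 / 5) τ
    rw [smul_eq_mul] at this
    rw [he5d, <- this]; simp only [hEd]; ring
  have hEb : ∀ τ ∈ ball (0 : ℂ) 1, ‖E τ‖ <= 9 / 5 * eT := by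
    refine max_near (r := 995 / 1000) (by norm_num) hEdiff ?_
    intro τ hτ hτ2
    rw [dist_zero_right] at hτ2
    have h1 := hEe τ
    have h2 : ‖(7 / 5 * τ - 7 / 25) * E τ‖ <= 2 * eT := by
      rw [h1]
      have := norm_sub_le (ev τ) e5
      have := hevb τ hτ
      linarith
    rw [norm_mul] at h2
    have h3 : 7 / 5 * (795 / 1000) <= ‖(7 / 5 * τ - 7 / 25)‖ := by
      have := norm_sub_norm_le (7 / 5 * τ) (7 / 25)
      rw [norm_mul] at this
      have n1 : ‖(7 / 5 : ℂ)‖ = 7 / 5 := by norm_num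
      have n2 : ‖(7 / 25 : ℂ)‖ = 7 / 25 := by norm_num
      rw [n1, n2] at this
      linarith
    have h4 := mul_le_mul_of_nonneg_right h3 (norm_nonneg (E τ))
    have : (0 : ℝ) <= eT := Nat.cast_nonneg _
    linarith
  have hk1 : 1000000000000 * khat 1 = c.r + evR δ (zc :: hs) 0 + e5 := by
    rw [he5d]; simp only [hev]
    rw [show (18 / 25 + 7 / 5 * (1 / 5) : ℂ) = 1 by norm_num]; ring
  have hzz : (B.η : ℂ) * z' = ((c.r - B.a : ℤ) : ℂ) + evR δ (zc :: hs) 0 + e5 := by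
    rw [hz', hk1]; field_simp; push_cast; ring
  constructor
  · have e : (B.η : ℂ) * (z' - ((zc.r / B.η : ℝ) : ℂ) * z) = ((c.r - B.a : ℤ) : ℂ) + evR δ hs 1 + e5 := by
      rw [mul_sub, hzz]; simp only [evR, hδ0]; push_cast; field_simp; ring
    have n := norm_add₃_le (a := ((c.r - B.a : ℤ) : ℂ)) (b := evR δ hs 1) (c := e5)
    rw [<- e, norm_mul, Complex.norm_natCast, natAbs_norm] at n
    have n2 := evR_norm hδ hs 1
    have h6 : (47 / 100 * (zc.r / B.η : ℝ) - 1) * B.η = 47 / 100 * zc.r - B.η := by field_simp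
    have h7 : (B.η : ℝ) * ‖z' - ((zc.r / B.η : ℝ) : ℂ) * z‖ <= (47 / 100 * (zc.r / B.η : ℝ) - 1) * B.η := by
      rw [h6]; linarith
    rw [mul_comm] at h7
    exact le_of_mul_le_mul_right h7 hηR
  · obtain ⟨hd, ρ, p1, p2, p3⟩ := heads_sound hδ hη (z' := z') he5 hEdiff hEb B.l 0 ⟨c.r - B.a, c.q, 0⟩ (zc :: hs)
      (by omega) (by
        intro s hs
        have := List.all_eq_true.1 hall s hs
        simpa using this) hheads hzz
    refine ⟨hd, ρ, p1, p2, fun τ hτ => ?_⟩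
    rw [<- p3 τ hτ]
    simp only [ds]
    have h1 := hEe τ
    have h2 : ev τ = 1000000000000 * khat (18 / 25 + 7 / 5 * τ) -
      (c.r + evR δ (zc :: hs) 0 + (7 / 5 * τ - 7 / 25) * (evalP τ c.q + evQ τ δ (zc :: hs) 0)) := rfl
    rw [mul_add, h1, h2, hzz]; push_cast; ring
theorem bound_sound {A : Box} (hok : boundOK A = true) {z : ℂ} {k : ℂ -> ℂ} (hz : ‖z‖ <= 1) (hk : InBox A z k) :
    ∀ t ∈ ball (18 / 25 : ℂ) (7 / 5), ‖k t - (-(142 / 100) + 9 / 100 * (t - 18 / 25))‖ <= 155 / 1000 := by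
  intro t ht
  obtain ⟨hd, ρ, hhd, hρ, hk⟩ := hk
  set δ := dlt z hd with hδdef
  have hδ : ∀ i, ‖δ i‖ <= 1 := by
    intro i; cases i with
    | zero => exact hz
    | succ n => exact hhd n
  have hδ0 : δ 0 = z := rfl
  set τ := (t - 18 / 25) * (5 / 7) with hτd
  have htt : t = 18 / 25 + 7 / 5 * τ := by rw [hτd]; ring
  have hτb : τ ∈ ball (0 : ℂ) 1 := by
    rw [mem_ball_iff_norm] at ht
    rw [mem_ball_zero_iff, hτd, norm_mul]
    have : ‖(5 / 7 : ℂ)‖ = 5 / 7 := by norm_num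
    rw [this]; linarith
  have hτ : ‖τ‖ <= 1 := (mem_ball_zero_iff.1 hτb).le
  simp only [boundOK, sigF_eq, TM.addF_eq, TM.mulF_eq, decide_eq_true_eq] at hok
  have r1 := Rep_lin (τ := τ) (δ := δ) 0 1000000000000 τ (by push_cast; ring)
  have r2 := Rep_sig hτ hδ (hρ τ hτb) r1 A.l 0 hd (fun j => by
      rw [show 0 + 1 + j = j + 1 by ring]; rfl)
  have rt : Rep τ δ tT t := Rep_lin _ _ _ (by rw [htt]; push_cast; ring)
  have rmone : Rep τ δ mone (-1) := Rep_one _ _ (by norm_num)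
  have ra0 := Rep_a0 (τ := τ) (δ := δ) A.a A.η
  have rL : Rep τ δ ⟨[1420000000000, -126000000000], [], 0⟩ (-(-(142 / 100) + 9 / 100 * (t - 18 / 25))) :=
    Rep_lin _ _ _ (by rw [htt]; push_cast; ring)
  have r := (ra0.add ((rt.add rmone).mul hτ hδ r2)).add rL
  have n := nrm_small hτ hδ r hok
  rw [show ((155000000000 : ℕ) : ℝ) / 1000000000000 = 155 / 1000 by norm_num] at n
  have hkt := hk τ hτb
  rw [<- htt] at hkt
  convert n using 2
  have : k t = (1000000000000 * k t) / 1000000000000 := by ring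
  rw [this, hkt, hδ0, htt]; ring
lemma deriv_bd {f : ℂ -> ℂ} {c s : ℂ} {R d M : ℝ} (hf : DifferentiableOn ℂ f (ball c R)) (hM : ∀ t ∈ ball c R, ‖f t‖ <= M)
    (hd : 0 < d) (hs : dist s c + d < R) : ‖deriv f s‖ <= M / d := by
  have hsub : closedBall s d ⊆ ball c R := fun t ht => by
    rw [mem_closedBall] at ht; rw [mem_ball]
    linarith [dist_triangle t s c]
  refine Complex.norm_deriv_le_of_forall_mem_sphere_norm_le hd ?_ fun z hz => hM z (hsub (sphere_subset_closedBall hz))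
  refine (hf.mono ?_).diffContOnCl
  rw [closure_ball _ hd.ne']; exact hsub
lemma lip_bd {f : ℂ -> ℂ} {c s s' : ℂ} {R ρ d M : ℝ} (hf : DifferentiableOn ℂ f (ball c R)) (hM : ∀ t ∈ ball c R, ‖f t‖ <= M)
    (hd : 0 < d) (hr : ρ + d < R) (hs : dist s c <= ρ) (hs' : dist s' c <= ρ) : ‖f s - f s'‖ <= M / d * ‖s - s'‖ := by
  refine Convex.norm_image_sub_le_of_norm_deriv_le (𝕜 := ℂ) (s := closedBall c ρ) (fun x hx => ?_) (fun x hx => ?_)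
    (convex_closedBall c ρ) (mem_closedBall.2 hs') (mem_closedBall.2 hs)
  · rw [mem_closedBall] at hx
    exact hf.differentiableAt (isOpen_ball.mem_nhds (by rw [mem_ball]; linarith))
  · rw [mem_closedBall] at hx
    exact deriv_bd hf hM hd (by linarith)
lemma lip_ctr {f : ℂ -> ℂ} {c s s' : ℂ} {R M : ℝ} (hf : DifferentiableOn ℂ f (ball c R)) (hM : ∀ t ∈ ball c R, ‖f t‖ <= M)
    (hR : 0 < R) (hs : dist s c <= R / 2) (hs' : dist s' c <= R / 2) : ‖f s - f s'‖ <= 5 / 2 * M / R * ‖s - s'‖ := by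
  have := lip_bd hf hM (d := 2 / 5 * R) (by positivity) (ρ := R / 2) (by linarith) hs hs'
  convert this using 2
  field_simp
lemma fix1 {f : ℂ -> ℂ} {r : ℝ} (hr : 0 < r) (hf : DifferentiableOn ℂ f (ball 0 r))
    (hM : ∀ t ∈ ball 0 r, ‖f t‖ <= 47/100 * r) : ∃ s, ‖s‖ <= 47/100*r ∧ f s = s ∧ ‖deriv f s‖ < 1 ∧
      ∀ s' ∈ ball 0 r, ‖s'‖ <= 47/100*r -> ‖s - s'‖ <= 11 * ‖f s' - s'‖ := by
  have hl : ∀ s s' : ℂ, ‖s‖ <= 47/100*r -> ‖s'‖ <= 47/100*r -> ‖f s - f s'‖ <= 904/1000 * ‖s - s'‖ := by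
    intro s s' h h'
    refine (lip_bd hf hM (d := 52/100*r) (by positivity) (ρ := 47/100*r) (by linarith) (by simpa using h)
      (by simpa using h')).trans ?_
    refine mul_le_mul_of_nonneg_right ?_ (norm_nonneg _)
    rw [div_le_iff₀ (by positivity)]; linarith
  have hin : ∀ s : ℂ, ‖s‖ <= 47/100*r -> s ∈ ball (0:ℂ) r := fun s hs => by
    rw [mem_ball_zero_iff]; linarith
  have hmaps : MapsTo f (closedBall 0 (47/100*r)) (closedBall 0 (47/100*r)) := fun s hs => by
    rw [mem_closedBall_zero_iff] at *
    exact hM s (hin s hs)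
  have hc : ContractingWith (904/1000 : NNReal) (hmaps.restrict f _ _) := by
    refine ⟨by rw [<- NNReal.coe_lt_coe]; push_cast; norm_num, LipschitzWith.of_dist_le_mul fun x y => ?_⟩
    push_cast
    rw [Subtype.dist_eq, Subtype.dist_eq, dist_eq_norm, dist_eq_norm]
    exact hl _ _ (mem_closedBall_zero_iff.1 x.2) (mem_closedBall_zero_iff.1 y.2)
  obtain ⟨s, hs, hfs, -⟩ := hc.exists_fixedPoint' (isClosed_closedBall.isComplete) hmaps (x := 0)
    (mem_closedBall_self (by positivity)) (edist_ne_top _ _)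
  rw [mem_closedBall_zero_iff] at hs
  refine ⟨s, hs, hfs, ?_, fun s' _ hs' => ?_⟩
  · refine (deriv_bd hf hM (d := 52/100*r) (by positivity) (by rw [dist_zero_right]; linarith)).trans_lt ?_
    rw [div_lt_iff₀ (by positivity)]; linarith
  · have h1 := hl s s' hs hs'
    have h2 : s - s' = (f s - f s') + (f s' - s') := by rw [hfs.eq]; ring
    have h3 := norm_add_le (f s - f s') (f s' - s')
    rw [<- h2] at h3
    linarith [norm_nonneg (f s' - s')]
theorem fix_family {E : Type*} [NormedAddCommGroup E] [NormedSpace ℂ E] [CompleteSpace E] {U : Set E} (hU : IsOpen U)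
    {r : ℝ} (hr : 0 < r) {e : E × ℂ -> ℂ} (he : AnalyticOnNhd ℂ e (U ×ˢ ball 0 r))
    (hb : ∀ p ∈ U, ∀ s ∈ ball (0:ℂ) r, ‖e (p, s)‖ <= 47/100*r) :
    ∃ T : E -> ℂ, AnalyticOnNhd ℂ T U ∧ ∀ p ∈ U, ‖T p‖ <= 47/100*r ∧ e (p, T p) = T p ∧
      (∀ s ∈ ball (0:ℂ) r, ‖s‖ <= 47/100*r -> ‖T p - s‖ <= 11 * ‖e (p, s) - s‖) ∧
      (∀ s ∈ ball (0:ℂ) r, e (p, s) = s -> s = T p) := by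
  have hd : ∀ p ∈ U, DifferentiableOn ℂ (fun s => e (p, s)) (ball 0 r) := fun p hp s hs =>
    ((he (p, s) ⟨hp, hs⟩).differentiableAt.comp s
      ((differentiableAt_const p).prodMk differentiableAt_id)).differentiableWithinAt
  have h1 := fun p : U => fix1 hr (hd p p.2) (hb p p.2)
  choose T0 hT using h1
  classical
  let T : E -> ℂ := fun p => if h : p ∈ U then T0 ⟨p, h⟩ else 0
  have hT' : ∀ p ∈ U, ‖T p‖ <= 47/100*r ∧ e (p, T p) = T p ∧ ‖deriv (fun s => e (p, s)) (T p)‖ < 1 ∧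
      ∀ s' ∈ ball (0:ℂ) r, ‖s'‖ <= 47/100*r -> ‖T p - s'‖ <= 11 * ‖e (p, s') - s'‖ := by
    intro p hp
    simp only [T, dif_pos hp]
    exact hT ⟨p, hp⟩
  have huniq : ∀ p ∈ U, ∀ s ∈ ball (0:ℂ) r, e (p, s) = s -> s = T p := by
    intro p hp s hs h
    have h2 := (hT' p hp).2.2.2 s hs (by rw [<- h]; exact hb p hp s hs)
    rw [h, sub_self, norm_zero, mul_zero] at h2
    have := norm_le_zero_iff.1 h2
    exact (sub_eq_zero.1 this).symm
  refine ⟨T, fun p hp => ?_, fun p hp => ⟨(hT' p hp).1, (hT' p hp).2.1, (hT' p hp).2.2.2, huniq p hp⟩⟩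
  obtain ⟨k1, k2, k3, -⟩ := hT' p hp
  have hball : T p ∈ ball (0:ℂ) r := by rw [mem_ball_zero_iff]; linarith
  have hea := he (p, T p) ⟨hp, hball⟩
  set f : E × ℂ -> ℂ := fun q => e q - q.2 with hfdef
  have hfa : AnalyticAt ℂ f (p, T p) := hea.sub analyticAt_snd
  have hcd : ContDiffAt ℂ ⊤ f (p, T p) := hfa.contDiffAt
  have hder : (fderiv ℂ f (p, T p) ∘L .inr ℂ E ℂ) 1 = deriv (fun s => e (p, s)) (T p) - 1 := by
    have a1 : HasDerivAt (fun s => f (p, s)) ((fderiv ℂ f (p, T p) ∘L .inr ℂ E ℂ) 1) (T p) := by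
      have := (hfa.differentiableAt.hasFDerivAt).comp (T p) (hasFDerivAt_prodMk_right (𝕜 := ℂ) p (T p))
      exact this.hasDerivAt
    have a2 : HasDerivAt (fun s => f (p, s)) (deriv (fun s => e (p, s)) (T p) - 1) (T p) :=
      (((hd p hp).differentiableAt (isOpen_ball.mem_nhds hball)).hasDerivAt).sub (hasDerivAt_id _)
    exact a1.unique a2
  have hne : (fderiv ℂ f (p, T p) ∘L .inr ℂ E ℂ) 1 ≠ 0 := by
    rw [hder]; intro h
    rw [sub_eq_zero.1 h] at k3
    simp at k3
  have hinv : (fderiv ℂ f (p, T p) ∘L .inr ℂ E ℂ).IsInvertible := by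
    set L := (fderiv ℂ f (p, T p) ∘L .inr ℂ E ℂ) with hL
    refine ⟨ContinuousLinearEquiv.unitsEquivAut ℂ (Units.mk0 (L 1) hne), ?_⟩
    ext
    simp
  have hcd2 := hcd.contDiffAt_implicitFunction (by simp) hinv
  set ψ := hcd.implicitFunction (by simp) hinv with hψ
  have e1 : ψ p = T p := hcd.implicitFunction_apply_self (by simp) hinv
  have e2 := hcd.eventually_apply_implicitFunction (by simp) hinv
  have e3 : ∀ᶠ x in nhds p, ψ x ∈ ball (0:ℂ) r :=
    hcd2.continuousAt.eventually (isOpen_ball.mem_nhds (by rw [e1]; exact hball))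
  have e4 : ψ =ᶠ[nhds p] T := by
    filter_upwards [e2, e3, hU.mem_nhds hp] with x x1 x2 x3
    refine huniq x x3 _ x2 ?_
    have : f (p, T p) = 0 := by simp only [hfdef]; rw [k2, sub_self]
    rw [this] at x1
    exact sub_eq_zero.1 x1
  exact (hcd2.congr_of_eventuallyEq e4.symm).analyticAt
def Tb : Set ℂ := ball (18/25) (7/5)
def Dm : Set ℂ := {x | x ^ 2 ∈ Tb}
lemma Tb_open : IsOpen Tb := isOpen_ball
lemma Dm_open : IsOpen Dm := Tb_open.preimage (by fun_prop)
lemma Tb_zero : (0:ℂ) ∈ Tb := by rw [Tb, mem_ball, dist_comm, dist_zero_right]; norm_num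
lemma Tb_one : (1:ℂ) ∈ Tb := by rw [Tb, mem_ball, dist_eq_norm]; norm_num
lemma Dm_zero : (0:ℂ) ∈ Dm := by rw [Dm, mem_ofPred_eq]; simpa using Tb_zero
lemma Dm_one : (1:ℂ) ∈ Dm := by rw [Dm, mem_ofPred_eq]; simpa using Tb_one
lemma Dm_neg {x : ℂ} (hx : x ∈ Dm) : -x ∈ Dm := by simpa [Dm] using hx
lemma mem_Tb {t : ℂ} : t ∈ Tb ↔ ‖t - 18/25‖ < 7/5 := by rw [Tb, mem_ball, dist_eq_norm]
lemma mem_Dm {x : ℂ} : x ∈ Dm ↔ ‖x^2 - 18/25‖ < 7/5 := mem_Tb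
lemma sq_root (t : ℂ) : (t ^ (1/2 : ℂ)) ^ 2 = t := by
  have := Complex.cpow_nat_inv_pow t (n := 2) (by norm_num)
  simpa using this
lemma even_split {G : ℂ -> ℂ} (hG : DifferentiableOn ℂ G Dm) (hev : ∀ x ∈ Dm, G (-x) = G x) :
    ∃ H : ℂ -> ℂ, DifferentiableOn ℂ H Tb ∧ ∀ x ∈ Dm, G x = H (x ^ 2) := by
  have key : ∀ x y : ℂ, x ∈ Dm -> x ^ 2 = y ^ 2 -> G x = G y := by
    intro x y hx h
    rcases sq_eq_sq_iff_eq_or_eq_neg.1 h with h | h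
    · rw [h]
    · have : y = -x := by rw [h, neg_neg]
      rw [this, hev x hx]
  refine ⟨fun t => G (t ^ (1/2 : ℂ)), ?_, fun x hx => key _ _ hx (sq_root _).symm⟩
  have hmem : ∀ t ∈ Tb, ∀ r : ℂ, r ^ 2 = t -> r ∈ Dm := fun t ht r hr => by rw [Dm, mem_ofPred_eq, hr]; exact ht
  refine (Complex.differentiableOn_compl_singleton_and_continuousAt_iff (Tb_open.mem_nhds Tb_zero)).1 ⟨?_, ?_⟩
  · rintro t ⟨ht, h0⟩
    refine DifferentiableAt.differentiableWithinAt ?_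
    rcases Complex.mem_slitPlane_or_neg_mem_slitPlane h0 with h | h
    · have h1 : DifferentiableAt ℂ (fun t : ℂ => t ^ (1/2 : ℂ)) t :=
        differentiableAt_id.cpow_const h
      exact (hG.differentiableAt (Dm_open.mem_nhds (hmem t ht _ (sq_root t)))).comp t h1
    · have h1 : DifferentiableAt ℂ (fun t : ℂ => Complex.I * (-t) ^ (1/2 : ℂ)) t :=
        (differentiableAt_id.neg.cpow_const h).const_mul _
      have hr : ∀ s : ℂ, (Complex.I * (-s) ^ (1/2 : ℂ)) ^ 2 = s := fun s => by
        rw [mul_pow, sq_root, Complex.I_sq]; ring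
      have h2 := (hG.differentiableAt (Dm_open.mem_nhds (hmem t ht _ (hr t)))).comp t h1
      refine h2.congr_of_eventuallyEq ?_
      filter_upwards [Tb_open.mem_nhds ht] with s hs
      exact key _ _ (hmem s hs _ (sq_root s)) (by rw [sq_root, hr])
  · have h1 : ContinuousAt G ((0:ℂ) ^ (1/2 : ℂ)) :=
      (hG.differentiableAt (Dm_open.mem_nhds (hmem 0 Tb_zero _ (sq_root 0)))).continuousAt
    refine ContinuousAt.comp (g := G) h1 ?_
    have h00 : (0:ℂ) ^ (1/2:ℂ) = 0 := by rw [Complex.zero_cpow]; norm_num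
    rw [ContinuousAt, h00, tendsto_zero_iff_norm_tendsto_zero]
    have h2 : ∀ t : ℂ, ‖t ^ (1/2:ℂ)‖ = Real.sqrt ‖t‖ := fun t => by
      rw [eq_comm, Real.sqrt_eq_iff_mul_self_eq (norm_nonneg _) (norm_nonneg _), <- norm_mul, <- sq, sq_root]
    simp_rw [h2]
    have : Tendsto (fun t : ℂ => Real.sqrt ‖t‖) (nhds 0) (nhds (Real.sqrt ‖(0:ℂ)‖)) :=
      (Continuous.tendsto (by fun_prop) 0)
    simpa using this
lemma dsl_diff {H : ℂ -> ℂ} (h : DifferentiableOn ℂ H Tb) : DifferentiableOn ℂ (dslope H 0) Tb :=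
  (Complex.differentiableOn_dslope (Tb_open.mem_nhds Tb_zero)).2 h
lemma dsl_eq (H : ℂ -> ℂ) (t : ℂ) : H t = H 0 + t * dslope H 0 t := by
  have := sub_smul_dslope H 0 t
  simp only [sub_zero, smul_eq_mul] at this
  rw [this]; ring
lemma split {F : ℂ -> ℂ} (hF : DifferentiableOn ℂ F Dm) (h0 : F 0 = 1) (h1 : deriv F 0 = 0) :
    ∃ k g : ℂ -> ℂ, DifferentiableOn ℂ k Tb ∧ DifferentiableOn ℂ g Tb ∧
      ∀ x ∈ Dm, F x = 1 + x^2 * k (x^2) + x^3 * g (x^2) := by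
  have hneg : DifferentiableOn ℂ (fun x => F (-x)) Dm :=
    hF.comp (differentiableOn_id.neg) (fun x hx => Dm_neg hx)
  obtain ⟨H, hH, hH'⟩ := even_split (G := fun x => (F x + F (-x)) / 2) ((hF.add hneg).div_const 2)
    (fun x hx => by simp only [neg_neg]; ring)
  obtain ⟨K, hK, hK'⟩ := even_split (G := fun x => x * ((F x - F (-x)) / 2))
    (differentiableOn_id.mul ((hF.sub hneg).div_const 2))
    (fun x hx => by simp only [neg_neg]; ring)
  have H0 : H 0 = 1 := by
    have := hH' 0 Dm_zero
    simp only [neg_zero, h0] at this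
    rw [zero_pow (by norm_num)] at this
    rw [<- this]; norm_num
  have K0 : K 0 = 0 := by
    have := hK' 0 Dm_zero
    simp only [zero_mul] at this
    rw [zero_pow (by norm_num)] at this
    exact this.symm
  set h := dslope K 0 with hh
  have hodd : ∀ x ∈ Dm, (F x - F (-x)) / 2 = x * h (x^2) := by
    intro x hx
    rcases eq_or_ne x 0 with rfl | hx0
    · simp
    · have e1 := hK' x hx
      rw [dsl_eq K, K0, zero_add] at e1
      refine mul_left_cancel₀ hx0 ?_
      rw [e1]; ring
  have hh0 : h 0 = 0 := by
    have a0 : HasDerivAt F 0 0 := by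
      have := (hF.differentiableAt (Dm_open.mem_nhds Dm_zero)).hasDerivAt
      rwa [h1] at this
    have a1 : HasDerivAt (fun x => (F x - F (-x)) / 2) 0 0 := by
      have a0' : HasDerivAt F 0 (-0) := by simpa using a0
      have := (a0.sub (a0'.comp (0:ℂ) (hasDerivAt_neg 0))).div_const 2
      simpa using this
    have hc : DifferentiableAt ℂ h (0 ^ 2) := by
      rw [zero_pow (by norm_num)]
      exact (dsl_diff hK).differentiableAt (Tb_open.mem_nhds Tb_zero)
    have a2 : HasDerivAt (fun x : ℂ => x * h (x^2)) (1 * h (0^2) + 0 * (deriv h (0^2) * (2 * 0))) 0 := by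
      refine (hasDerivAt_id (0:ℂ)).mul ?_
      have := hc.hasDerivAt.comp (0:ℂ) (hasDerivAt_pow 2 (0:ℂ))
      simp only [Nat.add_one_sub_one, pow_one, Nat.cast_ofNat] at this
      exact this
    have a3 := a1.congr_of_eventuallyEq (f₁ := fun x : ℂ => x * h (x^2)) (by
      filter_upwards [Dm_open.mem_nhds Dm_zero] with x hx using (hodd x hx).symm)
    have := a2.unique a3
    simpa using this
  refine ⟨dslope H 0, dslope h 0, dsl_diff hH, dsl_diff (dsl_diff hK), fun x hx => ?_⟩
  have e1 := hH' x hx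
  have e2 := hodd x hx
  rw [dsl_eq H, H0] at e1
  rw [dsl_eq h, hh0] at e2
  linear_combination e1 + e2
noncomputable def T1 : ℝ := 1 / 10 ^ 16
noncomputable def T2 : ℝ := 1 / 10 ^ 36
lemma T1_eq : T1 = 1 / 10 ^ 16 := rfl
lemma T2_eq : T2 = 1 / 10 ^ 36 := rfl
lemma T1_pos : 0 < T1 := by rw [T1]; positivity
lemma T2_pos : 0 < T2 := by rw [T2]; positivity
structure Gd (φ : ℂ -> ℂ -> ℂ) (k g : ℂ -> ℂ) : Prop where
  an : AnalyticOnNhd ℂ (fun q : ℂ × ℂ => φ q.1 q.2) (Dm ×ˢ Dm)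
  dk : DifferentiableOn ℂ k Tb
  dg : DifferentiableOn ℂ g Tb
  eq : ∀ x ∈ Dm, φ x 0 = 1 + x^2 * k (x^2) + x^3 * g (x^2)
  hg : ∀ t ∈ Tb, ‖g t‖ <= T1
  hy : ∀ x ∈ Dm, ∀ y ∈ Dm, ‖φ x y - φ x 0‖ <= T2
  hk : ∀ t ∈ Tb, ‖k t - (-(142/100) + 9/100 * (t - 18/25))‖ <= 155/1000
  lam : ‖(1 + k 1) + 2/5‖ <= 1/200
  w1 : ∀ t ∈ Tb, ‖(1 + k 1)^2 * t - 18/25‖ <= 62/100*(7/5)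
  w2 : ∀ t ∈ Tb, ‖(1 + (1 + k 1)^2 * t * k ((1 + k 1)^2 * t))^2 - 18/25‖ <= 62/100*(7/5)
def dp (x : ℂ) : Prop := ‖x^2 - 18/25‖ <= 9/10
lemma sq_le_of {x : ℂ} {a b : ℝ} (h : ‖x^2 - 18/25‖ <= a) (hb : 0 <= b) (hab : a + 18/25 <= b^2) : ‖x‖ <= b := by
  have h1 : ‖x^2‖ <= a + 18/25 := by
    have := norm_add_le (x^2 - 18/25) (18/25)
    rw [sub_add_cancel] at this
    have h2 : ‖(18/25:ℂ)‖ = 18/25 := by norm_num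
    linarith
  rw [norm_pow] at h1
  exact abs_le_of_sq_le_sq' (by linarith) hb |>.2
lemma nx {x : ℂ} (hx : x ∈ Dm) : ‖x‖ <= 1457/1000 :=
  sq_le_of (mem_Dm.1 hx).le (by norm_num) (by norm_num)
lemma dp_nx {x : ℂ} (hx : dp x) : ‖x‖ <= 1273/1000 := sq_le_of hx (by norm_num) (by norm_num)
lemma dp.mem {x : ℂ} (hx : dp x) : x ∈ Dm := mem_Dm.2 (by unfold dp at hx; linarith)
lemma nt {t : ℂ} (ht : t ∈ Tb) : ‖t‖ <= 212/100 := by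
  have := norm_add_le (t - 18/25) (18/25)
  rw [sub_add_cancel] at this
  have h2 : ‖(18/25:ℂ)‖ = 18/25 := by norm_num
  have := mem_Tb.1 ht
  linarith
lemma dp_ball {x : ℂ} (hx : dp x) : ball x (15/100) ⊆ Dm := by
  intro y hy
  rw [mem_ball, dist_eq_norm] at hy
  have h1 := dp_nx hx
  have e : y^2 - 18/25 = (x^2 - 18/25) + (y - x) * (2 * x + (y - x)) := by ring
  rw [mem_Dm, e]
  refine (norm_add_le _ _).trans_lt ?_
  rw [norm_mul]
  have h2 : ‖2 * x + (y - x)‖ <= 2 * ‖x‖ + ‖y - x‖ := by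
    refine (norm_add_le _ _).trans ?_
    rw [norm_mul]; norm_num
  unfold dp at hx
  nlinarith [norm_nonneg (y - x), norm_nonneg (2 * x + (y - x))]
lemma dp_of_near {x y : ℂ} (hx : ‖x^2 - 18/25‖ <= 87/100) (h : ‖y - x‖ <= 1/100) : dp y := by
  have h1 : ‖x‖ <= 1273/1000 := sq_le_of hx (by norm_num) (by norm_num)
  have e : y^2 - 18/25 = (x^2 - 18/25) + (y - x) * (2 * x + (y - x)) := by ring
  rw [dp, e]
  refine (norm_add_le _ _).trans ?_
  rw [norm_mul]
  have h2 : ‖2 * x + (y - x)‖ <= 2 * ‖x‖ + ‖y - x‖ := by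
    refine (norm_add_le _ _).trans ?_
    rw [norm_mul]; norm_num
  nlinarith [norm_nonneg (y - x), norm_nonneg (2 * x + (y - x))]
lemma small_mem {u : ℂ} (hu : ‖u‖ <= 6/10) : u ∈ Dm := by
  rw [mem_Dm]
  refine (norm_sub_le _ _).trans_lt ?_
  rw [norm_pow]
  have : ‖(18/25:ℂ)‖ = 18/25 := by norm_num
  nlinarith [norm_nonneg u]
section
variable {φ : ℂ -> ℂ -> ℂ} {k g : ℂ -> ℂ}
lemma Gd.kb (h : Gd φ k g) {t : ℂ} (ht : t ∈ Tb) : ‖k t‖ <= 1702/1000 := by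
  have h1 := h.hk t ht
  have h2 : k t = (k t - (-(142/100) + 9/100 * (t - 18/25))) + (-(142/100) + 9/100 * (t - 18/25)) := by ring
  rw [h2]
  refine (norm_add_le _ _).trans ?_
  have h3 := norm_add_le (-(142/100) : ℂ) (9/100 * (t - 18/25))
  rw [norm_mul] at h3
  have h4 : ‖(-(142/100):ℂ)‖ = 142/100 := by norm_num
  have h5 : ‖(9/100:ℂ)‖ = 9/100 := by norm_num
  have := (mem_Tb.1 ht).le
  rw [h4, h5] at h3
  linarith
lemma Gd.near0 (h : Gd φ k g) {x : ℂ} (hx : x ∈ Dm) : ‖φ x 0 - (1 + x^2 * k (x^2))‖ <= 31/10*T1 := by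
  have e : φ x 0 - (1 + x^2 * k (x^2)) = x^3 * g (x^2) := by rw [h.eq x hx]; ring
  rw [e, norm_mul, norm_pow]
  have h1 := h.hg _ hx
  have h2 : ‖x‖^3 <= (1457/1000)^3 := pow_le_pow_left₀ (norm_nonneg _) (nx hx) 3
  have := mul_le_mul h2 h1 (norm_nonneg _) (by norm_num)
  refine this.trans ?_
  have := T1_pos
  nlinarith
lemma Gd.near (h : Gd φ k g) {x y : ℂ} (hx : x ∈ Dm) (hy : y ∈ Dm) : ‖φ x y - (1 + x^2 * k (x^2))‖ <= 4*T1 := by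
  have e : φ x y - (1 + x^2 * k (x^2)) = (φ x y - φ x 0) + (φ x 0 - (1 + x^2 * k (x^2))) := by ring
  rw [e]
  refine (norm_add_le _ _).trans ?_
  have h1 := h.hy x hx y hy
  have h2 := h.near0 hx
  rw [T2_eq] at h1
  rw [T1_eq] at *
  linarith
lemma Gd.Eb (h : Gd φ k g) {t : ℂ} (ht : t ∈ Tb) : ‖1 + t * k t‖ <= 461/100 := by
  refine (norm_add_le _ _).trans ?_
  rw [norm_mul, norm_one]
  have := mul_le_mul (nt ht) (h.kb ht) (norm_nonneg _) (by norm_num)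
  linarith
lemma Gd.bd (h : Gd φ k g) {x y : ℂ} (hx : x ∈ Dm) (hy : y ∈ Dm) : ‖φ x y‖ <= 47/10 := by
  have h1 := h.near hx hy
  have h2 := h.Eb hx
  have h3 := norm_add_le (φ x y - (1 + x^2 * k (x^2))) (1 + x^2 * k (x^2))
  rw [sub_add_cancel] at h3
  rw [T1_eq] at h1
  linarith
lemma Gd.dx (h : Gd φ k g) {y : ℂ} (hy : y ∈ Dm) : DifferentiableOn ℂ (fun x => φ x y) Dm := fun x hx =>
  (DifferentiableAt.comp (g := fun q : ℂ × ℂ => φ q.1 q.2) (f := fun x => (x, y)) x (h.an (x, y) ⟨hx, hy⟩).differentiableAt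
    (differentiableAt_id.prodMk (differentiableAt_const y))).differentiableWithinAt
lemma Gd.dy (h : Gd φ k g) {x : ℂ} (hx : x ∈ Dm) : DifferentiableOn ℂ (fun y => φ x y) Dm := fun y hy =>
  (DifferentiableAt.comp (g := fun q : ℂ × ℂ => φ q.1 q.2) (f := fun y => (x, y)) y (h.an (x, y) ⟨hx, hy⟩).differentiableAt
    ((differentiableAt_const x).prodMk differentiableAt_id)).differentiableWithinAt
lemma Gd.lipx (h : Gd φ k g) {x x' y : ℂ} (hx : dp x) (hx' : ‖x' - x‖ <= 7/100) (hy : y ∈ Dm) :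
    ‖φ x' y - φ x y‖ <= 79 * ‖x' - x‖ := by
  have := lip_ctr (f := fun x => φ x y) (c := x) (s := x') (s' := x) (R := 15/100) (M := 47/10)
    ((h.dx hy).mono (dp_ball hx)) (fun t ht => h.bd (dp_ball hx ht) hy)
    (by norm_num) (by rw [dist_eq_norm]; linarith) (by rw [dist_self]; norm_num)
  refine this.trans ?_
  gcongr
  norm_num
lemma Gd.lipy (h : Gd φ k g) {x y y' : ℂ} (hy : dp y) (hy' : ‖y' - y‖ <= 7/100) (hx : x ∈ Dm) :
    ‖φ x y' - φ x y‖ <= 17 * T2 * ‖y' - y‖ := by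
  have := lip_ctr (f := fun y => φ x y - φ x 0) (c := y) (s := y') (s' := y) (R := 15/100) (M := T2)
    (((h.dy hx).mono (dp_ball hy)).sub_const _) (fun t ht => h.hy x hx t (dp_ball hy ht))
    (by norm_num) (by rw [dist_eq_norm]; linarith) (by rw [dist_self]; norm_num)
  rw [sub_sub_sub_cancel_right] at this
  refine this.trans ?_
  gcongr
  have := T2_pos
  linarith
noncomputable def rt (u S : ℂ) : ℂ := (1 - u) ^ (1/2:ℂ) * (1 + S) ^ (1/2:ℂ) * (100/142) ^ (1/2:ℂ)
lemma rt_sq (u S : ℂ) : rt u S ^ 2 = (1 - u) * (1 + S) * (100/142) := by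
  rw [rt, mul_pow, mul_pow, sq_root, sq_root, sq_root]
lemma rt_near {u S : ℂ} {s : ℝ} (hu : ‖u‖ <= 6/10) (hS : ‖S‖ <= s) :
    ‖rt u S ^ 2 - 18/25‖ <= (224/10000 + 6/10 + 16/10 * s) * (100/142) := by
  have e : rt u S ^ 2 - 18/25 = ((-(224/10000) - u) + (1 - u) * S) * (100/142) := by rw [rt_sq]; ring
  rw [e, norm_mul]
  have h0 : ‖(100/142:ℂ)‖ = 100/142 := by norm_num
  rw [h0]
  gcongr
  refine (norm_add_le _ _).trans ?_
  have h1 := norm_sub_le (-(224/10000):ℂ) u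
  have h2 : ‖(-(224/10000):ℂ)‖ = 224/10000 := by norm_num
  have h3 := norm_sub_le (1:ℂ) u
  rw [norm_one] at h3
  rw [norm_mul]
  have h4 : ‖1 - u‖ * ‖S‖ <= 16/10 * s := mul_le_mul (by linarith) hS (norm_nonneg _) (by norm_num)
  linarith
noncomputable def eX (φ : ℂ -> ℂ -> ℂ) (u v S : ℂ) : ℂ := S + (φ (rt u S) v - u) / (1 - u)
lemma one_sub_ge {u : ℂ} (hu : ‖u‖ <= 6/10) : 4/10 <= ‖1 - u‖ := by
  have := norm_sub_norm_le (1:ℂ) u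
  rw [norm_one] at this; linarith
lemma rt_mem {u S : ℂ} (hu : ‖u‖ < 6/10) (hS : S ∈ ball (0:ℂ) (3/4)) : rt u S ∈ Dm := by
  rw [mem_ball_zero_iff] at hS
  rw [mem_Dm]
  have := rt_near hu.le hS.le
  linarith
lemma rt_dp {u S : ℂ} (hu : ‖u‖ < 6/10) (hS : ‖S‖ <= 47/100*(3/4)) : dp (rt u S) := by
  have := rt_near hu.le hS
  rw [dp]; linarith
lemma eX_bd' (h : Gd φ k g) {u v S : ℂ} {s : ℝ} (hu : ‖u‖ < 6/10) (hv : v ∈ Dm) (hS : ‖S‖ <= s) (hm : rt u S ∈ Dm) :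
    ‖eX φ u v S‖ <= (1 + s) * (155/1000 + 9/100 * ((224/10000 + 6/10 + 16/10 * s) * (100/142))) * (100/142) + 10*T1 := by
  have hn := rt_near hu.le hS
  set X := rt u S with hX
  have hk := h.hk (X^2) hm
  have hne : 1 - u ≠ 0 := by
    intro h0; have := one_sub_ge hu.le; rw [h0, norm_zero] at this; linarith
  have e : eX φ u v S = (1 + S) * ((k (X^2) - (-(142/100) + 9/100 * (X^2 - 18/25))) + 9/100 * (X^2 - 18/25)) * (100/142)
      + (φ X v - (1 + X^2 * k (X^2))) / (1 - u) := by
    rw [eX, <- hX]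
    have h2 : X^2 = (1 - u) * (1 + S) * (100/142) := rt_sq u S
    generalize k (X^2) = K
    rw [h2]
    field_simp
    ring
  rw [e]
  refine (norm_add_le _ _).trans ?_
  have h0 : ‖(100/142:ℂ)‖ = 100/142 := by norm_num
  have h9 : ‖(9/100:ℂ)‖ = 9/100 := by norm_num
  refine add_le_add ?_ ?_
  · rw [norm_mul, norm_mul, h0]
    have hs0 := (norm_nonneg S).trans hS
    refine mul_le_mul_of_nonneg_right (mul_le_mul ?_ ?_ (norm_nonneg _) (by linarith)) (by norm_num)
    · refine (norm_add_le _ _).trans ?_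
      rw [norm_one]; linarith
    · refine (norm_add_le _ _).trans ?_
      rw [norm_mul, h9]
      gcongr
  · rw [norm_div, div_le_iff₀ (norm_pos_iff.2 hne)]
    have := h.near hm hv
    have := one_sub_ge hu.le
    nlinarith [T1_pos]
lemma eX_bd (h : Gd φ k g) {u v S : ℂ} (hu : ‖u‖ < 6/10) (hv : v ∈ Dm) (hS : S ∈ ball (0:ℂ) (3/4)) :
    ‖eX φ u v S‖ <= 47/100 * (3/4) := by
  have := eX_bd' h hu hv (mem_ball_zero_iff.1 hS).le (rt_mem hu hS)
  rw [T1_eq] at this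
  linarith
lemma slit_one_sub {u : ℂ} (hu : ‖u‖ < 1) : 1 - u ∈ Complex.slitPlane := by
  have := Complex.mem_slitPlane_of_norm_lt_one (z := -u) (by simpa using hu)
  simpa [sub_eq_add_neg] using this
lemma slit_one_add {u : ℂ} (hu : ‖u‖ < 1) : 1 + u ∈ Complex.slitPlane :=
  Complex.mem_slitPlane_of_norm_lt_one hu
lemma rt_lip {u S S' : ℂ} (hu : ‖u‖ < 6/10) (hS : ‖S‖ <= 47/100*(3/4)) (hS' : ‖S'‖ <= 47/100*(3/4)) :
    ‖rt u S - rt u S'‖ <= 375/100 * ‖S - S'‖ := by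
  have hd : DifferentiableOn ℂ (fun S => rt u S) (ball 0 (3/4)) := by
    intro S hS
    rw [mem_ball_zero_iff] at hS
    refine DifferentiableAt.differentiableWithinAt ?_
    unfold rt
    refine (DifferentiableAt.mul_const ?_ _)
    refine (DifferentiableAt.const_mul ?_ _)
    exact (differentiableAt_id.const_add 1).cpow_const (slit_one_add (by simp only [id]; linarith))
  refine (lip_bd hd (M := 1457/1000) (d := 39/100) (ρ := 47/100*(3/4)) (fun t ht => nx (rt_mem hu ht)) (by norm_num)
    (by norm_num) (by simpa using hS) (by simpa using hS')).trans ?_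
  refine mul_le_mul_of_nonneg_right ?_ (norm_nonneg _)
  norm_num
end
def ft (φ : ℂ -> ℂ -> ℂ) (X : ℂ -> ℂ -> ℂ) (u v : ℂ) : ℂ := φ (φ u (X u v)) u
structure XF (φ : ℂ -> ℂ -> ℂ) (X : ℂ -> ℂ -> ℂ) : Prop where
  dpX : ∀ u v, ‖u‖ < 6/10 -> v ∈ Dm -> dp (X u v)
  yX : ∀ u v v', ‖u‖ < 6/10 -> v ∈ Dm -> v' ∈ Dm -> ‖X u v - X u v'‖ <= 210 * T2
  dft : ∀ u v, ‖u‖ < 6/10 -> v ∈ Dm -> φ u (X u v) ∈ Dm -> DifferentiableAt ℂ (fun u => ft φ X u v) u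
def fm (k : ℂ -> ℂ) (x : ℂ) : ℂ := 1 + x^2 * k (x^2)
structure Dq (k : ℂ -> ℂ) (u u0 : ℂ) : Prop where
  lt : ‖u‖ < 6/10
  near : ‖u - u0‖ <= 1/10^10
  d0 : ‖u0^2 - 18/25‖ <= 868/1000
  d1 : ‖(fm k u0)^2 - 18/25‖ <= 868/1000
section
variable {φ X : ℂ -> ℂ -> ℂ} {k g : ℂ -> ℂ}
lemma Gd.lm_le (h : Gd φ k g) : ‖1 + k 1‖ <= 405/1000 := by
  have h1 := h.lam
  have h2 := norm_sub_le ((1 + k 1) + 2/5) (2/5)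
  rw [add_sub_cancel_right] at h2
  have h3 : ‖(2/5:ℂ)‖ = 2/5 := by norm_num
  linarith
lemma Gd.lm_ge (h : Gd φ k g) : 395/1000 <= ‖1 + k 1‖ := by
  have h1 := h.lam
  have h2 := norm_sub_le ((1 + k 1) + 2/5) (1 + k 1)
  rw [add_sub_cancel_left] at h2
  have h3 : ‖(2/5:ℂ)‖ = 2/5 := by norm_num
  linarith
lemma Dq.of_t (h : Gd φ k g) {u u0 t : ℂ} (hu : ‖u‖ < 6/10) (hn : ‖u - u0‖ <= 1/10^10) (ht : t ∈ Tb)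
    (e : u0^2 = (1 + k 1)^2 * t) : Dq k u u0 := by
  refine ⟨hu, hn, ?_, ?_⟩
  · rw [e]; have := h.w1 t ht; linarith
  · rw [fm, e]; have := h.w2 t ht; linarith
lemma Dq.of_small (h : Gd φ k g) {u : ℂ} (hu : ‖u‖ <= 2/10) : Dq k u u := by
  have h1 := h.lm_ge
  have hne : 1 + k 1 ≠ 0 := by intro h0; rw [h0, norm_zero] at h1; linarith
  refine Dq.of_t h (t := u^2 / (1 + k 1)^2) (by linarith) (by rw [sub_self, norm_zero]; positivity) ?_ (by field_simp)
  rw [mem_Tb]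
  refine (norm_sub_le _ _).trans_lt ?_
  have h3 : ‖(18/25:ℂ)‖ = 18/25 := by norm_num
  rw [norm_div, norm_pow, norm_pow, h3, <- lt_sub_iff_add_lt, div_lt_iff₀ (by positivity)]
  nlinarith [norm_nonneg u]
lemma Dq.mem {u u0 : ℂ} (hq : Dq k u u0) : u ∈ Dm := small_mem hq.lt.le
lemma Dq.dp0 {u u0 : ℂ} (hq : Dq k u u0) : dp u0 := by have := hq.d0; rw [dp]; linarith
lemma Dq.dp {u u0 : ℂ} (hq : Dq k u u0) : dp u :=
  dp_of_near (x := u0) (by have := hq.d0; linarith) (by have := hq.near; linarith)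
lemma Gd.wn (h : Gd φ k g) {u u0 y : ℂ} (hq : Dq k u u0) (hy : y ∈ Dm) :
    ‖φ u y - fm k u0‖ <= 79 * ‖u - u0‖ + 4 * T1 := by
  have e : φ u y - fm k u0 = (φ u y - φ u0 y) + (φ u0 y - fm k u0) := by ring
  rw [e]
  refine (norm_add_le _ _).trans (add_le_add ?_ ?_)
  · exact h.lipx hq.dp0 (by have := hq.near; linarith) hy
  · exact h.near hq.dp0.mem hy
lemma Gd.wd (h : Gd φ k g) {u u0 y : ℂ} (hq : Dq k u u0) (hy : y ∈ Dm) : HN.dp (φ u y) := by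
  refine dp_of_near (x := fm k u0) (by have := hq.d1; linarith) ((h.wn hq hy).trans ?_)
  have := hq.near
  rw [T1_eq]; linarith
lemma Gd.hh (h : Gd φ k g) (hX : XF φ X) {u u0 v : ℂ} (hq : Dq k u u0) (hv : v ∈ Dm) :
    ‖ft φ X u v - φ (φ u 0) 0‖ <= 81 * T2 := by
  have hXm := (hX.dpX u v hq.lt hv).mem
  have h0 := h.wd hq Dm_zero
  have h1 := h.hy u hq.mem _ hXm
  have h2 := h.lipx (x' := φ u (X u v)) h0 (by rw [T2_eq] at h1; linarith) hq.mem
  have h3 := h.hy _ h0.mem _ hq.mem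
  have e : ft φ X u v - φ (φ u 0) 0 = (φ (φ u (X u v)) u - φ (φ u 0) u) + (φ (φ u 0) u - φ (φ u 0) 0) := by
    rw [ft]; ring
  rw [e]
  refine (norm_add_le _ _).trans ?_
  linarith [T2_pos]
lemma Gd.ffn (h : Gd φ k g) (hX : XF φ X) {u u0 v : ℂ} (hq : Dq k u u0) (hv : v ∈ Dm) :
    ‖ft φ X u v - fm k (fm k u0)‖ <= 79 * (79 * ‖u - u0‖ + 4 * T1) + 4 * T1 := by
  have hXm := (hX.dpX u v hq.lt hv).mem
  have h1 := h.wn hq hXm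
  have hd : HN.dp (fm k u0) := by have := hq.d1; rw [HN.dp]; linarith
  have h2 := h.lipx (x' := φ u (X u v)) hd (by
    refine h1.trans ?_
    have := hq.near; rw [T1_eq]; linarith) hq.mem
  have h3 := h.near hd.mem hq.mem
  have e : ft φ X u v - fm k (fm k u0) = (φ (φ u (X u v)) u - φ (fm k u0) u) + (φ (fm k u0) u - fm k (fm k u0)) := by
    rw [ft]; ring
  rw [e]
  refine (norm_add_le _ _).trans (add_le_add (h2.trans ?_) h3)
  linarith
lemma E_hasDeriv (h : Gd φ k g) {t : ℂ} (ht : t ∈ Tb) : HasDerivAt (fun t => 1 + t * k t) (k t + t * deriv k t) t := by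
  have := ((hasDerivAt_id t).mul (h.dk.differentiableAt (Tb_open.mem_nhds ht)).hasDerivAt).const_add 1
  simpa using this
lemma fm_hasDeriv (h : Gd φ k g) {x : ℂ} (hx : x ∈ Dm) :
    HasDerivAt (fm k) ((k (x^2) + x^2 * deriv k (x^2)) * (2 * x)) x := by
  have := (E_hasDeriv h (t := x^2) hx).comp x (hasDerivAt_pow 2 x)
  simp only [Nat.add_one_sub_one, pow_one, Nat.cast_ofNat] at this
  exact this
noncomputable def th0 : ℂ := 4 * (14848/10000) * (13048/10000)
lemma th0_norm : ‖th0‖ = 4 * (14848/10000) * (13048/10000) := by rw [th0]; norm_num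
lemma th0_ne : th0 ≠ 0 := by rw [th0]; norm_num
lemma th_bound (h : Gd φ k g) {c : ℂ} (hc : ‖c‖ <= 1/1000) :
    ∃ th : ℂ, HasDerivAt (fun u => fm k (fm k u)) (th * c) c ∧ ‖th - th0‖ <= 40/100 * ‖th0‖ := by
  have hq := Dq.of_small h (u := c) (by linarith)
  set t := c^2 with ht
  have htn : ‖t‖ <= 1/1000000 := by rw [ht, norm_pow]; nlinarith [norm_nonneg c]
  have htm : t ∈ Tb := hq.mem
  have hfd : HN.dp (fm k c) := by have := hq.d1; rw [HN.dp]; linarith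
  set w := fm k c with hw
  have hw1 : ‖w - 1‖ <= 2/1000000 := by
    rw [hw, fm, add_sub_cancel_left, norm_mul]
    have := mul_le_mul htn (h.kb htm) (norm_nonneg _) (by norm_num)
    linarith
  set s := w^2 with hs
  have hs1 : ‖s - 1‖ <= 5/1000000 := by
    have e : s - 1 = (w - 1) * (2 + (w - 1)) := by rw [hs]; ring
    rw [e, norm_mul]
    have := norm_add_le (2:ℂ) (w - 1)
    have h2 : ‖(2:ℂ)‖ = 2 := by norm_num
    nlinarith [norm_nonneg (w - 1), norm_nonneg (2 + (w-1))]
  have hsm : s ∈ Tb := hfd.mem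
  refine ⟨4 * w * (k t + t * deriv k t) * (k s + s * deriv k s), ?_, ?_⟩
  · have := (fm_hasDeriv h hfd.mem).comp c (fm_hasDeriv h hq.mem)
    exact this.congr_deriv (by ring)
  have nine : ‖(9/100:ℂ)‖ = 9/100 := by norm_num
  have a1 : ‖(k t + t * deriv k t) + 14848/10000‖ <= 1552/10000 := by
    have e : (k t + t * deriv k t) + 14848/10000 = (k t - (-(142/100) + 9/100 * (t - 18/25))) + (9/100 * t + t * deriv k t) := by ring
    rw [e]
    refine (norm_add_le _ _).trans ?_
    have h1 := h.hk t htm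
    have h2 := norm_add_le (9/100*t) (t * deriv k t)
    rw [norm_mul, norm_mul, nine] at h2
    have h3 : ‖deriv k t‖ <= (1702/1000) / (6/10) := deriv_bd (c := 18/25) (R := 7/5) h.dk (fun t ht => h.kb ht) (by norm_num) (by
      rw [dist_eq_norm]
      refine lt_of_le_of_lt (add_le_add_left (norm_sub_le _ _) _) ?_
      have : ‖(18/25:ℂ)‖ = 18/25 := by norm_num
      rw [this]; linarith)
    have h4 := mul_le_mul htn h3 (norm_nonneg _) (by norm_num)
    linarith
  have a2 : ‖(k s + s * deriv k s) + 13048/10000‖ <= 2961/10000 := by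
    have hL : DifferentiableOn ℂ (fun t => -(142/100) + 9/100 * (t - 18/25) : ℂ -> ℂ) Tb := by fun_prop
    have hd : deriv (fun t => k t - (-(142/100) + 9/100 * (t - 18/25))) s = deriv k s - 9/100 := by
      have e1 := (h.dk.differentiableAt (Tb_open.mem_nhds hsm)).hasDerivAt
      have e2 : HasDerivAt (fun t => -(142/100) + 9/100 * (t - 18/25) : ℂ -> ℂ) (9/100) s := by
        have := (((hasDerivAt_id s).sub_const (18/25:ℂ)).const_mul (9/100:ℂ)).const_add (-(142/100):ℂ)
        simpa using this
      exact (e1.sub e2).deriv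
    have h3 : ‖deriv k s - 9/100‖ <= (155/1000) / (11/10) := by
      rw [<- hd]
      refine deriv_bd (c := 18/25) (R := 7/5) (h.dk.sub hL) (fun t ht => h.hk t ht) (by norm_num) ?_
      rw [dist_eq_norm]
      have e : s - 18/25 = (s - 1) + 7/25 := by ring
      rw [e]
      refine lt_of_le_of_lt (add_le_add_left (norm_add_le _ _) _) ?_
      have : ‖(7/25:ℂ)‖ = 7/25 := by norm_num
      rw [this]; linarith
    have e : (k s + s * deriv k s) + 13048/10000 = (k s - (-(142/100) + 9/100 * (s - 18/25))) +
        (18/100 * (s - 1) + ((deriv k s - 9/100) + (s - 1) * (deriv k s - 9/100))) := by ring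
    rw [e]
    refine (norm_add_le _ _).trans ?_
    have h1 := h.hk s hsm
    have h2 := norm_add_le (18/100*(s-1)) ((deriv k s - 9/100) + (s - 1) * (deriv k s - 9/100))
    have h4 := norm_add_le (deriv k s - 9/100) ((s - 1) * (deriv k s - 9/100))
    have h5 := mul_le_mul hs1 h3 (norm_nonneg _) (by norm_num)
    have n18 : ‖(18/100:ℂ)‖ = 18/100 := by norm_num
    rw [norm_mul, n18] at h2
    rw [norm_mul] at h4
    linarith
  set A := k t + t * deriv k t
  set B := k s + s * deriv k s
  have e : 4 * w * A * B - th0 = 4 * (((w - 1) * ((A + 14848/10000) - 14848/10000)) * ((B + 13048/10000) - 13048/10000)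
      - (A + 14848/10000) * (13048/10000) - (14848/10000) * (B + 13048/10000) + (A + 14848/10000) * (B + 13048/10000)) := by
    rw [th0]; ring
  rw [e, th0_norm, norm_mul]
  have n4 : ‖(4:ℂ)‖ = 4 := by norm_num
  have nA : ‖(14848/10000:ℂ)‖ = 14848/10000 := by norm_num
  have nB : ‖(13048/10000:ℂ)‖ = 13048/10000 := by norm_num
  set α := A + 14848/10000
  set β := B + 13048/10000
  have b1 : ‖((w - 1) * (α - 14848/10000)) * (β - 13048/10000)‖ <= 2/1000000 * 2 * 2 := by
    rw [norm_mul, norm_mul]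
    have x1 := norm_sub_le α (14848/10000)
    have x2 := norm_sub_le β (13048/10000)
    refine mul_le_mul (mul_le_mul hw1 (by linarith) (norm_nonneg _) (by norm_num)) (by linarith) (norm_nonneg _) (by norm_num)
  have b2 : ‖α * (13048/10000)‖ <= 1552/10000 * (13048/10000) := by rw [norm_mul, nB]; gcongr
  have b3 : ‖(14848/10000) * β‖ <= (14848/10000) * (2961/10000) := by rw [norm_mul, nA]; gcongr
  have b4 : ‖α * β‖ <= 1552/10000 * (2961/10000) := by rw [norm_mul]; gcongr
  have c1 := norm_add_le ((w - 1) * (α - 14848/10000) * (β - 13048/10000) - α * (13048/10000) - (14848/10000) * β) (α * β)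
  have c2 := norm_sub_le ((w - 1) * (α - 14848/10000) * (β - 13048/10000) - α * (13048/10000)) ((14848/10000) * β)
  have c3 := norm_sub_le ((w - 1) * (α - 14848/10000) * (β - 13048/10000)) (α * (13048/10000))
  rw [n4]
  linarith
noncomputable def eC (φ X : ℂ -> ℂ -> ℂ) (c : ℂ) : ℂ := c - deriv (fun u => ft φ X u c) c / th0
lemma ft_dOn (h : Gd φ k g) (hX : XF φ X) {v : ℂ} (hv : v ∈ Dm) :
    DifferentiableOn ℂ (fun u => ft φ X u v) (ball 0 (2/10)) := fun u hu => by
  have hq := Dq.of_small h (u := u) (mem_ball_zero_iff.1 hu).le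
  exact (hX.dft u v hq.lt hv (h.wd hq (hX.dpX u v hq.lt hv).mem).mem).differentiableWithinAt
lemma eC_bd (h : Gd φ k g) (hX : XF φ X) {c : ℂ} (hc : c ∈ ball (0:ℂ) (1/1000)) : ‖eC φ X c‖ <= 47/100 * (1/1000) := by
  rw [mem_ball_zero_iff] at hc
  obtain ⟨th, h1, h2⟩ := th_bound h hc.le
  have hcm : c ∈ Dm := small_mem (by linarith)
  have hcb : c ∈ ball (0:ℂ) (2/10) := by rw [mem_ball_zero_iff]; linarith
  have hfd : DifferentiableOn ℂ (fun u => fm k (fm k u)) (ball 0 (2/10)) := fun u hu => by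
    have hq := Dq.of_small h (u := u) (mem_ball_zero_iff.1 hu).le
    have hd : HN.dp (fm k u) := by have := hq.d1; rw [HN.dp]; linarith
    exact ((fm_hasDeriv h hd.mem).comp u (fm_hasDeriv h hq.mem)).differentiableAt.differentiableWithinAt
  have h3 : ‖deriv (fun u => ft φ X u c - fm k (fm k u)) c‖ <= (320 * T1) / (1/10) := by
    refine deriv_bd (c := 0) (R := 2/10) ((ft_dOn h hX hcm).sub hfd) (fun u hu => ?_) (by norm_num) ?_
    · have hq := Dq.of_small h (u := u) (mem_ball_zero_iff.1 hu).le
      have := h.ffn hX hq hcm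
      rw [sub_self, norm_zero] at this
      linarith
    · rw [dist_zero_right]; linarith
  have h4 : deriv (fun u => ft φ X u c - fm k (fm k u)) c = deriv (fun u => ft φ X u c) c - th * c := by
    have := ((ft_dOn h hX hcm).differentiableAt (isOpen_ball.mem_nhds hcb)).hasDerivAt.sub h1
    exact this.deriv
  rw [h4] at h3
  have e : eC φ X c * th0 = -(c * (th - th0)) - (deriv (fun u => ft φ X u c) c - th * c) := by
    rw [eC]; field_simp [th0_ne]; ring
  have h5 := norm_sub_le (-(c * (th - th0))) (deriv (fun u => ft φ X u c) c - th * c)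
  rw [<- e, norm_neg, norm_mul, norm_mul] at h5
  have h6 : ‖c‖ * ‖th - th0‖ <= 1/1000 * (40/100 * ‖th0‖) := mul_le_mul hc.le h2 (norm_nonneg _) (by norm_num)
  rw [th0_norm] at *
  rw [T1_eq] at h3
  linarith
lemma eC_zero (h : Gd φ k g) (hX : XF φ X) : 11 * ‖eC φ X 0 - 0‖ <= 1200 * T2 := by
  have h0b : (0:ℂ) ∈ ball (0:ℂ) (2/10) := mem_ball_self (by norm_num)
  have hd0 : HasDerivAt (fun x => φ x 0) 0 0 := by
    have e : (fun x => φ x 0) =ᶠ[nhds 0] fun x => fm k x + x^3 * g (x^2) := by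
      filter_upwards [Dm_open.mem_nhds Dm_zero] with x hx
      rw [fm, h.eq x hx]
    refine HasDerivAt.congr_of_eventuallyEq ?_ e
    have a1 := fm_hasDeriv h Dm_zero
    have a2 : DifferentiableAt ℂ (fun x => g (x^2)) 0 := by
      refine DifferentiableAt.comp (0:ℂ) (g := g) ?_ (differentiableAt_pow 2)
      exact h.dg.differentiableAt (Tb_open.mem_nhds Dm_zero)
    have a3 := a1.add ((hasDerivAt_pow 3 (0:ℂ)).mul a2.hasDerivAt)
    exact a3.congr_deriv (by simp)
  have hq0 := Dq.of_small h (u := 0) (by rw [norm_zero]; norm_num)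
  have hd1 : HasDerivAt (fun u => φ (φ u 0) 0) 0 0 := by
    have a1 := ((h.dx Dm_zero).differentiableAt (Dm_open.mem_nhds (h.wd hq0 Dm_zero).mem)).hasDerivAt
    have := HasDerivAt.comp (h₂ := fun x => φ x 0) (h := fun x => φ x 0) (0:ℂ) a1 hd0
    rw [mul_zero] at this
    exact this
  have hfd : DifferentiableOn ℂ (fun u => φ (φ u 0) 0) (ball 0 (2/10)) := fun u hu => by
    have hq := Dq.of_small h (u := u) (mem_ball_zero_iff.1 hu).le
    refine DifferentiableAt.differentiableWithinAt ?_
    exact ((h.dx Dm_zero).differentiableAt (Dm_open.mem_nhds (h.wd hq Dm_zero).mem)).comp u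
      ((h.dx Dm_zero).differentiableAt (Dm_open.mem_nhds hq.mem))
  have h3 : ‖deriv (fun u => ft φ X u 0 - φ (φ u 0) 0) 0‖ <= (81 * T2) / (1/10) := by
    refine deriv_bd (c := 0) (R := 2/10) ((ft_dOn h hX Dm_zero).sub hfd) (fun u hu => ?_) (by norm_num) ?_
    · exact h.hh hX (Dq.of_small h (u := u) (mem_ball_zero_iff.1 hu).le) Dm_zero
    · rw [dist_self]; norm_num
  have h4 : deriv (fun u => ft φ X u 0 - φ (φ u 0) 0) 0 = deriv (fun u => ft φ X u 0) 0 := by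
    have := ((ft_dOn h hX Dm_zero).differentiableAt (isOpen_ball.mem_nhds h0b)).hasDerivAt.sub hd1
    rw [sub_zero] at this
    exact this.deriv
  rw [h4] at h3
  rw [eC, zero_sub, sub_zero, norm_neg, norm_div, th0_norm, <- mul_div_assoc, div_le_iff₀ (by norm_num)]
  have := T2_pos
  linarith
end
noncomputable def rn (φ X : ℂ -> ℂ -> ℂ) (c l : ℂ) (x y : ℂ) : ℂ := (ft φ X (c + l * x) (c + l * y) - c) / l
section
variable {φ X : ℂ -> ℂ -> ℂ} {k g : ℂ -> ℂ} {c l : ℂ}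
lemma l_near (h : Gd φ k g) (hX : XF φ X) (hc : ‖c‖ <= 1200 * T2) (hl : l = ft φ X c c - c) : ‖l - (1 + k 1)‖ <= 2 * T1 := by
  have hc' := hc
  rw [T2_eq] at hc'
  have hq := Dq.of_small h (u := c) (by linarith)
  have h1 := h.hh hX hq hq.mem
  have h2 : ‖φ 1 0 - (1 + k 1)‖ <= T1 := by
    have := h.eq 1 Dm_one
    simp only [one_pow, one_mul] at this
    rw [this, add_sub_cancel_left]
    exact h.hg 1 Tb_one
  have hd1 : HN.dp 1 := by rw [HN.dp]; norm_num
  have h3 : ‖φ c 0 - 1‖ <= 2 * ‖c‖ := by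
    rw [h.eq c hq.mem]
    have e : 1 + c^2 * k (c^2) + c^3 * g (c^2) - 1 = c * (c * k (c^2) + c^2 * g (c^2)) := by ring
    rw [e, norm_mul, mul_comm]
    gcongr
    refine (norm_add_le _ _).trans ?_
    rw [norm_mul, norm_mul, norm_pow]
    have a1 := h.kb (t := c^2) hq.mem
    have a2 := h.hg (c^2) hq.mem
    rw [T1_eq] at a2
    have b1 := mul_le_mul (show ‖c‖ <= 1/10 by linarith) a1 (norm_nonneg _) (by norm_num)
    have b2 := mul_le_mul (show ‖c‖^2 <= 1 by nlinarith [norm_nonneg c]) a2 (norm_nonneg _) (by norm_num)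
    linarith
  have h4 := h.lipx (x' := φ c 0) hd1 (by linarith) Dm_zero
  have e : l - (1 + k 1) = (ft φ X c c - φ (φ c 0) 0) + (φ (φ c 0) 0 - φ 1 0) + (φ 1 0 - (1 + k 1)) - c := by rw [hl]; ring
  rw [e]
  have n1 := norm_sub_le ((ft φ X c c - φ (φ c 0) 0) + (φ (φ c 0) 0 - φ 1 0) + (φ 1 0 - (1 + k 1))) c
  have n2 := norm_add_le ((ft φ X c c - φ (φ c 0) 0) + (φ (φ c 0) 0 - φ 1 0)) (φ 1 0 - (1 + k 1))
  have n3 := norm_add_le (ft φ X c c - φ (φ c 0) 0) (φ (φ c 0) 0 - φ 1 0)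
  have : 1000000 * T2 <= T1 := by rw [T1_eq, T2_eq]; norm_num
  linarith [T1_pos, T2_pos, norm_nonneg c]
lemma Gd.l_bds (h : Gd φ k g) (hl : ‖l - (1 + k 1)‖ <= 2 * T1) : ‖l‖ <= 4051/10000 ∧ 394/1000 <= ‖l‖ := by
  have h1 := h.lm_le
  have h2 := h.lm_ge
  have h3 := norm_add_le (l - (1 + k 1)) (1 + k 1)
  rw [sub_add_cancel] at h3
  have h4 := norm_sub_le l (l - (1 + k 1))
  rw [sub_sub_cancel] at h4
  rw [T1_eq] at hl
  constructor <;> linarith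
lemma Dq.of_x (h : Gd φ k g) (hc : ‖c‖ <= 1200 * T2) (hl : ‖l - (1 + k 1)‖ <= 2 * T1) {x : ℂ} (hx : x ∈ Dm) :
    Dq k (c + l * x) ((1 + k 1) * x) ∧ ‖c + l * x - (1 + k 1) * x‖ <= 3 * T1 := by
  have hn : ‖c + l * x - (1 + k 1) * x‖ <= 3 * T1 := by
    have e : c + l * x - (1 + k 1) * x = c + (l - (1 + k 1)) * x := by ring
    rw [e]
    refine (norm_add_le _ _).trans ?_
    rw [norm_mul]
    have := mul_le_mul hl (nx hx) (norm_nonneg _) (by linarith [T1_pos])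
    have : 1000000 * T2 <= T1 := by rw [T1_eq, T2_eq]; norm_num
    linarith [T1_pos, T2_pos, norm_nonneg c]
  refine ⟨Dq.of_t h (t := x^2) ?_ (hn.trans (by rw [T1_eq]; norm_num)) hx (by ring), hn⟩
  obtain ⟨h1, -⟩ := h.l_bds hl
  refine (norm_add_le _ _).trans_lt ?_
  rw [norm_mul]
  have := mul_le_mul h1 (nx hx) (norm_nonneg _) (by norm_num)
  rw [T2_eq] at hc
  linarith
lemma rn_y (h : Gd φ k g) (hX : XF φ X) (hc : ‖c‖ <= 1200 * T2) (hl : ‖l - (1 + k 1)‖ <= 2 * T1) {x y : ℂ} (hx : x ∈ Dm)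
    (hy : y ∈ Dm) : ‖rn φ X c l x y - rn φ X c l x 0‖ <= T2 := by
  obtain ⟨-, hl1⟩ := h.l_bds hl
  have hq := (Dq.of_x h hc hl hx).1
  have hv := (Dq.of_x h hc hl hy).1.mem
  have hv0 := (Dq.of_x h hc hl Dm_zero).1.mem
  rw [rn, rn, <- sub_div, norm_div, sub_sub_sub_cancel_right, div_le_iff₀ (by linarith)]
  generalize c + l * x = u at *
  generalize c + l * y = v at *
  generalize c + l * 0 = v0 at *
  have a1 := hX.yX u v v0 hq.lt hv hv0
  have d0 := hX.dpX u v0 hq.lt hv0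
  have dv := hX.dpX u v hq.lt hv
  have a2 := h.lipy (y' := X u v) d0 (a1.trans (by rw [T2_eq]; norm_num)) hq.mem
  have hT := T2_pos
  have a3 : ‖φ u (X u v) - φ u (X u v0)‖ <= 17 * T2 * (210 * T2) := a2.trans (by gcongr)
  have a4 := h.lipx (x' := φ u (X u v)) (h.wd hq d0.mem) (a3.trans (by rw [T2_eq]; norm_num)) hq.mem
  rw [ft, ft]
  refine a4.trans ?_
  have : 17 * T2 * (210 * T2) <= T2 * (1/1000) := by rw [T2_eq]; norm_num
  nlinarith
lemma ft_diff (h : Gd φ k g) (hX : XF φ X) {u u0 v : ℂ} (hq : Dq k u u0) (hv : v ∈ Dm) :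
    DifferentiableAt ℂ (fun u => ft φ X u v) u :=
  hX.dft u v hq.lt hv (h.wd hq (hX.dpX u v hq.lt hv).mem).mem
lemma E_lip (h : Gd φ k g) {a b : ℂ} (ha : ‖a - 18/25‖ <= 8685/10000) (hb : ‖b - 18/25‖ <= 8685/10000) :
    ‖(1 + a * k a) - (1 + b * k b)‖ <= 2135/1000 * ‖a - b‖ := by
  have hL : DifferentiableOn ℂ (fun t => -(142/100) + 9/100 * (t - 18/25) : ℂ -> ℂ) Tb := by fun_prop
  have h1 := lip_bd (f := fun t => t * (k t - (-(142/100) + 9/100 * (t - 18/25)))) (c := 18/25) (R := 7/5)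
    (M := 212/100 * (155/1000)) (d := 531/1000) (ρ := 8685/10000) (s := a) (s' := b)
    (differentiableOn_id.mul (h.dk.sub hL)) (fun t ht => by
      rw [norm_mul]; exact mul_le_mul (nt ht) (h.hk t ht) (norm_nonneg _) (by norm_num)) (by norm_num) (by norm_num)
    (by rw [dist_eq_norm]; exact ha) (by rw [dist_eq_norm]; exact hb)
  have e : (1 + a * k a) - (1 + b * k b) = (a * (k a - (-(142/100) + 9/100 * (a - 18/25))) - b * (k b - (-(142/100) + 9/100 * (b - 18/25))))
      + (-(13552/10000) + 9/100 * ((a - 18/25) + (b - 18/25))) * (a - b) := by ring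
  rw [e]
  refine (norm_add_le _ _).trans ?_
  rw [norm_mul]
  have h2 : ‖(-(13552/10000) + 9/100 * ((a - 18/25) + (b - 18/25)) : ℂ)‖ <= 13552/10000 + 9/100 * (2 * (8685/10000)) := by
    refine (norm_add_le _ _).trans ?_
    rw [norm_mul]
    have n1 : ‖(-(13552/10000) : ℂ)‖ = 13552/10000 := by norm_num
    have n2 : ‖(9/100 : ℂ)‖ = 9/100 := by norm_num
    rw [n1, n2]
    have := norm_add_le (a - 18/25) (b - 18/25)
    linarith
  have h3 := mul_le_mul_of_nonneg_right h2 (norm_nonneg (a - b))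
  refine (add_le_add h1 h3).trans ?_
  rw [<- add_mul]
  refine mul_le_mul_of_nonneg_right ?_ (norm_nonneg _)
  norm_num
lemma sq_near {x y : ℂ} {ε : ℝ} (hx : ‖x^2 - 18/25‖ <= 868/1000) (h : ‖y - x‖ <= ε) (hε : ε <= 1/10000) : ‖y^2 - 18/25‖ <= 8685/10000 := by
  have h1 : ‖x‖ <= 127/100 := sq_le_of hx (by norm_num) (by norm_num)
  have e : y^2 - 18/25 = (x^2 - 18/25) + (y - x) * (2 * x + (y - x)) := by ring
  rw [e]
  refine (norm_add_le _ _).trans ?_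
  rw [norm_mul]
  have h2 : ‖2 * x + (y - x)‖ <= 2 * ‖x‖ + ‖y - x‖ := by
    refine (norm_add_le _ _).trans ?_
    rw [norm_mul]; norm_num
  nlinarith [norm_nonneg (y - x), norm_nonneg (2 * x + (y - x))]
lemma odd_main (h : Gd φ k g) {s u0 : ℂ} (hq : Dq k s u0) (hq' : Dq k (-s) (-u0)) (hn : ‖s - u0‖ <= 3 * T1) :
    ‖φ (φ s 0) 0 - φ (φ (-s) 0) 0‖ <= 10765/1000 * (‖s‖^3 * T1) := by
  have hT := T1_pos
  have hTs : T1 <= 1/10^10 := by rw [T1_eq]; norm_num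
  set P := fm k s with hP
  set Q := s^3 * g (s^2) with hQ
  have hQn : ‖Q‖ <= ‖s‖^3 * T1 := by
    rw [hQ, norm_mul, norm_pow]; gcongr; exact h.hg _ hq.mem
  have e1 : φ s 0 = P + Q := by rw [h.eq s hq.mem, hP, fm]
  have e2 : φ (-s) 0 = P - Q := by rw [h.eq _ hq'.mem, hP, hQ, fm]; ring_nf
  have w1 := h.wn hq Dm_zero
  have w2 := h.wn hq' Dm_zero
  have ee : fm k (-u0) = fm k u0 := by rw [fm, fm]; ring_nf
  have hn' : ‖-s - -u0‖ <= 3 * T1 := by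
    have e : -s - -u0 = -(s-u0) := by ring
    rw [e, norm_neg]; exact hn
  rw [ee] at w2
  rw [e1] at w1
  rw [e2] at w2
  set f0 := fm k u0 with hf0
  have hPf : ‖P - f0‖ <= 300 * T1 := by
    have e : P - f0 = (1/2) * ((P + Q - f0) + (P - Q - f0)) := by ring
    rw [e, norm_mul]
    have n := norm_add_le (P + Q - f0) (P - Q - f0)
    have n2 : ‖(1/2:ℂ)‖ = 1/2 := by norm_num
    rw [n2]; linarith
  have hd1 := hq.d1
  rw [<- hf0] at hd1
  have hf0n : ‖f0‖ <= 12603/10000 := sq_le_of hd1 (by norm_num) (by norm_num)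
  have hPn : ‖P‖ <= 12604/10000 := by
    have := norm_add_le (P - f0) f0
    rw [sub_add_cancel] at this
    linarith
  have hPd : HN.dp P := dp_of_near (x := f0) (by linarith) (by linarith)
  have ha := sq_near hd1 (y := P + Q) (ε := 300 * T1) (by linarith) (by linarith)
  have hb := sq_near hd1 (y := P - Q) (ε := 300 * T1) (by linarith) (by linarith)
  have hE := E_lip h ha hb
  have e3 : (P + Q)^2 - (P - Q)^2 = 4 * P * Q := by ring
  rw [e3, norm_mul, norm_mul] at hE
  have n4 : ‖(4:ℂ)‖ = 4 := by norm_num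
  rw [n4] at hE
  have hQs : ‖Q‖ <= 7/100 := by
    refine hQn.trans ?_
    have : ‖s‖^3 <= 1 := pow_le_one₀ (norm_nonneg _) (by have := hq.lt; linarith)
    nlinarith
  have hmd : DifferentiableOn ℂ (fun w => w^3 * g (w^2)) Dm := by
    refine (differentiableOn_pow 3).mul ?_
    exact h.dg.comp (differentiableOn_pow 2) (fun x hx => hx)
  have hm := lip_ctr (f := fun w => w^3 * g (w^2)) (c := P) (s := P + Q) (s' := P - Q) (R := 15/100) (M := 31/10*T1)
    (hmd.mono (dp_ball hPd)) (fun t ht => by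
      have := h.near0 (dp_ball hPd ht)
      rw [h.eq t (dp_ball hPd ht), add_sub_cancel_left] at this
      exact this) (by norm_num) (by rw [dist_eq_norm, add_sub_cancel_left]; linarith)
    (by rw [dist_eq_norm, sub_sub_cancel_left, norm_neg]; linarith)
  have e4 : (P + Q) - (P - Q) = 2 * Q := by ring
  have n2 : ‖(2:ℂ)‖ = 2 := by norm_num
  rw [e4, norm_mul, n2] at hm
  have hin1 : P + Q ∈ Dm := mem_Dm.2 (by linarith)
  have hin2 : P - Q ∈ Dm := mem_Dm.2 (by linarith)
  rw [e1, e2, h.eq _ hin1, h.eq _ hin2]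
  have e5 : (1 + (P + Q)^2 * k ((P + Q)^2) + (P + Q)^3 * g ((P + Q)^2)) - (1 + (P - Q)^2 * k ((P - Q)^2) + (P - Q)^3 * g ((P - Q)^2))
    = ((1 + (P + Q)^2 * k ((P + Q)^2)) - (1 + (P - Q)^2 * k ((P - Q)^2))) +
      ((P + Q)^3 * g ((P + Q)^2) - (P - Q)^3 * g ((P - Q)^2)) := by ring
  rw [e5]
  refine (norm_add_le _ _).trans ((add_le_add hE hm).trans ?_)
  refine le_trans ?_ (mul_le_mul_of_nonneg_left hQn (by norm_num : (0:ℝ) <= 10765/1000))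
  have hQ0 := norm_nonneg Q
  have x1 : ‖P‖ * ‖Q‖ <= 12604/10000 * ‖Q‖ := mul_le_mul_of_nonneg_right hPn hQ0
  have x2 : T1 * ‖Q‖ <= 1/10^10 * ‖Q‖ := mul_le_mul_of_nonneg_right hTs hQ0
  nlinarith
lemma Hlip (h : Gd φ k g) {s u0 d : ℂ} (hq : Dq k s u0) (hd : ‖d‖ <= 1200 * T2) :
    ‖φ (φ (d + s) 0) 0 - φ (φ s 0) 0‖ <= 6241 * (1200 * T2) := by
  have hs : ‖d‖ <= 1/10^10 := hd.trans (by rw [T2_eq]; norm_num)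
  have a1 := h.lipx (x' := d + s) hq.dp (by rw [add_sub_cancel_right]; linarith) Dm_zero
  rw [add_sub_cancel_right] at a1
  have a2 := h.lipx (x' := φ (d + s) 0) (h.wd hq Dm_zero) (by linarith) Dm_zero
  linarith
theorem renorm_fiber (h : Gd φ k g) (hX : XF φ X) (hc : ‖c‖ <= 1200 * T2) (hcd : deriv (fun u => ft φ X u c) c = 0)
    (hl : l = ft φ X c c - c) :
    ∃ k' g' : ℂ -> ℂ, DifferentiableOn ℂ k' Tb ∧ DifferentiableOn ℂ g' Tb ∧
      (∀ x ∈ Dm, rn φ X c l x 0 = 1 + x^2 * k' (x^2) + x^3 * g' (x^2)) ∧ (∀ t ∈ Tb, ‖g' t‖ <= T1) ∧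
      ∀ t ∈ Tb, ‖(1 + t * k' t) * (1 + k 1) - (1 + (1 + (1 + k 1)^2 * t * k ((1 + k 1)^2 * t))^2 *
        k ((1 + (1 + k 1)^2 * t * k ((1 + k 1)^2 * t))^2))‖ <= 2/10^10 := by
  have hln := l_near h hX hc hl
  obtain ⟨hl1, hl2⟩ := h.l_bds hln
  have hT := T1_pos
  have hT2 := T2_pos
  have hTT : 10^18 * T2 <= T1 := by rw [T1_eq, T2_eq]; norm_num
  have hTs : T1 <= 1/10^16 := by rw [T1_eq]
  have hl0 : l ≠ 0 := by intro h0; rw [h0, norm_zero] at hl2; linarith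
  have hcm : c + l * 0 ∈ Dm := (Dq.of_x h hc hln Dm_zero).1.mem
  have hFd : DifferentiableOn ℂ (fun x => rn φ X c l x 0) Dm := fun x hx => by
    have hq := (Dq.of_x h hc hln hx).1
    refine DifferentiableAt.differentiableWithinAt ?_
    unfold rn
    refine DifferentiableAt.div_const (DifferentiableAt.sub_const ?_ _) _
    exact (ft_diff h hX hq hcm).comp x (((differentiableAt_id).const_mul l).const_add c)
  have hF0 : rn φ X c l 0 0 = 1 := by
    rw [rn, mul_zero, add_zero, <- hl, div_self hl0]
  have hF1 : deriv (fun x => rn φ X c l x 0) 0 = 0 := by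
    have hq := (Dq.of_x h hc hln Dm_zero).1
    have a1 := (ft_diff h hX hq hcm).hasDerivAt
    have a2 : HasDerivAt (fun x => c + l * x) (l * 1) (0:ℂ) := ((hasDerivAt_id (0:ℂ)).const_mul l).const_add c
    have a3 := ((a1.comp (0:ℂ) a2).sub_const c).div_const l
    have a4 := a3.deriv
    simp only [mul_zero, add_zero] at a4
    rw [hcd] at a4
    simp only [zero_mul, zero_div] at a4
    have : (fun x => rn φ X c l x 0) = (fun x => (((fun u => ft φ X u c) ∘ fun x => c + l * x) x - c) / l) := by
      funext x; simp [rn]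
    rw [this]; exact a4
  obtain ⟨k', g', hk', hg', heq⟩ := split hFd hF0 hF1
  refine ⟨k', g', hk', hg', heq, ?_, ?_⟩
  · refine max_near (r := 133/100) (by norm_num) hg' fun t ht htd => ?_
    have hxt := sq_root t
    set x := t ^ (1/2:ℂ) with hx
    have hxm : x ∈ Dm := by rw [Dm, mem_ofPred_eq, hxt]; exact ht
    have htn : 61/100 <= ‖t‖ := by
      rw [dist_eq_norm] at htd
      have := norm_sub_le t (18/25)
      have n : ‖(18/25:ℂ)‖ = 18/25 := by norm_num
      linarith
    have hxn : 78/100 <= ‖x‖ := by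
      rw [<- hxt, norm_pow] at htn
      nlinarith [norm_nonneg x]
    have hx3 : 47/100 <= ‖x‖^3 := by
      have := pow_le_pow_left₀ (by norm_num) hxn 3
      linarith
    have p1 := heq x hxm
    have p2 := heq (-x) (Dm_neg hxm)
    have hq := Dq.of_x h hc hln hxm
    have hq' := Dq.of_x h hc hln (Dm_neg hxm)
    have hqs := Dq.of_x h (c := 0) (by rw [norm_zero]; positivity) hln hxm
    have hqs' := Dq.of_x h (c := 0) (by rw [norm_zero]; positivity) hln (Dm_neg hxm)
    rw [zero_add] at hqs hqs'
    have b1 := h.hh hX hq.1 hcm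
    have b2 := h.hh hX hq'.1 hcm
    have b3 := Hlip h hqs.1 hc
    have b4 := Hlip h hqs'.1 hc
    have b5 := odd_main h hqs.1 (by rw [<- mul_neg, <- mul_neg]; exact hqs'.1) hqs.2
    rw [<- mul_neg] at b5
    have e : 2 * l * x^3 * g' (x^2) = (ft φ X (c + l * x) (c + l * 0) - φ (φ (c + l * x) 0) 0)
        - (ft φ X (c + l * -x) (c + l * 0) - φ (φ (c + l * -x) 0) 0)
        + (φ (φ (c + l * x) 0) 0 - φ (φ (l * x) 0) 0) - (φ (φ (c + l * -x) 0) 0 - φ (φ (l * -x) 0) 0)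
        + (φ (φ (l * x) 0) 0 - φ (φ (l * -x) 0) 0) := by
      rw [rn, div_eq_iff hl0] at p1 p2
      rw [neg_sq, neg_pow x 3] at p2
      linear_combination p2 - p1
    have b6 : ‖2 * l * x^3 * g' (x^2)‖ <= 81 * T2 + 81 * T2 + 6241 * (1200 * T2) + 6241 * (1200 * T2) + 10765/1000 * (‖l * x‖^3 * T1) := by
      rw [e]
      refine (norm_add_le _ _).trans (add_le_add ?_ b5)
      refine (norm_sub_le _ _).trans (add_le_add ?_ b4)
      refine (norm_add_le _ _).trans (add_le_add ?_ b3)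
      exact (norm_sub_le _ _).trans (add_le_add b1 b2)
    rw [hxt, norm_mul, norm_mul, norm_mul, norm_mul, norm_pow, mul_pow] at b6
    have n2 : ‖(2:ℂ)‖ = 2 := by norm_num
    rw [n2] at b6
    set L := ‖l‖
    set Y := ‖x‖^3
    set G := ‖g' t‖
    by_contra hcon
    push Not at hcon
    have hLY : 0 < L * Y := by positivity
    have q1 : L * Y * T1 < L * Y * G := mul_lt_mul_of_pos_left hcon hLY
    have q2 : L^3 * Y * T1 <= (1642/10000) * (L * Y * T1) := by
      have : L^2 <= 1642/10000 := by nlinarith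
      have h3 : L^3 * Y * T1 = L^2 * (L * Y * T1) := by ring
      rw [h3]
      exact mul_le_mul_of_nonneg_right this (by positivity)
    have q3 : 18/100 * T1 <= L * Y * T1 := by
      refine mul_le_mul_of_nonneg_right ?_ hT.le
      nlinarith
    nlinarith
  · intro t ht
    have hxt := sq_root t
    set x := t ^ (1/2:ℂ) with hx
    have hxm : x ∈ Dm := by rw [Dm, mem_ofPred_eq, hxt]; exact ht
    have p1 := heq x hxm
    have p2 := heq (-x) (Dm_neg hxm)
    have hq := Dq.of_x h hc hln hxm
    have hq' := Dq.of_x h hc hln (Dm_neg hxm)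
    have b1 := h.ffn hX hq.1 hcm
    have b2 := h.ffn hX hq'.1 hcm
    have ee : ∀ z, fm k (-z) = fm k z := fun z => by rw [fm, fm, neg_sq]
    rw [mul_neg (1 + k 1) x, ee] at b2
    have hn2 := hq'.2
    rw [mul_neg (1 + k 1) x] at hn2
    have ef : fm k (fm k ((1 + k 1) * x)) = 1 + (1 + (1 + k 1)^2 * t * k ((1 + k 1)^2 * t))^2 *
        k ((1 + (1 + k 1)^2 * t * k ((1 + k 1)^2 * t))^2) := by
      simp only [fm]; rw [mul_pow, hxt]
    rw [<- ef]
    set W := fm k (fm k ((1 + k 1) * x))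
    have hWd : HN.dp (fm k ((1 + k 1) * x)) := by have := hq.1.d1; rw [HN.dp]; linarith
    have hWn : ‖W‖ <= 461/100 := h.Eb hWd.mem
    rw [neg_sq, neg_pow x 3] at p2
    rw [rn, div_eq_iff hl0] at p1 p2
    rw [hxt] at p1 p2
    have e1 : (1 + t * k' t) * l - W = (1/2) * ((ft φ X (c + l * x) (c + l * 0) - W) + (ft φ X (c + l * -x) (c + l * 0) - W)) - c := by
      linear_combination -(1/2) * p1 - (1/2) * p2
    have b3 : ‖(1 + t * k' t) * l - W‖ <= 20000 * T1 := by
      rw [e1]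
      refine (norm_sub_le _ _).trans ?_
      rw [norm_mul]
      have n := norm_add_le (ft φ X (c + l * x) (c + l * 0) - W) (ft φ X (c + l * -x) (c + l * 0) - W)
      have n2 : ‖(1/2:ℂ)‖ = 1/2 := by norm_num
      have hq2 := hq.2
      rw [n2]; linarith
    have b4 : ‖1 + t * k' t‖ <= 13 := by
      have n := norm_add_le ((1 + t * k' t) * l - W) W
      rw [sub_add_cancel, norm_mul] at n
      nlinarith [norm_nonneg (1 + t * k' t)]
    have e2 : (1 + t * k' t) * (1 + k 1) - W = ((1 + t * k' t) * l - W) - (1 + t * k' t) * (l - (1 + k 1)) := by ring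
    rw [e2]
    refine (norm_sub_le _ _).trans ?_
    rw [norm_mul]
    have := mul_le_mul b4 hln (norm_nonneg _) (by norm_num)
    linarith
end
set_option linter.unusedSectionVars false
section
variable {E : Type*} [NormedAddCommGroup E] [NormedSpace ℂ E] [CompleteSpace E] {U : Set E} {Φ : E -> ℂ -> ℂ -> ℂ}
structure PF (U : Set E) (Φ : E -> ℂ -> ℂ -> ℂ) : Prop where
  opn : IsOpen U
  an : AnalyticOnNhd ℂ (fun q : E × ℂ × ℂ => Φ q.1 q.2.1 q.2.2) (U ×ˢ (Dm ×ˢ Dm))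
  gd : ∀ p ∈ U, ∃ k g, Gd (Φ p) k g
def WU (U : Set E) : Set (E × ℂ × ℂ) := U ×ˢ (ball (0:ℂ) (6/10) ×ˢ Dm)
lemma WU_open (hU : IsOpen U) : IsOpen (WU U) := hU.prod (isOpen_ball.prod Dm_open)
lemma an_fst {G F H : Type*} [NormedAddCommGroup G] [NormedSpace ℂ G] [NormedAddCommGroup F] [NormedSpace ℂ F] [NormedAddCommGroup H] [NormedSpace ℂ H]
    {f : G -> F × H} {q : G} (h : AnalyticAt ℂ f q) : AnalyticAt ℂ (fun q => (f q).1) q := analyticAt_fst.fun_comp h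
lemma an_snd {G F H : Type*} [NormedAddCommGroup G] [NormedSpace ℂ G] [NormedAddCommGroup F] [NormedSpace ℂ F] [NormedAddCommGroup H] [NormedSpace ℂ H]
    {f : G -> F × H} {q : G} (h : AnalyticAt ℂ f q) : AnalyticAt ℂ (fun q => (f q).2) q := analyticAt_snd.fun_comp h
lemma rt_an {G : Type*} [NormedAddCommGroup G] [NormedSpace ℂ G] {f h : G -> ℂ} {q : G} (hf : AnalyticAt ℂ f q) (hh : AnalyticAt ℂ h q)
    (h1 : ‖f q‖ < 1) (h2 : ‖h q‖ < 1) : AnalyticAt ℂ (fun q => rt (f q) (h q)) q := by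
  unfold rt
  refine AnalyticAt.mul (AnalyticAt.mul ?_ ?_) analyticAt_const
  · exact (analyticAt_const.sub hf).cpow analyticAt_const (slit_one_sub h1)
  · exact (analyticAt_const.add hh).cpow analyticAt_const (slit_one_add h2)
lemma one_sub_ne {u : ℂ} (hu : ‖u‖ < 6/10) : 1 - u ≠ 0 := by
  intro h; have := one_sub_ge hu.le; rw [h, norm_zero] at this; linarith
lemma PF.comp (h : PF U Φ) {G : Type*} [NormedAddCommGroup G] [NormedSpace ℂ G] {f : G -> E} {x y : G -> ℂ} {q : G}
    (hf : AnalyticAt ℂ f q) (hx : AnalyticAt ℂ x q) (hy : AnalyticAt ℂ y q) (h1 : f q ∈ U) (h2 : x q ∈ Dm) (h3 : y q ∈ Dm) :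
    AnalyticAt ℂ (fun q => Φ (f q) (x q) (y q)) q :=
  AnalyticAt.fun_comp (g := fun q : E × ℂ × ℂ => Φ q.1 q.2.1 q.2.2) (f := fun q => (f q, x q, y q))
    (h.an _ ⟨h1, h2, h3⟩) (hf.prod (hx.prod hy))
structure SF (U : Set E) (Φ : E -> ℂ -> ℂ -> ℂ) (S : E × ℂ × ℂ -> ℂ) : Prop where
  an : AnalyticOnNhd ℂ S (WU U)
  bd : ∀ p ∈ U, ∀ u v, ‖u‖ < 6/10 -> v ∈ Dm -> ‖S (p, u, v)‖ <= 47/100*(3/4)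
  eq : ∀ p ∈ U, ∀ u v, ‖u‖ < 6/10 -> v ∈ Dm -> Φ p (rt u (S (p, u, v))) v = u
  un : ∀ p ∈ U, ∀ u v, ‖u‖ < 6/10 -> v ∈ Dm -> ∀ s ∈ ball (0:ℂ) (3/4), Φ p (rt u s) v = u -> s = S (p, u, v)
  yd : ∀ p ∈ U, ∀ u v v', ‖u‖ < 6/10 -> v ∈ Dm -> v' ∈ Dm -> ‖S (p, u, v) - S (p, u, v')‖ <= 55 * T2
theorem exists_S (h : PF U Φ) : ∃ S, SF U Φ S := by
  have key := fix_family (E := E × ℂ × ℂ) (WU_open h.opn) (r := 3/4) (by norm_num)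
    (e := fun q => eX (Φ q.1.1) q.1.2.1 q.1.2.2 q.2) ?_ ?_
  · obtain ⟨S, hS, hS'⟩ := key
    have heq : ∀ p ∈ U, ∀ u v, ‖u‖ < 6/10 -> v ∈ Dm -> ∀ s, (eX (Φ p) u v s = s ↔ Φ p (rt u s) v = u) := by
      intro p hp u v hu hv s
      have := one_sub_ne hu
      rw [eX]
      constructor
      · intro h1
        have h2 : (Φ p (rt u s) v - u) / (1 - u) = 0 := by linear_combination h1
        rw [div_eq_zero_iff] at h2
        rcases h2 with h2 | h2
        · linear_combination h2
        · exact absurd h2 this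
      · intro h1; rw [h1]; simp
    have hm : ∀ p ∈ U, ∀ u v, ‖u‖ < 6/10 -> v ∈ Dm -> (p, u, v) ∈ WU U := fun p hp u v hu hv =>
      ⟨hp, mem_ball_zero_iff.2 hu, hv⟩
    have hbd := fun p hp u v hu hv => (hS' (p, u, v) (hm p hp u v hu hv)).1
    have hin : ∀ p ∈ U, ∀ u v, ‖u‖ < 6/10 -> v ∈ Dm -> S (p, u, v) ∈ ball (0:ℂ) (3/4) := fun p hp u v hu hv => by
      rw [mem_ball_zero_iff]; have := hbd p hp u v hu hv; linarith
    have he := fun p hp u v hu hv => (heq p hp u v hu hv _).1 (hS' (p, u, v) (hm p hp u v hu hv)).2.1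
    refine ⟨S, hS, hbd, he, fun p hp u v hu hv s hs hss => ?_, fun p hp u v v' hu hv hv' => ?_⟩
    · exact (hS' (p, u, v) (hm p hp u v hu hv)).2.2.2 s hs ((heq p hp u v hu hv s).2 hss)
    · have h1 := (hS' (p, u, v) (hm p hp u v hu hv)).2.2.1 _ (hin p hp u v' hu hv') (hbd p hp u v' hu hv')
      have h2 : eX (Φ p) u v (S (p, u, v')) - S (p, u, v') = (Φ p (rt u (S (p, u, v'))) v - Φ p (rt u (S (p, u, v'))) v') / (1 - u) := by
        rw [he p hp u v' hu hv', eX]; ring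
      simp only [h2] at h1
      obtain ⟨k, g, hG⟩ := h.gd p hp
      have hr := rt_mem hu (hin p hp u v' hu hv')
      have a1 := hG.hy _ hr v hv
      have a2 := hG.hy _ hr v' hv'
      have a3 := norm_sub_le (Φ p (rt u (S (p, u, v'))) v - Φ p (rt u (S (p, u, v'))) 0) (Φ p (rt u (S (p, u, v'))) v' - Φ p (rt u (S (p, u, v'))) 0)
      rw [sub_sub_sub_cancel_right] at a3
      have a4 := one_sub_ge hu.le
      refine h1.trans ?_
      rw [norm_div]
      have : ‖Φ p (rt u (S (p, u, v'))) v - Φ p (rt u (S (p, u, v'))) v'‖ / ‖1 - u‖ <= 5 * T2 := by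
        rw [div_le_iff₀ (by linarith)]
        nlinarith [T2_pos]
      linarith
  · rintro ⟨⟨p, u, v⟩, s⟩ ⟨⟨hp, hu, hv⟩, hs⟩
    simp only at hp hu hv hs
    have hu' := mem_ball_zero_iff.1 hu
    have hs' := mem_ball_zero_iff.1 hs
    unfold eX
    have a1 : AnalyticAt ℂ (fun q : (E × ℂ × ℂ) × ℂ => q.1.1) ((p, u, v), s) := an_fst (an_fst analyticAt_id)
    have a2 : AnalyticAt ℂ (fun q : (E × ℂ × ℂ) × ℂ => q.1.2.1) ((p, u, v), s) := an_fst (an_snd (an_fst analyticAt_id))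
    have a3 : AnalyticAt ℂ (fun q : (E × ℂ × ℂ) × ℂ => q.1.2.2) ((p, u, v), s) := an_snd (an_snd (an_fst analyticAt_id))
    have a4 : AnalyticAt ℂ (fun q : (E × ℂ × ℂ) × ℂ => q.2) ((p, u, v), s) := an_snd analyticAt_id
    refine a4.add (AnalyticAt.div (AnalyticAt.sub (h.comp a1 (rt_an a2 a4 ?_ ?_) a3 hp (rt_mem hu' hs) hv) a2) (analyticAt_const.sub a2) (one_sub_ne hu'))
    · simp only; linarith
    · simp only; linarith
  · rintro ⟨p, u, v⟩ ⟨hp, hu, hv⟩ s hs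
    obtain ⟨k, g, hG⟩ := h.gd p hp
    exact eX_bd hG (mem_ball_zero_iff.1 hu) hv hs
noncomputable def XS (S : E × ℂ × ℂ -> ℂ) (p : E) (u v : ℂ) : ℂ := rt u (S (p, u, v))
lemma XS_an {S : E × ℂ × ℂ -> ℂ} (hS : SF U Φ S) {G : Type*} [NormedAddCommGroup G] [NormedSpace ℂ G] {f : G -> E} {x y : G -> ℂ} {q : G}
    (hf : AnalyticAt ℂ f q) (hx : AnalyticAt ℂ x q) (hy : AnalyticAt ℂ y q) (h1 : f q ∈ U) (h2 : ‖x q‖ < 6/10) (h3 : y q ∈ Dm) :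
    AnalyticAt ℂ (fun q => XS S (f q) (x q) (y q)) q := by
  unfold XS
  refine rt_an hx ?_ (by linarith) (by have := hS.bd _ h1 _ _ h2 h3; linarith)
  exact AnalyticAt.fun_comp (g := S) (f := fun q => (f q, x q, y q)) (hS.an _ ⟨h1, mem_ball_zero_iff.2 h2, h3⟩) (hf.prod (hx.prod hy))
lemma ft_an (h : PF U Φ) {S : E × ℂ × ℂ -> ℂ} (hS : SF U Φ S) {G : Type*} [NormedAddCommGroup G] [NormedSpace ℂ G] {f : G -> E} {x y : G -> ℂ} {q : G}
    (hf : AnalyticAt ℂ f q) (hx : AnalyticAt ℂ x q) (hy : AnalyticAt ℂ y q) (h1 : f q ∈ U) (h2 : ‖x q‖ < 6/10) (h3 : y q ∈ Dm)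
    (h4 : Φ (f q) (x q) (XS S (f q) (x q) (y q)) ∈ Dm) :
    AnalyticAt ℂ (fun q => ft (Φ (f q)) (XS S (f q)) (x q) (y q)) q := by
  unfold ft
  have hm := (rt_dp h2 (hS.bd _ h1 _ _ h2 h3)).mem
  exact h.comp hf (h.comp hf hx (XS_an hS hf hx hy h1 h2 h3) h1 (small_mem h2.le) hm) hx h1 h4 (small_mem h2.le)
lemma XS_XF (h : PF U Φ) {S : E × ℂ × ℂ -> ℂ} (hS : SF U Φ S) {p : E} (hp : p ∈ U) : XF (Φ p) (XS S p) where
  dpX u v hu hv := rt_dp hu (hS.bd p hp u v hu hv)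
  yX u v v' hu hv hv' := by
    have h1 := rt_lip hu (hS.bd p hp u v hu hv) (hS.bd p hp u v' hu hv')
    have h2 := hS.yd p hp u v v' hu hv hv'
    unfold XS
    linarith [T2_pos]
  dft u v hu hv hm := by
    have := ft_an h hS (G := ℂ) (f := fun _ => p) (x := fun u => u) (y := fun _ => v) (q := u) analyticAt_const analyticAt_id analyticAt_const hp hu hv hm
    exact this.differentiableAt
structure CF (U : Set E) (Φ : E -> ℂ -> ℂ -> ℂ) (S : E × ℂ × ℂ -> ℂ) (c l : E -> ℂ) : Prop where
  anc : AnalyticOnNhd ℂ c U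
  anl : AnalyticOnNhd ℂ l U
  bd : ∀ p ∈ U, ‖c p‖ <= 1200 * T2
  crit : ∀ p ∈ U, deriv (fun u => ft (Φ p) (XS S p) u (c p)) (c p) = 0
  un : ∀ p ∈ U, ∀ s ∈ ball (0:ℂ) (1/1000), deriv (fun u => ft (Φ p) (XS S p) u s) s = 0 -> s = c p
  leq : ∀ p ∈ U, l p = ft (Φ p) (XS S p) (c p) (c p) - c p
lemma small_facts (h : PF U Φ) {S : E × ℂ × ℂ -> ℂ} (hS : SF U Φ S) {p : E} (hp : p ∈ U) {u v : ℂ} (hu : ‖u‖ <= 2/10) (hv : v ∈ Dm) :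
    Φ p u (XS S p u v) ∈ Dm := by
  obtain ⟨k, g, hG⟩ := h.gd p hp
  have hq := Dq.of_small hG hu
  exact (hG.wd hq ((XS_XF h hS hp).dpX u v hq.lt hv).mem).mem
theorem exists_C (h : PF U Φ) {S : E × ℂ × ℂ -> ℂ} (hS : SF U Φ S) : ∃ c l, CF U Φ S c l := by
  have key := fix_family (E := E) h.opn (r := 1/1000) (by norm_num)
    (e := fun q => eC (Φ q.1) (XS S q.1) q.2) ?_ ?_
  · obtain ⟨c, hc, hc'⟩ := key
    have hiff : ∀ p s, eC (Φ p) (XS S p) s = s ↔ deriv (fun u => ft (Φ p) (XS S p) u s) s = 0 := by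
      intro p s
      rw [eC]
      constructor
      · intro h1
        have h2 : deriv (fun u => ft (Φ p) (XS S p) u s) s / th0 = 0 := by linear_combination -h1
        rcases div_eq_zero_iff.1 h2 with h3 | h3
        · exact h3
        · exact absurd h3 th0_ne
      · intro h1; rw [h1]; simp
    have hb : ∀ p ∈ U, ‖c p‖ <= 1200 * T2 := fun p hp => by
      obtain ⟨k, g, hG⟩ := h.gd p hp
      have h1 := (hc' p hp).2.2.1 0 (by simp) (by norm_num)
      rw [sub_zero] at h1
      exact h1.trans (eC_zero hG (XS_XF h hS hp))
    have hb' : ∀ p ∈ U, ‖c p‖ <= 2/10 := fun p hp => (hb p hp).trans (by rw [T2_eq]; norm_num)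
    refine ⟨c, fun p => ft (Φ p) (XS S p) (c p) (c p) - c p, hc, ?_, hb, ?_, ?_, fun _ _ => rfl⟩
    · intro p hp
      have hcm := small_mem (show ‖c p‖ <= 6/10 by linarith [hb' p hp])
      exact (ft_an h hS (f := fun p => p) analyticAt_id (hc p hp) (hc p hp) hp (by have := hb' p hp; linarith) hcm
        (small_facts h hS hp (hb' p hp) hcm)).sub (hc p hp)
    · exact fun p hp => (hiff p _).1 (hc' p hp).2.1
    · exact fun p hp s hs hd => (hc' p hp).2.2.2 s hs ((hiff p s).2 hd)
  · rintro ⟨p, s⟩ ⟨hp, hs⟩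
    simp only at hp hs
    have hs' := mem_ball_zero_iff.1 hs
    have hsm := small_mem (show ‖s‖ <= 6/10 by linarith)
    set G : E × ℂ × ℂ -> ℂ := fun q => ft (Φ q.1) (XS S q.1) q.2.1 q.2.2 with hG
    have hGa : ∀ p ∈ U, ∀ u v, ‖u‖ <= 2/10 -> v ∈ Dm -> AnalyticAt ℂ G (p, u, v) := fun p hp u v hu hv => by
      refine ft_an h hS (f := fun q : E × ℂ × ℂ => q.1) (x := fun q => q.2.1) (y := fun q => q.2.2) (an_fst analyticAt_id) (an_fst (an_snd analyticAt_id)) (an_snd (an_snd analyticAt_id)) hp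
        (by simp only; linarith) hv (small_facts h hS hp hu hv)
    have h1 : AnalyticAt ℂ (fun q : E × ℂ => q.2 - (fderiv ℂ G (q.1, q.2, q.2)) (0, 1, 0) / th0) (p, s) := by
      have a1 : AnalyticAt ℂ (fun q : E × ℂ => fderiv ℂ G (q.1, q.2, q.2)) (p, s) :=
        AnalyticAt.fun_comp (g := fderiv ℂ G) (f := fun q : E × ℂ => (q.1, q.2, q.2)) (hGa p hp s s (by linarith) hsm).fderiv ((an_fst analyticAt_id).prod ((an_snd analyticAt_id).prod (an_snd analyticAt_id)))
      have a2 : AnalyticAt ℂ (fun q : E × ℂ => (fderiv ℂ G (q.1, q.2, q.2)) (0, 1, 0)) (p, s) := ((ContinuousLinearMap.apply ℂ ℂ ((0:E), (1:ℂ), (0:ℂ))).analyticAt _).fun_comp a1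
      exact AnalyticAt.sub (an_snd analyticAt_id) (a2.div analyticAt_const th0_ne)
    refine h1.congr ?_
    have hop : IsOpen (U ×ˢ ball (0:ℂ) (1/1000)) := h.opn.prod isOpen_ball
    filter_upwards [hop.mem_nhds (show (p, s) ∈ _ from ⟨hp, hs⟩)]
    rintro ⟨p, s⟩ ⟨hp, hs⟩
    simp only at hp hs ⊢
    have hs' := mem_ball_zero_iff.1 hs
    have hsm := small_mem (show ‖s‖ <= 6/10 by linarith)
    have hd := (hGa p hp s s (by linarith) hsm).differentiableAt.hasFDerivAt
    have hd2 : HasDerivAt (fun u : ℂ => (p, u, s)) ((0:E), (1:ℂ), (0:ℂ)) s := (hasDerivAt_const _ _).prodMk ((hasDerivAt_id s).prodMk (hasDerivAt_const _ _))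
    have hd3 := (hd.comp_hasDerivAt s hd2).deriv
    have e : (G ∘ fun u : ℂ => (p, u, s)) = fun u => ft (Φ p) (XS S p) u s := rfl
    rw [e] at hd3
    rw [eC, hd3]
  · intro p hp s hs
    obtain ⟨k, g, hG⟩ := h.gd p hp
    exact eC_bd hG (XS_XF h hS hp) hs
end
set_option linter.unusedSectionVars false
open scoped ComplexConjugate
lemma nconj (z : ℂ) : ‖conj z‖ = ‖z‖ := RCLike.norm_conj z
lemma Dm_conj {x : ℂ} (hx : x ∈ Dm) : conj x ∈ Dm := by
  rw [mem_Dm] at *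
  have : (conj x)^2 - 18/25 = conj (x^2 - 18/25) := by simp [Complex.conj_ofNat]
  rw [this, nconj]; exact hx
lemma half_conj {z : ℂ} (hz : z ∈ Complex.slitPlane) : (conj z) ^ (1/2:ℂ) = conj (z ^ (1/2:ℂ)) := by
  rw [Complex.conj_cpow _ _ (Complex.mem_slitPlane_iff_arg.1 hz).1]
  congr 2
  simp [Complex.conj_ofNat]
lemma rt_conj {u S : ℂ} (hu : ‖u‖ < 1) (hS : ‖S‖ < 1) : rt (conj u) (conj S) = conj (rt u S) := by
  unfold rt
  rw [map_mul, map_mul, <- half_conj (slit_one_sub hu), <- half_conj (slit_one_add hS), <- half_conj]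
  · simp [Complex.conj_ofNat]
  · rw [Complex.mem_slitPlane_iff]; left; norm_num
section
variable {E : Type*} [NormedAddCommGroup E] [NormedSpace ℂ E] [CompleteSpace E] {U : Set E} {Φ : E -> ℂ -> ℂ -> ℂ}
  {S : E × ℂ × ℂ -> ℂ} {c l : E -> ℂ} {σ : E -> E}
structure Sym (U : Set E) (σ : E -> E) (Φ : E -> ℂ -> ℂ -> ℂ) : Prop where
  mem : ∀ p ∈ U, σ p ∈ U
  eq : ∀ p ∈ U, ∀ x ∈ Dm, ∀ y ∈ Dm, Φ (σ p) (conj x) (conj y) = conj (Φ p x y)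
lemma S_sym (hs : Sym U σ Φ) (hS : SF U Φ S) {p : E} (hp : p ∈ U) {u v : ℂ} (hu : ‖u‖ < 6/10) (hv : v ∈ Dm) :
    S (σ p, conj u, conj v) = conj (S (p, u, v)) := by
  have hb := hS.bd p hp u v hu hv
  refine (hS.un (σ p) (hs.mem p hp) (conj u) (conj v) (by rwa [nconj]) (Dm_conj hv) _ ?_ ?_).symm
  · rw [mem_ball_zero_iff, nconj]; linarith
  · rw [rt_conj (by linarith) (by linarith), hs.eq p hp _ (rt_dp hu hb).mem v hv, hS.eq p hp u v hu hv]
lemma XS_sym (hs : Sym U σ Φ) (hS : SF U Φ S) {p : E} (hp : p ∈ U) {u v : ℂ} (hu : ‖u‖ < 6/10) (hv : v ∈ Dm) :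
    XS S (σ p) (conj u) (conj v) = conj (XS S p u v) := by
  have hb := hS.bd p hp u v hu hv
  rw [XS, XS, S_sym hs hS hp hu hv, rt_conj (by linarith) (by linarith)]
lemma ft_sym (hs : Sym U σ Φ) (hS : SF U Φ S) {p : E} (hp : p ∈ U) {u v : ℂ} (hu : ‖u‖ < 6/10) (hv : v ∈ Dm)
    (hm : Φ p u (XS S p u v) ∈ Dm) :
    ft (Φ (σ p)) (XS S (σ p)) (conj u) (conj v) = conj (ft (Φ p) (XS S p) u v) := by
  have hX : XS S p u v ∈ Dm := (rt_dp hu (hS.bd p hp u v hu hv)).mem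
  have hu' := small_mem hu.le
  rw [ft, ft, XS_sym hs hS hp hu hv, hs.eq p hp u hu' _ hX, hs.eq p hp _ hm u hu']
lemma CF.sm (hC : CF U Φ S c l) {p : E} (hp : p ∈ U) : ‖c p‖ < 1/1000 :=
  (hC.bd p hp).trans_lt (by rw [T2_eq]; norm_num)
lemma c_sym (h : PF U Φ) (hs : Sym U σ Φ) (hS : SF U Φ S) (hC : CF U Φ S c l) {p : E} (hp : p ∈ U) : c (σ p) = conj (c p) := by
  have hsm := hC.sm hp
  have hcm := small_mem (show ‖c p‖ <= 6/10 by linarith)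
  refine (hC.un (σ p) (hs.mem p hp) _ (by rw [mem_ball_zero_iff, nconj]; exact hsm) ?_).symm
  obtain ⟨k, g, hG⟩ := h.gd p hp
  have hd : HasDerivAt (fun u => ft (Φ p) (XS S p) u (c p)) 0 (c p) := by
    rw [<- hC.crit p hp]
    exact ((XS_XF h hS hp).dft _ _ (by linarith) hcm (small_facts h hS hp (by linarith) hcm)).hasDerivAt
  have hd2 := hd.conj_conj
  rw [map_zero] at hd2
  refine (hd2.congr_of_eventuallyEq ?_).deriv
  have hop : conj (c p) ∈ ball (0:ℂ) (2/10) := by rw [mem_ball_zero_iff, nconj]; linarith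
  filter_upwards [isOpen_ball.mem_nhds hop] with w hw
  rw [mem_ball_zero_iff] at hw
  have hw' : ‖conj w‖ <= 2/10 := by rw [nconj]; exact hw.le
  have := ft_sym hs hS hp (u := conj w) (v := c p) (by linarith) hcm (small_facts h hS hp hw' hcm)
  rw [Complex.conj_conj] at this
  simpa using this
lemma l_sym (h : PF U Φ) (hs : Sym U σ Φ) (hS : SF U Φ S) (hC : CF U Φ S c l) {p : E} (hp : p ∈ U) : l (σ p) = conj (l p) := by
  have hsm := hC.sm hp
  have hcm := small_mem (show ‖c p‖ <= 6/10 by linarith)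
  rw [hC.leq _ (hs.mem p hp), hC.leq p hp, c_sym h hs hS hC hp, map_sub,
    ft_sym hs hS hp (by linarith) hcm (small_facts h hS hp (by linarith) hcm)]
noncomputable def RN (Φ : E -> ℂ -> ℂ -> ℂ) (S : E × ℂ × ℂ -> ℂ) (c l : E -> ℂ) (p : E) : ℂ -> ℂ -> ℂ :=
  rn (Φ p) (XS S p) (c p) (l p)
lemma dom_facts (h : PF U Φ) (hS : SF U Φ S) (hC : CF U Φ S c l) {p : E} (hp : p ∈ U) {x y : ℂ} (hx : x ∈ Dm) (hy : y ∈ Dm) :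
    ‖c p + l p * x‖ < 6/10 ∧ c p + l p * y ∈ Dm ∧ Φ p (c p + l p * x) (XS S p (c p + l p * x) (c p + l p * y)) ∈ Dm := by
  obtain ⟨k, g, hG⟩ := h.gd p hp
  have hXF := XS_XF h hS hp
  have hl := l_near hG hXF (hC.bd p hp) (hC.leq p hp)
  have hq := (Dq.of_x hG (hC.bd p hp) hl hx).1
  have hq' := (Dq.of_x hG (hC.bd p hp) hl hy).1
  exact ⟨hq.lt, hq'.mem, (hG.wd hq (hXF.dpX _ _ hq.lt hq'.mem).mem).mem⟩
lemma l_ne (h : PF U Φ) (hS : SF U Φ S) (hC : CF U Φ S c l) {p : E} (hp : p ∈ U) : l p ≠ 0 := by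
  obtain ⟨k, g, hG⟩ := h.gd p hp
  have := (hG.l_bds (l_near hG (XS_XF h hS hp) (hC.bd p hp) (hC.leq p hp))).2
  intro h0; rw [h0, norm_zero] at this; linarith
lemma RN_an (h : PF U Φ) (hS : SF U Φ S) (hC : CF U Φ S c l) {G : Type*} [NormedAddCommGroup G] [NormedSpace ℂ G] {f : G -> E} {x y : G -> ℂ} {q : G}
    (hf : AnalyticAt ℂ f q) (hx : AnalyticAt ℂ x q) (hy : AnalyticAt ℂ y q) (h1 : f q ∈ U) (h2 : x q ∈ Dm) (h3 : y q ∈ Dm) :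
    AnalyticAt ℂ (fun q => RN Φ S c l (f q) (x q) (y q)) q := by
  obtain ⟨d1, d2, d3⟩ := dom_facts h hS hC h1 h2 h3
  have hc : AnalyticAt ℂ (fun q => c (f q)) q := (hC.anc _ h1).fun_comp hf
  have hl : AnalyticAt ℂ (fun q => l (f q)) q := (hC.anl _ h1).fun_comp hf
  unfold RN rn
  exact ((ft_an h hS hf (hc.add (hl.mul hx)) (hc.add (hl.mul hy)) h1 d1 d2 d3).sub hc).div hl (l_ne h hS hC h1)
lemma RN_sym (h : PF U Φ) (hs : Sym U σ Φ) (hS : SF U Φ S) (hC : CF U Φ S c l) : Sym U σ (RN Φ S c l) where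
  mem := hs.mem
  eq p hp x hx y hy := by
    obtain ⟨d1, d2, d3⟩ := dom_facts h hS hC hp hx hy
    have := ft_sym hs hS hp d1 d2 d3
    rw [map_add, map_add, map_mul, map_mul] at this
    rw [RN, rn, c_sym h hs hS hC hp, l_sym h hs hS hC hp, this, RN, rn, map_div₀, map_sub]
end
def UU (β : ℝ) : Set (ℂ × ℂ) := ball (0:ℂ) 1 ×ˢ ball (0:ℂ) β
lemma UU_open (β : ℝ) : IsOpen (UU β) := isOpen_ball.prod isOpen_ball
def sg (p : ℂ × ℂ) : ℂ × ℂ := (conj p.1, conj p.2)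
lemma sg_mem {β : ℝ} (p : ℂ × ℂ) (hp : p ∈ UU β) : sg p ∈ UU β := by
  obtain ⟨h1, h2⟩ := hp
  rw [mem_ball_zero_iff] at h1 h2
  refine ⟨?_, ?_⟩ <;> rw [mem_ball_zero_iff] <;> simp only [sg, nconj] <;> assumption
structure Fam (β : ℝ) (B : Box) (Φ : ℂ × ℂ -> ℂ -> ℂ -> ℂ) : Prop where
  an : AnalyticOnNhd ℂ (fun q : (ℂ × ℂ) × ℂ × ℂ => Φ q.1 q.2.1 q.2.2) (UU β ×ˢ (Dm ×ˢ Dm))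
  sym : Sym (UU β) sg Φ
  fib : ∀ p ∈ UU β, ∃ k g, InBox B p.1 k ∧ DifferentiableOn ℂ k Tb ∧ DifferentiableOn ℂ g Tb ∧
    (∀ x ∈ Dm, Φ p x 0 = 1 + x^2 * k (x^2) + x^3 * g (x^2)) ∧ (∀ t ∈ Tb, ‖g t‖ <= T1) ∧
    ∀ x ∈ Dm, ∀ y ∈ Dm, ‖Φ p x y - Φ p x 0‖ <= T2
def rp (G : ℂ × ℂ -> ℂ) (p : ℂ × ℂ) : ℂ × ℂ := (G p, p.2)
structure Stp (β : ℝ) (Φ : ℂ × ℂ -> ℂ -> ℂ -> ℂ) (S : (ℂ × ℂ) × ℂ × ℂ -> ℂ) (c l G : ℂ × ℂ -> ℂ) : Prop where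
  pf : PF (UU β) Φ
  sf : SF (UU β) Φ S
  cf : CF (UU β) Φ S c l
  an : AnalyticOnNhd ℂ G (UU β)
  bd : ∀ p ∈ UU β, ‖G p‖ <= 47/100
  sym : ∀ p ∈ UU β, G (sg p) = conj (G p)
theorem fam_step {β : ℝ} {A B : Box} {Φ : ℂ × ℂ -> ℂ -> ℂ -> ℂ} (hA : boundOK A = true) (hAB : stepOK A B = true) (hF : Fam β A Φ) :
    ∃ S c l G, Stp β Φ S c l G ∧ Fam β B (fun p => RN Φ S c l (rp G p)) := by
  obtain ⟨hη, D, hD, hst⟩ := step_sound hAB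
  have hgd : ∀ p ∈ UU β, ∀ k g, InBox A p.1 k ∧ DifferentiableOn ℂ k Tb ∧ DifferentiableOn ℂ g Tb ∧
      (∀ x ∈ Dm, Φ p x 0 = 1 + x^2 * k (x^2) + x^3 * g (x^2)) ∧ (∀ t ∈ Tb, ‖g t‖ <= T1) ∧
      (∀ x ∈ Dm, ∀ y ∈ Dm, ‖Φ p x y - Φ p x 0‖ <= T2) -> Gd (Φ p) k g := by
    rintro p hp k g ⟨h1, h2, h3, h4, h5, h6⟩
    have hz := (mem_ball_zero_iff.1 hp.1).le
    obtain ⟨s1, s2, s3⟩ := (hst p.1 k hz h1).1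
    refine ⟨?_, h2, h3, h4, h5, h6, bound_sound hA hz h1, s1, s2, s3⟩
    rintro ⟨x, y⟩ ⟨hx, hy⟩
    exact AnalyticAt.fun_comp (g := fun q : (ℂ × ℂ) × ℂ × ℂ => Φ q.1 q.2.1 q.2.2) (f := fun q : ℂ × ℂ => (p, q)) (hF.an _ ⟨hp, hx, hy⟩)
      (analyticAt_const.prod analyticAt_id)
  have h : PF (UU β) Φ := ⟨UU_open β, hF.an, fun p hp => by
    obtain ⟨k, g, hk⟩ := hF.fib p hp
    exact ⟨k, g, hgd p hp k g hk⟩⟩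
  obtain ⟨S, hS⟩ := exists_S h
  obtain ⟨c, l, hC⟩ := exists_C h hS
  set zp : ℂ × ℂ -> ℂ := fun p => (1000000000000 * ((RN Φ S c l p 1 0 + RN Φ S c l p (-1) 0) / 2 - 1) - B.a) / B.η with hzp
  have hηc : (B.η : ℂ) ≠ 0 := by exact_mod_cast hη.ne'
  have hDc : (D : ℂ) ≠ 0 := by exact_mod_cast hD.ne'
  have hzpa : AnalyticOnNhd ℂ zp (UU β) := fun p hp => by
    have a1 := RN_an h hS hC (f := fun p => p) (x := fun _ => 1) (y := fun _ => 0) (q := p) analyticAt_id analyticAt_const analyticAt_const hp Dm_one Dm_zero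
    have a2 := RN_an h hS hC (f := fun p => p) (x := fun _ => -1) (y := fun _ => 0) (q := p) analyticAt_id analyticAt_const analyticAt_const hp (Dm_neg Dm_one) Dm_zero
    exact ((analyticAt_const.mul (((a1.add a2).div analyticAt_const two_ne_zero).sub analyticAt_const)).sub analyticAt_const).div analyticAt_const hηc
  have hRs := RN_sym h hF.sym hS hC
  have hzs : ∀ p ∈ UU β, zp (sg p) = conj (zp p) := fun p hp => by
    have a1 := hRs.eq p hp 1 Dm_one 0 Dm_zero
    have a2 := hRs.eq p hp (-1) (Dm_neg Dm_one) 0 Dm_zero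
    simp only [map_one, map_zero, map_neg] at a1 a2
    simp [hzp, a1, a2, Complex.conj_ofNat]
  have main : ∀ p ∈ UU β, ‖zp p - D * p.1‖ <= 47/100 * D - 1 ∧ ∃ k g, InBox B (zp p) k ∧ DifferentiableOn ℂ k Tb ∧ DifferentiableOn ℂ g Tb ∧
      (∀ x ∈ Dm, RN Φ S c l p x 0 = 1 + x^2 * k (x^2) + x^3 * g (x^2)) ∧ (∀ t ∈ Tb, ‖g t‖ <= T1) ∧
      ∀ x ∈ Dm, ∀ y ∈ Dm, ‖RN Φ S c l p x y - RN Φ S c l p x 0‖ <= T2 := by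
    intro p hp
    obtain ⟨k, g, hk⟩ := hF.fib p hp
    have hG := hgd p hp k g hk
    have hX := XS_XF h hS hp
    obtain ⟨k', g', e1, e2, e3, e4, e5⟩ := renorm_fiber hG hX (hC.bd p hp) (hC.crit p hp) (hC.leq p hp)
    have hz := (mem_ball_zero_iff.1 hp.1).le
    have := (hst p.1 k hz hk.1).2 k' e1 (fun t ht _ => e5 t ht) (zp p) ?_
    · exact ⟨this.1, k', g', this.2, e1, e2, e3, e4, fun x hx y hy => rn_y hG hX (hC.bd p hp) (l_near hG hX (hC.bd p hp) (hC.leq p hp)) hx hy⟩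
    · have a1 := e3 1 Dm_one
      have a2 := e3 (-1) (Dm_neg Dm_one)
      have b1 : ((-1:ℂ))^2 = 1 := by norm_num
      have b2 : ((-1:ℂ))^3 = -1 := by norm_num
      rw [b1, b2] at a2
      rw [one_pow, one_pow] at a1
      simp only [hzp, RN, a1, a2]
      congr 2
      ring
  have key := fix_family (UU_open β) (r := 1) one_pos (e := fun q : (ℂ × ℂ) × ℂ => (q.1.1 - (zp (q.2, q.1.2) - D * q.2)) / D) ?_ ?_
  · obtain ⟨G, hGa, hG⟩ := key
    have hbd : ∀ p ∈ UU β, ‖G p‖ <= 47/100 := fun p hp => by have := (hG p hp).1; linarith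
    have hrm : ∀ p ∈ UU β, rp G p ∈ UU β := fun p hp => ⟨mem_ball_zero_iff.2 (by have := hbd p hp; simp only [rp]; linarith), hp.2⟩
    have hze : ∀ p ∈ UU β, zp (rp G p) = p.1 := fun p hp => by
      have := (hG p hp).2.1
      simp only at this
      rw [div_eq_iff hDc] at this
      rw [rp]; linear_combination -this
    have hsy : ∀ p ∈ UU β, G (sg p) = conj (G p) := fun p hp => by
      refine ((hG (sg p) (sg_mem p hp)).2.2.2 _ ?_ ?_).symm
      · rw [mem_ball_zero_iff, nconj]; have := hbd p hp; linarith
      · have a1 := hzs _ (hrm p hp)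
        rw [hze p hp] at a1
        simp only [sg, rp] at a1 ⊢
        rw [a1, div_eq_iff hDc]; ring
    have hrpa : ∀ p ∈ UU β, AnalyticAt ℂ (rp G) p := fun p hp => (hGa p hp).prod (an_snd analyticAt_id)
    refine ⟨S, c, l, G, ⟨h, hS, hC, hGa, hbd, hsy⟩, ?_, ⟨fun p hp => sg_mem p hp, ?_⟩, ?_⟩
    · rintro ⟨p, x, y⟩ ⟨hp, hx, hy⟩
      have b1 : AnalyticAt ℂ (fun q : (ℂ × ℂ) × ℂ × ℂ => rp G q.1) (p, x, y) := (hrpa p hp).fun_comp (an_fst analyticAt_id)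
      exact RN_an h hS hC b1 (an_fst (an_snd analyticAt_id)) (an_snd (an_snd analyticAt_id)) (hrm p hp) hx hy
    · intro p hp x hx y hy
      have : rp G (sg p) = sg (rp G p) := by rw [rp, hsy p hp]; rfl
      simp only [this]
      exact hRs.eq _ (hrm p hp) x hx y hy
    · intro p hp
      have := (main _ (hrm p hp)).2
      rw [hze p hp] at this
      exact this
  · rintro ⟨⟨w, b⟩, z⟩ ⟨⟨hw, hb⟩, hz⟩
    have b1 : AnalyticAt ℂ (fun q : (ℂ × ℂ) × ℂ => zp (q.2, q.1.2)) ((w, b), z) :=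
      AnalyticAt.fun_comp (g := zp) (f := fun q : (ℂ × ℂ) × ℂ => (q.2, q.1.2)) (hzpa (z, b) ⟨hz, hb⟩) ((an_snd analyticAt_id).prod (an_snd (an_fst analyticAt_id)))
    exact ((an_fst (an_fst analyticAt_id)).sub (b1.sub (analyticAt_const.mul (an_snd analyticAt_id)))).div analyticAt_const hDc
  · rintro ⟨w, b⟩ ⟨hw, hb⟩ z hz
    have a1 := (main (z, b) ⟨hz, hb⟩).1
    simp only at a1 ⊢ hw
    rw [mem_ball_zero_iff] at hw
    rw [norm_div, Complex.norm_real, Real.norm_of_nonneg hD.le, div_le_iff₀ hD]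
    have := norm_sub_le w (zp (z, b) - D * z)
    linarith
noncomputable def bt : ℝ := 1 / 10 ^ 37
lemma bt_pos : 0 < bt := by rw [bt]; positivity
noncomputable def az (z : ℂ) : ℂ := (-1401155189092 + 200000000 * z) / 1000000000000
noncomputable def F0 (p : ℂ × ℂ) (x y : ℂ) : ℂ := 1 + az p.1 * x^2 - p.2 * y
lemma fam0 : Fam bt bx0 F0 where
  an := by
    rintro ⟨p, x, y⟩ -
    have a1 : AnalyticAt ℂ (fun q : (ℂ × ℂ) × ℂ × ℂ => q.1.1) (p, x, y) := an_fst (an_fst analyticAt_id)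
    have a2 : AnalyticAt ℂ (fun q : (ℂ × ℂ) × ℂ × ℂ => q.1.2) (p, x, y) := an_snd (an_fst analyticAt_id)
    have a3 : AnalyticAt ℂ (fun q : (ℂ × ℂ) × ℂ × ℂ => q.2.1) (p, x, y) := an_fst (an_snd analyticAt_id)
    have a4 : AnalyticAt ℂ (fun q : (ℂ × ℂ) × ℂ × ℂ => q.2.2) (p, x, y) := an_snd (an_snd analyticAt_id)
    unfold F0 az
    exact (analyticAt_const.add (((analyticAt_const.add (analyticAt_const.mul a1)).div analyticAt_const (by norm_num)).mul (a3.pow 2))).sub (a2.mul a4)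
  sym := ⟨fun p hp => sg_mem p hp, fun p hp x hx y hy => by simp [F0, az, sg, Complex.conj_ofNat]⟩
  fib := by
    intro p hp
    refine ⟨fun _ => az p.1, fun _ => 0, ⟨fun _ => 0, fun _ => 0, ?_, ?_, ?_⟩, differentiableOn_const _, differentiableOn_const _, ?_, ?_, ?_⟩
    · simp
    · simp
    · intro τ _
      simp only [bx0, sigS, az]
      push_cast
      ring
    · intro x hx; simp only [F0]; ring
    · intro t ht; rw [norm_zero]; exact T1_pos.le
    · intro x hx y hy
      have e : F0 p x y - F0 p x 0 = -(p.2 * y) := by simp only [F0]; ring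
      rw [e, norm_neg, norm_mul]
      have h1 := (mem_ball_zero_iff.1 hp.2).le
      have := mul_le_mul h1 (nx hy) (norm_nonneg _) bt_pos.le
      refine this.trans ?_
      rw [bt, T2_eq]; norm_num
def Bn : ℕ -> Box
  | 0 => bx0
  | 1 => bx1
  | 2 => bx2
  | 3 => bx3
  | 4 => bx4
  | _ => bx5
lemma Bn_bd : ∀ n, boundOK (Bn n) = true
  | 0 => b0
  | 1 => b1
  | 2 => b2
  | 3 => b3
  | 4 => b4
  | _ + 5 => b5
lemma Bn_st : ∀ n, stepOK (Bn n) (Bn (n+1)) = true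
  | 0 => c01
  | 1 => c12
  | 2 => c23
  | 3 => c34
  | 4 => c45
  | _ + 5 => c55
structure Tow (Φ : ℕ -> ℂ × ℂ -> ℂ -> ℂ -> ℂ) (S : ℕ -> (ℂ × ℂ) × ℂ × ℂ -> ℂ) (c l G : ℕ -> ℂ × ℂ -> ℂ) : Prop where
  zero : Φ 0 = F0
  fam : ∀ n, Fam bt (Bn n) (Φ n)
  stp : ∀ n, Stp bt (Φ n) (S n) (c n) (l n) (G n)
  succ : ∀ n, Φ (n+1) = fun p => RN (Φ n) (S n) (c n) (l n) (rp (G n) p)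
theorem exists_tow : ∃ Φ S c l G, Tow Φ S c l G := by
  have hs : ∀ n (Φ : {Φ // Fam bt (Bn n) Φ}), ∃ S c l G, Stp bt Φ.1 S c l G ∧ Fam bt (Bn (n+1)) (fun p => RN Φ.1 S c l (rp G p)) :=
    fun n Φ => fam_step (Bn_bd n) (Bn_st n) Φ.2
  choose S c l G h1 h2 using hs
  let F : ∀ n, {Φ // Fam bt (Bn n) Φ} := fun n => Nat.rec ⟨F0, fam0⟩ (fun n Φ => ⟨_, h2 n Φ⟩) n
  exact ⟨fun n => (F n).1, fun n => S n (F n), fun n => c n (F n), fun n => l n (F n), fun n => G n (F n),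
    rfl, fun n => (F n).2, fun n => h1 n (F n), fun n => rfl⟩
def it (G : ℕ -> ℂ × ℂ -> ℂ) : ℕ -> ℕ -> ℂ -> ℂ
  | 0, _, _ => 0
  | m+1, n, b => G n (it G m (n+1) b, b)
theorem exists_lim {G : ℕ -> ℂ × ℂ -> ℂ} (an : ∀ n, AnalyticOnNhd ℂ (G n) (UU bt)) (bd : ∀ n, ∀ p ∈ UU bt, ‖G n p‖ <= 47/100)
    (sym : ∀ n, ∀ p ∈ UU bt, G n (sg p) = conj (G n p)) :
    ∃ z : ℕ -> ℂ -> ℂ, (∀ n, DifferentiableOn ℂ (z n) (ball 0 bt)) ∧ (∀ n, ∀ b ∈ ball (0:ℂ) bt, ‖z n b‖ <= 47/100) ∧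
      (∀ n, ∀ b ∈ ball (0:ℂ) bt, z n (conj b) = conj (z n b)) ∧ ∀ n, ∀ b ∈ ball (0:ℂ) bt, G n (z (n+1) b, b) = z n b := by
  have hm : ∀ w b : ℂ, ‖w‖ <= 47/100 -> b ∈ ball (0:ℂ) bt -> (w, b) ∈ UU bt := fun w b hw hb =>
    ⟨mem_ball_zero_iff.2 (by simp only; linarith), hb⟩
  have ib : ∀ m n, ∀ b ∈ ball (0:ℂ) bt, ‖it G m n b‖ <= 47/100 := by
    intro m
    induction m with
    | zero => intro n b hb; rw [it, norm_zero]; norm_num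
    | succ m ih => intro n b hb; exact bd n _ (hm _ _ (ih (n+1) b hb) hb)
  have ctr : ∀ n w w' b, ‖w‖ <= 47/100 -> ‖w'‖ <= 47/100 -> b ∈ ball (0:ℂ) bt -> ‖G n (w, b) - G n (w', b)‖ <= 91/100 * ‖w - w'‖ := by
    intro n w w' b hw hw' hb
    have h1 : DifferentiableOn ℂ (fun w => G n (w, b)) (ball 0 1) := fun w hw =>
      ((an n (w, b) ⟨hw, hb⟩).differentiableAt.comp w (differentiableAt_id.prodMk (differentiableAt_const b))).differentiableWithinAt
    have := lip_bd h1 (fun t ht => bd n (t, b) ⟨ht, hb⟩) (d := 52/100) (ρ := 47/100) (by norm_num) (by norm_num)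
      (s := w) (s' := w') (by simpa using hw) (by simpa using hw')
    exact this.trans (mul_le_mul_of_nonneg_right (by norm_num) (norm_nonneg _))
  have step : ∀ m n, ∀ b ∈ ball (0:ℂ) bt, dist (it G m n b) (it G (m+1) n b) <= 1 * (91/100)^m := by
    intro m
    induction m with
    | zero => intro n b hb; rw [it, dist_comm, dist_zero_right]; have := ib 1 n b hb; norm_num; linarith
    | succ m ih =>
      intro n b hb
      rw [it, it, dist_eq_norm]
      refine (ctr n _ _ b (ib _ _ b hb) (ib _ _ b hb) hb).trans ?_
      have := ih (n+1) b hb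
      rw [dist_eq_norm] at this
      rw [pow_succ]; linarith
  have hex : ∀ n b, ∃ a, b ∈ ball (0:ℂ) bt -> Tendsto (fun m => it G m n b) atTop (nhds a) := by
    intro n b
    by_cases hb : b ∈ ball (0:ℂ) bt
    · obtain ⟨a, ha⟩ := cauchySeq_tendsto_of_complete (cauchySeq_of_le_geometric (91/100) 1 (by norm_num) (fun m => step m n b hb))
      exact ⟨a, fun _ => ha⟩
    · exact ⟨0, fun h => absurd h hb⟩
  choose z hz using hex
  have zb : ∀ n, ∀ b ∈ ball (0:ℂ) bt, ‖z n b‖ <= 47/100 := fun n b hb =>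
    le_of_tendsto (hz n b hb).norm (Eventually.of_forall fun m => ib m n b hb)
  refine ⟨z, fun n => ?_, zb, fun n b hb => ?_, fun n b hb => ?_⟩
  · have hd : ∀ m n, DifferentiableOn ℂ (it G m n) (ball 0 bt) := by
      intro m
      induction m with
      | zero => intro n; exact differentiableOn_const (c := (0:ℂ))
      | succ m ih =>
        intro n b hb
        have h1 := (an n _ (hm _ _ (ib m (n+1) b hb) hb)).differentiableAt
        have h2 := ((ih (n+1)).differentiableAt (isOpen_ball.mem_nhds hb)).prodMk differentiableAt_id
        exact (DifferentiableAt.comp (g := G n) (f := fun b => (it G m (n+1) b, b)) b h1 h2).differentiableWithinAt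
    have hu : TendstoUniformlyOn (fun m b => it G m n b) (z n) atTop (ball 0 bt) := by
      rw [Metric.tendstoUniformlyOn_iff]
      intro ε hε
      have h0 : Tendsto (fun m : ℕ => 1 * (91/100:ℝ)^m / (1 - 91/100)) atTop (nhds (1 * 0 / (1 - 91/100))) :=
        ((tendsto_pow_atTop_nhds_zero_of_lt_one (by norm_num) (by norm_num)).const_mul 1).div_const _
      rw [mul_zero, zero_div] at h0
      filter_upwards [h0.eventually (gt_mem_nhds hε)] with m hm b hb
      rw [dist_comm]
      exact (dist_le_of_le_geometric_of_tendsto (91/100) 1 (by norm_num) (fun m => step m n b hb) (hz n b hb) m).trans_lt hm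
    exact hu.tendstoLocallyUniformlyOn.differentiableOn (Eventually.of_forall fun m => hd m n) isOpen_ball
  · have hbc : conj b ∈ ball (0:ℂ) bt := by rw [mem_ball_zero_iff, nconj]; exact mem_ball_zero_iff.1 hb
    have hs : ∀ m n, it G m n (conj b) = conj (it G m n b) := by
      intro m
      induction m with
      | zero => intro n; simp [it]
      | succ m ih =>
        intro n
        rw [it, it, ih, <- sym n _ (hm _ _ (ib m _ b hb) hb)]
        rfl
    refine tendsto_nhds_unique (hz n _ hbc) ?_
    simp_rw [hs]
    exact (Complex.continuous_conj.tendsto _).comp (hz n b hb)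
  · refine tendsto_nhds_unique ?_ ((tendsto_add_atTop_iff_nat 1).2 (hz n b hb))
    rw [tendsto_iff_norm_sub_tendsto_zero]
    have h1 := ((tendsto_iff_norm_sub_tendsto_zero.1 (hz (n+1) b hb)).const_mul (91/100))
    rw [mul_zero] at h1
    refine squeeze_zero (fun _ => norm_nonneg _) (fun m => ?_) h1
    exact ctr n _ _ b (ib _ _ b hb) (zb _ b hb) hb
def I0 : Set ℝ := Icc (-(12/10)) (12/10)
lemma mem_I0 {x : ℝ} : x ∈ I0 ↔ |x| <= 12/10 := by rw [I0, mem_Icc, abs_le]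
lemma I0_sq {x : ℝ} (h : x ∈ I0) : x^2 <= 144/100 := by
  rw [I0, mem_Icc] at h; nlinarith
structure RG (f D : ℝ -> ℝ -> ℝ) : Prop where
  up : ∀ x ∈ I0, ∀ y ∈ I0, f x y <= 1 - x^2 * (13298/10000 - 9/100*x^2) + 1/10^10
  lo : ∀ x ∈ I0, ∀ y ∈ I0, 1 - x^2 * (16398/10000 - 9/100*x^2) - 1/10^10 <= f x y
  dx : ∀ x ∈ I0, ∀ y ∈ I0, HasDerivAt (fun x => f x y) (D x y) x
  Db : ∀ x ∈ I0, ∀ y ∈ I0, |D x y - 2 * x * (-(14848/10000) + 18/100*x^2)| <= 2 * |x| * (155/1000 + 2314/10000*x^2) + 1/10^10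
  ly : ∀ x ∈ I0, ∀ y ∈ I0, ∀ y' ∈ I0, |f x y - f x y'| <= 1/10^6 * |y - y'|
lemma dp_re {x : ℝ} (hx : x ∈ I0) : dp (x:ℂ) := by
  rw [dp]
  have e : ((x:ℂ)^2 - 18/25) = ((x^2 - 18/25 : ℝ) : ℂ) := by push_cast; ring
  rw [e, Complex.norm_real, Real.norm_eq_abs, abs_le]
  have := I0_sq hx
  constructor <;> nlinarith [sq_nonneg x]
section
variable {φ : ℂ -> ℂ -> ℂ} {k g : ℂ -> ℂ}
lemma re_fm (h : Gd φ k g) {x : ℝ} (hx : x ∈ I0) :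
    |(fm k x).re - (1 + x^2 * (-(14848/10000) + 9/100*x^2))| <= 155/1000 * x^2 := by
  have h1 := h.hk ((x:ℂ)^2) (dp_re hx).mem
  have e : (fm k x).re - (1 + x^2 * (-(14848/10000) + 9/100*x^2)) =
      x^2 * (k ((x:ℂ)^2) - (-(142/100) + 9/100 * ((x:ℂ)^2 - 18/25))).re := by
    have : (fm k x) = ((1 + x^2 * (-(14848/10000) + 9/100*x^2) : ℝ) : ℂ) +
        ((x^2:ℝ):ℂ) * (k ((x:ℂ)^2) - (-(142/100) + 9/100 * ((x:ℂ)^2 - 18/25))) := by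
      rw [fm]; push_cast; ring
    rw [this, Complex.add_re, Complex.ofReal_re, Complex.re_ofReal_mul]; ring
  rw [e, abs_mul, abs_of_nonneg (sq_nonneg x), mul_comm]
  exact mul_le_mul_of_nonneg_right ((Complex.abs_re_le_norm _).trans h1) (sq_nonneg x)
lemma re_D (h : Gd φ k g) {x y : ℝ} (hx : x ∈ I0) (hy : y ∈ I0) :
    |(deriv (fun x => φ x y) x).re - 2 * x * (-(14848/10000) + 18/100*x^2)| <= 2 * |x| * (155/1000 + 2314/10000*x^2) + 1/10^10 := by
  have hd := dp_re hx
  have hy' := (dp_re hy).mem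
  set K : ℂ -> ℂ := fun t => k t - (-(142/100) + 9/100 * (t - 18/25)) with hK
  have hKd : DifferentiableOn ℂ K Tb := h.dk.sub (by fun_prop)
  have hds : dist ((x:ℂ)^2) (18/25) <= 72/100 := by
    rw [dist_eq_norm]
    have e : ((x:ℂ)^2 - 18/25) = ((x^2 - 18/25 : ℝ) : ℂ) := by push_cast; ring
    rw [e, Complex.norm_real, Real.norm_eq_abs, abs_le]
    have := I0_sq hx
    constructor <;> nlinarith [sq_nonneg x]
  have h2 : ‖deriv K ((x:ℂ)^2)‖ <= (155/1000) / (67/100) :=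
    deriv_bd hKd h.hk (by norm_num) (by linarith)
  have h1 := h.hk ((x:ℂ)^2) hd.mem
  have hkd : deriv K ((x:ℂ)^2) = deriv k ((x:ℂ)^2) - 9/100 := by
    have a := (h.dk.differentiableAt (Tb_open.mem_nhds hd.mem)).hasDerivAt
    have b := (((hasDerivAt_id ((x:ℂ)^2)).sub_const (18/25)).const_mul (9/100)).const_add (-(142/100) : ℂ)
    have := (a.sub b).deriv
    simp only [id, mul_one] at this
    exact this
  set R : ℂ -> ℂ := fun x => φ x y - fm k x with hR
  have hsub := dp_ball hd
  have hfd : DifferentiableOn ℂ (fm k) Dm := fun z hz => (fm_hasDeriv h hz).differentiableAt.differentiableWithinAt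
  have h3 : ‖deriv R x‖ <= 4*T1 / (14/100) := by
    refine deriv_bd (c := (x:ℂ)) (R := 15/100) (((h.dx hy').sub hfd).mono hsub) (fun t ht => h.near (hsub ht) hy') (by norm_num) ?_
    rw [dist_self]; norm_num
  have a := ((h.dx hy').differentiableAt (Dm_open.mem_nhds hd.mem)).hasDerivAt
  have h4 : deriv R x = deriv (fun x => φ x y) x - _ := (a.sub (fm_hasDeriv h hd.mem)).deriv
  have e : deriv (fun x => φ x y) x = ((2 * x * (-(14848/10000) + 18/100*x^2) : ℝ) : ℂ) +
      (deriv R x + (K ((x:ℂ)^2) + (x:ℂ)^2 * deriv K ((x:ℂ)^2)) * (2 * x)) := by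
    rw [h4, hkd, hK]; push_cast; ring
  rw [e, Complex.add_re, Complex.ofReal_re, add_sub_cancel_left]
  refine (Complex.abs_re_le_norm _).trans ((norm_add_le _ _).trans ?_)
  have h5 : ‖(K ((x:ℂ)^2) + (x:ℂ)^2 * deriv K ((x:ℂ)^2)) * (2 * x)‖ <= (155/1000 + 2314/10000*x^2) * (2*|x|) := by
    rw [norm_mul]
    have e1 : ‖(2 * (x:ℂ))‖ = 2 * |x| := by rw [norm_mul, Complex.norm_real]; norm_num
    rw [e1]
    refine mul_le_mul_of_nonneg_right ((norm_add_le _ _).trans (add_le_add h1 ?_)) (by positivity)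
    rw [norm_mul, norm_pow, Complex.norm_real, Real.norm_eq_abs, sq_abs, mul_comm]
    refine mul_le_mul_of_nonneg_right (h2.trans (by norm_num)) (sq_nonneg x)
  have : 4*T1 / (14/100) <= 1/10^10 := by rw [T1]; norm_num
  linarith
theorem RG_of (h : Gd φ k g) : RG (fun x y : ℝ => (φ x y).re) (fun x y : ℝ => (deriv (fun x => φ x y) (x:ℂ)).re) := by
  have hn : ∀ x ∈ I0, ∀ y ∈ I0, |(φ x y).re - (1 + x^2 * (-(14848/10000) + 9/100*x^2))| <= 155/1000 * x^2 + 1/10^10 := by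
    intro x hx y hy
    have h1 := abs_le.1 (re_fm h hx)
    have h2 := abs_le.1 ((Complex.abs_re_le_norm _).trans (h.near (dp_re hx).mem (dp_re hy).mem))
    rw [Complex.sub_re] at h2
    have h3 : 4 * T1 <= 1/10^10 := by rw [T1]; norm_num
    change _ <= (φ x y).re - (fm k x).re ∧ (φ x y).re - (fm k x).re <= _ at h2
    rw [abs_le]; constructor <;> linarith [h1.1, h1.2, h2.1, h2.2]
  refine ⟨fun x hx y hy => ?_, fun x hx y hy => ?_, fun x hx y hy => ?_, fun x hx y hy => re_D h hx hy, fun x hx y hy y' hy' => ?_⟩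
  · have := (abs_le.1 (hn x hx y hy)).2; linarith
  · have := (abs_le.1 (hn x hx y hy)).1; linarith
  · exact (((h.dx (dp_re hy).mem).differentiableAt (Dm_open.mem_nhds (dp_re hx).mem)).hasDerivAt).real_of_complex
  · have hdy := h.dy (dp_re hx).mem
    have hD : ∀ z ∈ I0, HasDerivWithinAt (fun y : ℝ => (φ x y).re) (deriv (fun y => φ x y) (z:ℂ)).re I0 z := fun z hz =>
      ((hdy.differentiableAt (Dm_open.mem_nhds (dp_re hz).mem)).hasDerivAt).real_of_complex.hasDerivWithinAt
    have hB : ∀ z ∈ I0, ‖(deriv (fun y => φ x y) (z:ℂ)).re‖ <= 1/10^6 := by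
      intro z hz
      refine (Complex.abs_re_le_norm _).trans ?_
      have hsub := dp_ball (dp_re hz)
      have := deriv_bd (f := fun y => φ x y - φ x 0) (c := (z:ℂ)) (s := z) (R := 15/100) (d := 14/100) (M := T2)
        ((hdy.mono hsub).sub_const _) (fun t ht => h.hy x (dp_re hx).mem t (hsub ht)) (by norm_num) (by rw [dist_self]; norm_num)
      rw [deriv_sub_const] at this
      refine this.trans ?_
      rw [T2]; norm_num
    exact (convex_Icc _ _).norm_image_sub_le_of_norm_hasDerivWithin_le hD hB hy' hy
end
structure RR (f D f' X : ℝ -> ℝ -> ℝ) (c l : ℝ) : Prop where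
  g : RG f D
  cb : |c| <= 1/10^6
  l1 : |l| <= 4051/10000
  l2 : 394/1000 <= |l|
  X1 : ∀ u v, |u| <= 49/100 -> |v| <= 49/100 -> X u v ∈ Icc (47/100) (12/10)
  X2 : ∀ u v, |u| <= 49/100 -> |v| <= 49/100 -> f (X u v) v = u
  rel : ∀ x ∈ I0, ∀ y ∈ I0, c + l * f' x y = f (f (c + l * x) (X (c + l * x) (c + l * y))) (c + l * x)
theorem RR_of {U : Set (ℂ × ℂ)} {Φ : ℂ × ℂ -> ℂ -> ℂ -> ℂ} {S : (ℂ × ℂ) × ℂ × ℂ -> ℂ} {c l : ℂ × ℂ -> ℂ}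
    (hP : PF U Φ) (hS : SF U Φ S) (hC : CF U Φ S c l) (hs : Sym U sg Φ) {p : ℂ × ℂ} (hp : p ∈ U) (hpp : sg p = p) :
    ∃ (D X : ℝ -> ℝ -> ℝ) (c' l' : ℝ), RR (fun x y : ℝ => (Φ p x y).re) D (fun x y : ℝ => (RN Φ S c l p x y).re) X c' l' := by
  obtain ⟨k, g, hG⟩ := hP.gd p hp
  have hXF := XS_XF hP hS hp
  have hc : ((c p).re : ℂ) = c p := Complex.conj_eq_iff_re.1 (by rw [<- c_sym hP hs hS hC hp, hpp])
  have hl : ((l p).re : ℂ) = l p := Complex.conj_eq_iff_re.1 (by rw [<- l_sym hP hs hS hC hp, hpp])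
  have hlb := hG.l_bds (l_near hG hXF (hC.bd p hp) (hC.leq p hp))
  have hcn : |(c p).re| = ‖c p‖ := by rw [<- hc, Complex.norm_real, Complex.ofReal_re]; rfl
  have hln : |(l p).re| = ‖l p‖ := by rw [<- hl, Complex.norm_real, Complex.ofReal_re]; rfl
  have hΦ : ∀ x y : ℝ, (x:ℂ) ∈ Dm -> (y:ℂ) ∈ Dm -> ((Φ p x y).re : ℂ) = Φ p x y := fun x y hx hy =>
    Complex.conj_eq_iff_re.1 (by rw [<- hs.eq p hp x hx y hy, hpp, Complex.conj_ofReal, Complex.conj_ofReal])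
  have hX : ∀ u v : ℝ, ‖(u:ℂ)‖ < 6/10 -> (v:ℂ) ∈ Dm -> ((XS S p u v).re : ℂ) = XS S p u v := fun u v hu hv =>
    Complex.conj_eq_iff_re.1 (by rw [<- XS_sym hs hS hp hu hv, hpp, Complex.conj_ofReal, Complex.conj_ofReal])
  have hu6 : ∀ u : ℝ, |u| <= 49/100 -> ‖(u:ℂ)‖ < 6/10 := fun u hu => by
    rw [Complex.norm_real, Real.norm_eq_abs]; linarith
  refine ⟨_, fun u v => (XS S p u v).re, (c p).re, (l p).re, RG_of hG, ?_, ?_, ?_, ?_, ?_, ?_⟩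
  · rw [hcn]; refine (hC.bd p hp).trans ?_; rw [T2]; norm_num
  · rw [hln]; exact hlb.1
  · rw [hln]; exact hlb.2
  · intro u v hu hv
    have hvD := small_mem (hu6 v hv).le
    have hb := hS.bd p hp u v (hu6 u hu) hvD
    have hSr : ((S (p, (u:ℂ), (v:ℂ))).re : ℂ) = S (p, (u:ℂ), (v:ℂ)) :=
      Complex.conj_eq_iff_re.1 (by rw [<- S_sym hs hS hp (hu6 u hu) hvD, hpp, Complex.conj_ofReal, Complex.conj_ofReal])
    set s := (S (p, (u:ℂ), (v:ℂ))).re with hsd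
    have hsb : |s| <= 3525/10000 := by
      rw [<- hSr, Complex.norm_real, Real.norm_eq_abs] at hb; linarith
    have hu0 := hu6 u hu
    rw [abs_le] at hsb hu
    have e : XS S p u v = (((1-u)^(1/2:ℝ) * (1+s)^(1/2:ℝ) * (100/142)^(1/2:ℝ) : ℝ) : ℂ) := by
      rw [XS, rt, <- hSr]
      push_cast
      rw [Complex.ofReal_cpow (by linarith), Complex.ofReal_cpow (by linarith), Complex.ofReal_cpow (by norm_num)]
      push_cast; rfl
    have h0 : 0 <= (XS S p u v).re := by
      rw [e, Complex.ofReal_re]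
      have : 0 <= 1 - u := by linarith
      have : 0 <= 1 + s := by linarith
      positivity
    have hsq : (XS S p u v).re ^ 2 = (1-u)*(1+s)*(100/142) := by
      have h1 : (XS S p u v)^2 = (1-u)*(1+(s:ℂ))*(100/142) := by rw [XS, rt_sq, hSr]
      rw [<- hX u v hu0 hvD] at h1
      refine Complex.ofReal_injective ?_
      push_cast; exact h1
    change 47/100 <= (XS S p u v).re ∧ (XS S p u v).re <= 12/10
    constructor <;> nlinarith [hsb.1, hsb.2, hu.1, hu.2]
  · intro u v hu hv
    have hvD := small_mem (hu6 v hv).le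
    change (Φ p ((XS S p u v).re : ℂ) v).re = u
    rw [hX u v (hu6 u hu) hvD, XS, hS.eq p hp u v (hu6 u hu) hvD, Complex.ofReal_re]
  · intro x hx y hy
    obtain ⟨d1, d2, d3⟩ := dom_facts hP hS hC hp (dp_re hx).mem (dp_re hy).mem
    have el := l_ne hP hS hC hp
    have e1 : c p + l p * RN Φ S c l p x y = ft (Φ p) (XS S p) (c p + l p * x) (c p + l p * y) := by
      rw [RN, rn]; field_simp; ring
    have eu : ∀ x : ℝ, c p + l p * x = (((c p).re + (l p).re * x : ℝ) : ℂ) := fun x => by push_cast; rw [hc, hl]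
    rw [eu] at d1 d2
    rw [eu, eu] at d3
    have hXm := (hXF.dpX _ _ d1 d2).mem
    have e2 := congrArg Complex.re e1
    rw [eu, eu, ft] at e2
    have hXe := hX _ _ d1 d2
    rw [<- hXe] at e2 d3 hXm
    rw [<- hΦ _ _ (small_mem d1.le) hXm] at e2
    rw [<- e2, <- hc, <- hl, Complex.add_re, Complex.re_ofReal_mul]
    simp
open Metric MeasureTheory
def Q0 : Set (ℝ × ℝ) := I0 ×ˢ I0
def Fm (f : ℝ -> ℝ -> ℝ) (q : ℝ × ℝ) : ℝ × ℝ := (f q.1 q.2, q.1)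
def pm (X : ℝ -> ℝ -> ℝ) (c l : ℝ) (q : ℝ × ℝ) : ℝ × ℝ := (c + l * q.1, X (c + l * q.1) (c + l * q.2))
section
variable {f D : ℝ -> ℝ -> ℝ}
lemma RG.P1 (h : RG f D) {x y : ℝ} (hx : x ∈ I0) (hy : y ∈ I0) : -(118/100) <= f x y ∧ f x y <= 1001/1000 := by
  have h1 := h.up x hx y hy
  have h2 := h.lo x hx y hy
  have h3 := I0_sq hx
  have h4 := sq_nonneg x
  generalize x^2 = t at *
  constructor <;> nlinarith
lemma RG.mI (h : RG f D) {x y : ℝ} (hx : x ∈ I0) (hy : y ∈ I0) : f x y ∈ I0 := by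
  have := h.P1 hx hy
  constructor <;> linarith [this.1, this.2]
lemma RG.P2 (h : RG f D) {x y : ℝ} (hx : x ∈ I0) (hy : y ∈ I0) (h' : 47/100 <= |x|) : f x y <= 72/100 := by
  have h1 := h.up x hx y hy
  have h3 := I0_sq hx
  have h4 : 2209/10000 <= x^2 := by rw [<- sq_abs]; nlinarith
  generalize x^2 = t at *
  nlinarith
lemma RG.P3 (h : RG f D) {x y a b : ℝ} (hx : x ∈ I0) (hy : y ∈ I0) (h' : |x| <= a) (ha : a^2 <= 144/100)
    (hab : b <= 1 - a^2 * (16398/10000 - 9/100*a^2) - 1/10^10) : b <= f x y := by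
  have h1 := h.lo x hx y hy
  have h4 : x^2 <= a^2 := by rw [<- sq_abs]; gcongr
  have h5 := sq_nonneg x
  generalize x^2 = t at *
  generalize a^2 = s at *
  nlinarith
lemma RG.D1 (h : RG f D) {x y : ℝ} (hx : x ∈ Icc (47/100) (12/10)) (hy : y ∈ I0) : D x y <= -(105/100) := by
  have h1 := (abs_le.1 (h.Db x ⟨by linarith [hx.1], hx.2⟩ y hy)).2
  rw [abs_of_nonneg (by linarith [hx.1])] at h1
  have h2 : x^2 <= 167/100*x - 564/1000 := by nlinarith [hx.1, hx.2]
  nlinarith [hx.1, hx.2, mul_le_mul_of_nonneg_left h2 (by linarith [hx.1] : 0 <= x)]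
lemma RG.D2 (h : RG f D) {x y : ℝ} (hx : |x| <= 49/100) (hy : y ∈ I0) : |D x y| <= 167/100 := by
  have h1 := (h.Db x (mem_I0.2 (by linarith)) y hy)
  have e : D x y = (D x y - 2 * x * (-(14848/10000) + 18/100*x^2)) + 2 * x * (-(14848/10000) + 18/100*x^2) := by ring
  have h2 : x^2 <= 2401/10000 := by rw [<- sq_abs]; nlinarith [abs_nonneg x]
  rw [e]
  refine (abs_add_le _ _).trans ?_
  have h3 : |2 * x * (-(14848/10000) + 18/100*x^2)| <= 2 * |x| * (14848/10000) := by
    rw [abs_mul, abs_mul, abs_of_nonneg (by norm_num : (0:ℝ) <= 2)]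
    refine mul_le_mul_of_nonneg_left ?_ (by positivity)
    rw [abs_le]; constructor <;> nlinarith [sq_nonneg x]
  nlinarith [abs_nonneg x]
lemma RG.D3 (h : RG f D) {x y : ℝ} (hx : x ∈ I0) (hy : y ∈ I0) : |D x y| <= 5 := by
  have h1 := (h.Db x hx y hy)
  have e : D x y = (D x y - 2 * x * (-(14848/10000) + 18/100*x^2)) + 2 * x * (-(14848/10000) + 18/100*x^2) := by ring
  have h2 := I0_sq hx
  rw [e]
  refine (abs_add_le _ _).trans ?_
  have h3 : |2 * x * (-(14848/10000) + 18/100*x^2)| <= 2 * |x| * (14848/10000) := by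
    rw [abs_mul, abs_mul, abs_of_nonneg (by norm_num : (0:ℝ) <= 2)]
    refine mul_le_mul_of_nonneg_left ?_ (by positivity)
    rw [abs_le]; constructor <;> nlinarith [sq_nonneg x]
  rw [mem_I0] at hx
  nlinarith [abs_nonneg x]
lemma RG.P5 (h : RG f D) {x x' y : ℝ} (hx : x ∈ Icc (47/100) (12/10)) (hx' : x' ∈ Icc (47/100) (12/10)) (hy : y ∈ I0) :
    105/100 * |x - x'| <= |f x y - f x' y| := by
  have hsub : ∀ z ∈ Icc (47/100:ℝ) (12/10), z ∈ I0 := fun z hz => ⟨by linarith [hz.1], hz.2⟩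
  have key : ∀ a ∈ Icc (47/100:ℝ) (12/10), ∀ b ∈ Icc (47/100:ℝ) (12/10), a <= b -> f b y - f a y <= -(105/100) * (b - a) :=
    (convex_Icc (47/100:ℝ) (12/10)).image_sub_le_mul_sub_of_deriv_le
      (fun z hz => (h.dx z (hsub z hz) y hy).continuousAt.continuousWithinAt)
      (fun z hz => (h.dx z (hsub z (interior_subset hz)) y hy).differentiableAt.differentiableWithinAt)
      (fun z hz => by rw [(h.dx z (hsub z (interior_subset hz)) y hy).deriv]; exact h.D1 (interior_subset hz) hy)
  rcases le_total x x' with hle | hle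
  · have := key x hx x' hx' hle
    rw [abs_of_nonpos (by linarith : x - x' <= 0)]
    refine le_trans ?_ (le_abs_self _); linarith
  · have := key x' hx' x hx hle
    rw [abs_of_nonneg (by linarith : 0 <= x - x')]
    refine le_trans ?_ (neg_le_abs _); linarith
lemma RG.uniq (h : RG f D) {x x' y : ℝ} (hx : x ∈ Icc (47/100) (12/10)) (hx' : x' ∈ Icc (47/100) (12/10)) (hy : y ∈ I0)
    (he : f x y = f x' y) : x = x' := by
  have := h.P5 hx hx' hy
  rw [he, sub_self, abs_zero] at this
  have h2 := abs_nonneg (x - x')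
  exact sub_eq_zero.1 (abs_eq_zero.1 (by linarith))
lemma RG.LJ (h : RG f D) {x x' y y' : ℝ} (hx : |x| <= 49/100) (hx' : |x'| <= 49/100) (hy : y ∈ I0) (hy' : y' ∈ I0) :
    |f x y - f x' y'| <= 167/100 * |x - x'| + 1/10^6 * |y - y'| := by
  have hsub : ∀ z ∈ Icc (-(49/100):ℝ) (49/100), z ∈ I0 := fun z hz => ⟨by linarith [hz.1], by linarith [hz.2]⟩
  have h1 : ‖f x y - f x' y‖ <= 167/100 * ‖x - x'‖ := (convex_Icc (-(49/100):ℝ) (49/100)).norm_image_sub_le_of_norm_hasDerivWithin_le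
    (fun z hz => (h.dx z (hsub z hz) y hy).hasDerivWithinAt) (fun z hz => h.D2 (abs_le.2 hz) hy) (abs_le.1 hx') (abs_le.1 hx)
  have h2 := h.ly x' (hsub x' (abs_le.1 hx')) y hy y' hy'
  have := abs_sub_le (f x y) (f x' y) (f x' y')
  simp only [Real.norm_eq_abs] at h1
  linarith
lemma RG.LI (h : RG f D) {x x' y y' : ℝ} (hx : x ∈ I0) (hx' : x' ∈ I0) (hy : y ∈ I0) (hy' : y' ∈ I0) :
    |f x y - f x' y'| <= 5 * |x - x'| + 1/10^6 * |y - y'| := by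
  have h1 : ‖f x y - f x' y‖ <= 5 * ‖x - x'‖ := (convex_Icc _ _).norm_image_sub_le_of_norm_hasDerivWithin_le
    (fun z hz => (h.dx z hz y hy).hasDerivWithinAt) (fun z hz => h.D3 hz hy) hx' hx
  have h2 := h.ly x' hx' y hy y' hy'
  have := abs_sub_le (f x y) (f x' y) (f x' y')
  simp only [Real.norm_eq_abs] at h1
  linarith
lemma RG.mQ (h : RG f D) : MapsTo (Fm f) Q0 Q0 := fun _ hq => ⟨h.mI hq.1 hq.2, hq.1⟩
lemma RG.cont (h : RG f D) : ContinuousOn (Fm f) Q0 := by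
  have : LipschitzOnWith 6 (Fm f) Q0 := by
    refine LipschitzOnWith.of_dist_le_mul fun p hp q hq => ?_
    have h1 := h.LI hp.1 hq.1 hp.2 hq.2
    simp only [Prod.dist_eq, Real.dist_eq, Fm]
    have a := le_max_left |p.1 - q.1| |p.2 - q.2|
    have b := le_max_right |p.1 - q.1| |p.2 - q.2|
    have := abs_nonneg (p.1 - q.1)
    refine max_le ?_ ?_ <;> push_cast <;> linarith
  exact this.continuousOn
def Nb (f : ℝ -> ℝ -> ℝ) : Set (ℝ × ℝ) := {q | q ∈ Q0 ∧ ∀ m, ((Fm f)^[m] q).1 ∈ Icc (47/100:ℝ) (72/100)}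
lemma Q0_closed : IsClosed Q0 := isClosed_Icc.prod isClosed_Icc
lemma Nb_null (h : RG f D) : volume (Nb f) = 0 := by
  have hit : ∀ m, MapsTo (Fm f)^[m] Q0 Q0 := fun m => h.mQ.iterate m
  have hcl : IsClosed (Nb f) := by
    have e : Nb f = Q0 ∩ ⋂ m, (Q0 ∩ (Fm f)^[m] ⁻¹' (Icc (47/100:ℝ) (72/100) ×ˢ univ)) := by
      ext q; simp only [Nb, mem_ofPred_eq, mem_inter_iff, mem_iInter, mem_preimage, mem_prod, mem_univ, and_true]
      exact ⟨fun hq => ⟨hq.1, fun m => ⟨hq.1, hq.2 m⟩⟩, fun hq => ⟨hq.1, fun m => (hq.2 m).2⟩⟩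
    rw [e]
    refine Q0_closed.inter (isClosed_iInter fun m => ?_)
    exact (h.cont.iterate h.mQ m).preimage_isClosed_of_isClosed Q0_closed (isClosed_Icc.prod isClosed_univ)
  have hsub : ∀ y x x', (x, y) ∈ Nb f -> (x', y) ∈ Nb f -> x = x' := by
    intro y x x' hx hx'
    have key : ∀ m, (26/25)^m * |x - x'| <= |((Fm f)^[m] (x,y)).1 - ((Fm f)^[m] (x',y)).1| ∧
        |((Fm f)^[m] (x,y)).2 - ((Fm f)^[m] (x',y)).2| <= |((Fm f)^[m] (x,y)).1 - ((Fm f)^[m] (x',y)).1| := by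
      intro m
      induction m with
      | zero => simp
      | succ m ih =>
        have a1 := hx.2 m
        have a2 := hx'.2 m
        have b1 := hit m hx.1
        have b2 := hit m hx'.1
        rw [Function.iterate_succ_apply', Function.iterate_succ_apply', pow_succ]
        generalize (Fm f)^[m] (x,y) = p at *
        generalize (Fm f)^[m] (x',y) = q at *
        simp only [Fm]
        have h1 := h.P5 (y := p.2) ⟨a1.1, by linarith [a1.2]⟩ ⟨a2.1, by linarith [a2.2]⟩ b1.2
        have h2 := h.ly q.1 b2.1 p.2 b1.2 q.2 b2.2
        have h3 : |f p.1 p.2 - f q.1 p.2| <= |f p.1 p.2 - f q.1 q.2| + |f q.1 p.2 - f q.1 q.2| := by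
          have := abs_sub_le (f p.1 p.2) (f q.1 q.2) (f q.1 p.2)
          rwa [abs_sub_comm (f q.1 q.2)] at this
        have h4 := abs_nonneg (p.1 - q.1)
        constructor <;> linarith [ih.1, ih.2]
    by_contra hne
    have hpos : 0 < |x - x'| := abs_pos.2 (sub_ne_zero.2 hne)
    obtain ⟨m, hm⟩ := pow_unbounded_of_one_lt (1/|x - x'|) (by norm_num : (1:ℝ) < 26/25)
    rw [div_lt_iff₀ hpos] at hm
    have h1 := (key m).1
    have h2 : |((Fm f)^[m] (x,y)).1 - ((Fm f)^[m] (x',y)).1| <= 25/100 := by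
      rw [abs_le]; constructor <;> linarith [(hx.2 m).1, (hx.2 m).2, (hx'.2 m).1, (hx'.2 m).2]
    linarith
  rw [Measure.volume_eq_prod, Measure.prod_apply_symm hcl.measurableSet]
  refine (lintegral_congr fun y => ?_).trans lintegral_zero
  exact Set.Subsingleton.measure_zero (fun x hx x' hx' => hsub y x x' hx hx') _
end
structure Dst (F F' ψ : ℝ × ℝ -> ℝ × ℝ) (N : Set (ℝ × ℝ)) : Prop where
  mF : MapsTo F Q0 Q0
  mψ : MapsTo ψ Q0 Q0
  lψ : ∀ p ∈ Q0, ∀ q ∈ Q0, dist (ψ p) (ψ q) <= 7/10 * dist p q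
  lF : ∀ p ∈ Q0, ∀ q ∈ Q0, dist (F (ψ p)) (F (ψ q)) <= 7/10 * dist p q
  semi : ∀ q ∈ Q0, F (F (ψ q)) = ψ (F' q)
  sep : ∀ p ∈ Q0, ∀ q ∈ Q0, ψ p ≠ F (ψ q)
  inj : InjOn F Q0 -> InjOn ψ Q0
  hit : ∀ q ∈ Q0, ∃ m, F^[m] q ∈ ψ '' Q0 ∪ N
  NQ : N ⊆ Q0
  null : volume N = 0
section
variable {f D f' D' X : ℝ -> ℝ -> ℝ} {c l : ℝ}
lemma RR.s49 (h : RR f D f' X c l) {x : ℝ} (hx : x ∈ I0) : |c + l * x| <= 49/100 := by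
  refine (abs_add_le _ _).trans ?_
  rw [abs_mul]
  nlinarith [h.cb, h.l1, mem_I0.1 hx, abs_nonneg x, abs_nonneg l]
lemma RR.l0 (h : RR f D f' X c l) : l ≠ 0 := by
  intro h0; have := h.l2; rw [h0, abs_zero] at this; linarith
lemma RR.sI (h : RR f D f' X c l) {u b : ℝ} (hu : |u - c| <= |l| * b) : ∃ x, |x| <= b ∧ c + l * x = u := by
  have := h.l0
  refine ⟨(u - c)/l, ?_, by field_simp; ring⟩
  rw [abs_div, div_le_iff₀ (abs_pos.2 this)]
  rwa [mul_comm]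
lemma i49 {u : ℝ} (hu : |u| <= 49/100) : u ∈ I0 := mem_I0.2 (by linarith)
lemma iRt {u : ℝ} (hu : u ∈ Icc (47/100:ℝ) (12/10)) : u ∈ I0 := ⟨by linarith [hu.1], hu.2⟩
lemma RR.XL (h : RR f D f' X c l) {u v u' v' : ℝ} (hu : |u| <= 49/100) (hv : |v| <= 49/100) (hu' : |u'| <= 49/100) (hv' : |v'| <= 49/100) :
    |X u v - X u' v'| <= |u - u'| + 1/10^6 * |v - v'| := by
  have h1 := h.g.P5 (h.X1 u v hu hv) (h.X1 u' v' hu' hv') (i49 hv)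
  have h2 := h.g.ly _ (iRt (h.X1 u' v' hu' hv')) v (i49 hv) v' (i49 hv')
  rw [h.X2 u' v' hu' hv'] at h2
  rw [h.X2 u v hu hv] at h1
  have h3 := abs_sub_le u u' (f (X u' v') v)
  rw [abs_sub_comm u'] at h3
  linarith [abs_nonneg (X u v - X u' v')]
lemma RR.fhi (h : RR f D f' X c l) {u y : ℝ} (hu : |u| <= 49/100) (hy : y ∈ I0) : f u y ∈ Icc (6/10:ℝ) (12/10) :=
  ⟨h.g.P3 (i49 hu) hy hu (by norm_num) (by norm_num), (h.g.mI (i49 hu) hy).2⟩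
lemma RR.fhi' (h : RR f D f' X c l) {u y : ℝ} (hu : |u| <= 49/100) (hy : y ∈ I0) : f u y ∈ Icc (47/100:ℝ) (12/10) :=
  ⟨by linarith [(h.fhi hu hy).1], (h.fhi hu hy).2⟩
lemma RR.hit (h : RR f D f' X c l) (g' : RG f' D') {u y : ℝ} (hu : |u| <= 47/100) (hy : y ∈ I0) :
    Fm f (Fm f (u, y)) ∈ pm X c l '' Q0 := by
  have hu9 : |u| <= 49/100 := by linarith
  have hcb := abs_le.1 h.cb
  have hu' := abs_le.1 hu
  obtain ⟨η, hη, he⟩ := h.sI (u := u) (b := 12/10) (by have := h.l2; rw [abs_le]; constructor <;> linarith [hcb.1, hcb.2, hu'.1, hu'.2])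
  have hηI := mem_I0.2 hη
  have hr := h.rel η hηI η hηI
  rw [he] at hr
  have hX := h.X1 u u hu9 hu9
  have h1 := h.g.LI (h.g.mI (i49 hu9) (iRt hX)) (h.g.mI (i49 hu9) hy) (i49 hu9) (i49 hu9)
  have h2 := h.g.ly u (i49 hu9) _ (iRt hX) y hy
  have h3 : |X u u - y| <= 24/10 := by
    have a := iRt hX
    rw [I0, mem_Icc] at a hy
    rw [abs_le]; constructor <;> linarith [a.1, a.2, hy.1, hy.2]
  rw [sub_self, abs_zero, <- hr] at h1
  have h4 : |c + l * f' η η - f (f u y) u| <= 2/10^5 := by linarith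
  have h5 : |f (f u y) u - c| <= |l| * (12/10) := by
    have := g'.P1 hηI hηI
    have h7 : |f' η η| <= 118/100 := by rw [abs_le]; constructor <;> linarith [this.1, this.2]
    have h8 := abs_sub_le (f (f u y) u) (c + l * f' η η) c
    rw [abs_sub_comm (f (f u y) u) (c + _), add_sub_cancel_left, abs_mul] at h8
    have h9 := mul_le_mul_of_nonneg_left h7 (abs_nonneg l)
    linarith [h.l2]
  obtain ⟨ξ, hξ, hx⟩ := h.sI h5
  refine ⟨(ξ, η), ⟨mem_I0.2 hξ, mem_I0.2 hη⟩, ?_⟩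
  have hx9 := h.s49 (mem_I0.2 hξ)
  simp only [pm, Fm, he]
  rw [hx] at hx9 ⊢
  refine Prod.ext rfl ?_
  simp only
  exact h.g.uniq (h.X1 _ _ hx9 hu9) (h.fhi' hu9 hy) (i49 hu9) (h.X2 _ _ hx9 hu9)
theorem RR.dst (h : RR f D f' X c l) (g' : RG f' D') : Dst (Fm f) (Fm f') (pm X c l) (Nb f) where
  mF := h.g.mQ
  mψ := fun q hq => ⟨i49 (h.s49 hq.1), iRt (h.X1 _ _ (h.s49 hq.1) (h.s49 hq.2))⟩
  lψ := fun p hp q hq => by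
    have h1 := h.XL (h.s49 hp.1) (h.s49 hp.2) (h.s49 hq.1) (h.s49 hq.2)
    simp only [Prod.dist_eq, Real.dist_eq, pm]
    have a := le_max_left |p.1 - q.1| |p.2 - q.2|
    have b := le_max_right |p.1 - q.1| |p.2 - q.2|
    have h0 := abs_nonneg (p.1 - q.1)
    have h0' := abs_nonneg (p.2 - q.2)
    simp only [add_sub_add_left_eq_sub, <- mul_sub, abs_mul] at h1 ⊢
    have hl := h.l1
    have h2 : |l| * |p.1 - q.1| <= 4051/10000 * |p.1 - q.1| := mul_le_mul_of_nonneg_right hl h0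
    have h3 : |l| * |p.2 - q.2| <= 4051/10000 * |p.2 - q.2| := mul_le_mul_of_nonneg_right hl h0'
    refine max_le ?_ ?_ <;> linarith
  lF := fun p hp q hq => by
    have h1 := h.XL (h.s49 hp.1) (h.s49 hp.2) (h.s49 hq.1) (h.s49 hq.2)
    have h4 := h.g.LJ (h.s49 hp.1) (h.s49 hq.1) (iRt (h.X1 _ _ (h.s49 hp.1) (h.s49 hp.2))) (iRt (h.X1 _ _ (h.s49 hq.1) (h.s49 hq.2)))
    simp only [Prod.dist_eq, Real.dist_eq, pm, Fm]
    have a := le_max_left |p.1 - q.1| |p.2 - q.2|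
    have b := le_max_right |p.1 - q.1| |p.2 - q.2|
    have h0 := abs_nonneg (p.1 - q.1)
    have h0' := abs_nonneg (p.2 - q.2)
    simp only [add_sub_add_left_eq_sub, <- mul_sub, abs_mul] at h1 h4 ⊢
    have hl := h.l1
    have h2 : |l| * |p.1 - q.1| <= 4051/10000 * |p.1 - q.1| := mul_le_mul_of_nonneg_right hl h0
    have h3 : |l| * |p.2 - q.2| <= 4051/10000 * |p.2 - q.2| := mul_le_mul_of_nonneg_right hl h0'
    refine max_le ?_ ?_ <;> linarith
  semi := fun q hq => by
    have a1 := h.s49 hq.1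
    have a2 := h.s49 hq.2
    have hX := h.X1 _ _ a1 a2
    have hr := h.rel _ hq.1 _ hq.2
    have a3 := h.s49 (g'.mI hq.1 hq.2)
    simp only [Fm, pm]
    refine Prod.ext hr.symm ?_
    simp only
    exact h.g.uniq (h.fhi' a1 (iRt hX)) (h.X1 _ _ a3 a1) (i49 a1) (by rw [h.X2 _ _ a3 a1, hr])
  sep := fun p hp q hq he => by
    have h1 := (abs_le.1 (h.s49 hp.1)).2
    have h2 := (h.fhi (h.s49 hq.1) (iRt (h.X1 _ _ (h.s49 hq.1) (h.s49 hq.2)))).1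
    have h3 := congrArg Prod.fst he
    simp only [pm, Fm] at h3
    linarith
  inj := fun hi p hp q hq he => by
    have hl := h.l0
    simp only [pm, Prod.mk.injEq] at he
    have e1 : p.1 = q.1 := mul_left_cancel₀ hl (add_left_cancel he.1)
    have a1 := h.s49 hp.1
    have a2 := h.s49 hp.2
    have b1 := h.s49 hq.1
    have b2 := h.s49 hq.2
    have h3 : Fm f (X (c + l * p.1) (c + l * p.2), c + l * p.2) = Fm f (X (c + l * q.1) (c + l * q.2), c + l * q.2) := by
      simp only [Fm]
      rw [h.X2 _ _ a1 a2, h.X2 _ _ b1 b2, he.2, he.1]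
    have := hi ⟨iRt (h.X1 _ _ a1 a2), i49 a2⟩ ⟨iRt (h.X1 _ _ b1 b2), i49 b2⟩ h3
    simp only [Prod.mk.injEq] at this
    exact Prod.ext e1 (mul_left_cancel₀ hl (add_left_cancel this.2))
  hit := fun q hq => by
    by_cases hex : ∃ m, |((Fm f)^[m] q).1| <= 47/100
    · obtain ⟨m, hm⟩ := hex
      refine ⟨m + 2, Or.inl ?_⟩
      rw [Function.iterate_succ_apply', Function.iterate_succ_apply']
      exact h.hit g' hm (h.g.mQ.iterate m hq).2
    · push Not at hex
      refine ⟨4, Or.inr ⟨h.g.mQ.iterate 4 hq, fun m => ?_⟩⟩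
      rw [<- Function.iterate_add_apply]
      have hQ : ∀ m, (Fm f)^[m] q ∈ Q0 := fun m => h.g.mQ.iterate m hq
      have hs : ∀ m, ((Fm f)^[m+1] q).1 = f ((Fm f)^[m] q).1 ((Fm f)^[m] q).2 := fun m => by
        rw [Function.iterate_succ_apply']; rfl
      have h7 : ∀ m, ((Fm f)^[m+1] q).1 <= 72/100 := fun m => by
        rw [hs]; exact h.g.P2 (hQ m).1 (hQ m).2 (hex m).le
      have h8 : ∀ m, -(118/100) <= ((Fm f)^[m+1] q).1 := fun m => by
        rw [hs]; exact (h.g.P1 (hQ m).1 (hQ m).2).1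
      have h9 : ∀ m, -(111/100) <= ((Fm f)^[m+2] q).1 := fun m => by
        rw [hs]; exact h.g.P3 (hQ _).1 (hQ _).2 (a := 118/100) (abs_le.2 ⟨h8 m, by linarith [h7 m]⟩) (by norm_num) (by norm_num)
      have h10 : ∀ m, -(9/10) <= ((Fm f)^[m+3] q).1 := fun m => by
        rw [hs]; exact h.g.P3 (hQ _).1 (hQ _).2 (a := 111/100) (abs_le.2 ⟨h9 m, by linarith [h7 (m+1)]⟩) (by norm_num) (by norm_num)
      have h11 : ∀ m, -(45/100) <= ((Fm f)^[m+4] q).1 := fun m => by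
        rw [hs]; exact h.g.P3 (hQ _).1 (hQ _).2 (a := 9/10) (abs_le.2 ⟨h10 m, by linarith [h7 (m+2)]⟩) (by norm_num) (by norm_num)
      refine ⟨?_, h7 (m+3)⟩
      rcases le_abs.1 (hex (m+4)).le with h12 | h12
      · exact h12
      · linarith [h11 m]
  NQ := fun q hq => hq.1
  null := Nb_null h.g
end
open Metric MeasureTheory Topology
noncomputable def rs (n : ℕ) (x : ℤ_[2]) : ℕ := (PadicInt.toZModPow n x : ZMod (2^n)).val
lemma rs_lt (n : ℕ) (x : ℤ_[2]) : rs n x < 2^n := ZMod.val_lt _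
lemma rs_succ (n : ℕ) (x : ℤ_[2]) : rs (n+1) x % 2^n = rs n x := by
  have h := PadicInt.cast_toZModPow (p := 2) n (n+1) (Nat.le_succ n) x
  rw [rs, rs, <- h, <- ZMod.natCast_val, ZMod.val_natCast]
lemma rs_add (n : ℕ) (x : ℤ_[2]) : rs n (x+1) = (rs n x + 1) % 2^n := by
  rw [rs, rs, <- ZMod.val_natCast, map_add, map_one, Nat.cast_add, ZMod.natCast_zmod_val, Nat.cast_one]
lemma rs_zero (n : ℕ) : rs n 0 = 0 := by rw [rs, map_zero, ZMod.val_zero]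
lemma rs_inj {x y : ℤ_[2]} (h : ∀ n, rs n x = rs n y) : x = y :=
  PadicInt.ext_of_toZModPow.1 fun n => ZMod.val_injective _ (h n)
lemma rs_near (n : ℕ) {x y : ℤ_[2]} (h : dist x y <= (2:ℝ)^(-n:ℤ)) : rs n x = rs n y := by
  have h1 : x - y ∈ RingHom.ker (PadicInt.toZModPow n : ℤ_[2] →+* ZMod (2 ^ n)) := by
    rw [PadicInt.ker_toZModPow, <- PadicInt.norm_le_pow_iff_mem_span_pow, <- dist_eq_norm]
    exact_mod_cast h
  rw [RingHom.mem_ker, map_sub, sub_eq_zero] at h1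
  rw [rs, rs, h1]
def Ps (ψ : ℕ -> ℝ × ℝ -> ℝ × ℝ) : ℕ -> ℝ × ℝ -> ℝ × ℝ
  | 0 => id
  | n+1 => Ps ψ n ∘ ψ n
def Cy (F ψ : ℕ -> ℝ × ℝ -> ℝ × ℝ) (n k : ℕ) : Set (ℝ × ℝ) := (fun q => (F 0)^[k] (Ps ψ n q)) '' Q0
lemma Q0_compact : IsCompact Q0 := isCompact_Icc.prod isCompact_Icc
lemma Q0_ne : Q0.Nonempty := ⟨(0,0), ⟨by norm_num, by norm_num⟩, ⟨by norm_num, by norm_num⟩⟩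
lemma Q0_dist {p q : ℝ × ℝ} (hp : p ∈ Q0) (hq : q ∈ Q0) : dist p q <= 3 := by
  rw [Prod.dist_eq, Real.dist_eq, Real.dist_eq]
  obtain ⟨⟨a1, a2⟩, a3, a4⟩ := hp
  obtain ⟨⟨b1, b2⟩, b3, b4⟩ := hq
  refine max_le (abs_le.2 ?_) (abs_le.2 ?_) <;> constructor <;> linarith
section
variable {F ψ : ℕ -> ℝ × ℝ -> ℝ × ℝ} {N : ℕ -> Set (ℝ × ℝ)}
lemma Ps_maps (H : ∀ n, Dst (F n) (F (n+1)) (ψ n) (N n)) : ∀ n, MapsTo (Ps ψ n) Q0 Q0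
  | 0 => fun _ h => h
  | n+1 => (Ps_maps H n).comp (H n).mψ
lemma Ps_semi (H : ∀ n, Dst (F n) (F (n+1)) (ψ n) (N n)) (n : ℕ) : ∀ q ∈ Q0, (F 0)^[2^n] (Ps ψ n q) = Ps ψ n (F n q) := by
  induction n with
  | zero => intro q _; rfl
  | succ n ih =>
    intro q hq
    have h1 := (H n).mψ hq
    rw [pow_succ, mul_two, Function.iterate_add_apply, Ps, Function.comp_apply, ih _ h1, ih _ ((H n).mF h1), (H n).semi q hq]
    rfl
lemma Ps_lip (H : ∀ n, Dst (F n) (F (n+1)) (ψ n) (N n)) (n : ℕ) : ∀ k < 2^n, ∀ p ∈ Q0, ∀ q ∈ Q0,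
    dist ((F 0)^[k] (Ps ψ n p)) ((F 0)^[k] (Ps ψ n q)) <= (7/10)^n * dist p q := by
  induction n with
  | zero =>
    intro k hk p _ q _
    have : k = 0 := by simpa using hk
    subst this; simp [Ps]
  | succ n ih =>
    intro k hk p hp q hq
    have hp1 := (H n).mψ hp
    have hq1 := (H n).mψ hq
    rw [pow_succ (7/10:ℝ), mul_assoc, Ps, Function.comp_apply, Function.comp_apply]
    rcases lt_or_ge k (2^n) with h | h
    · exact (ih k h _ hp1 _ hq1).trans (mul_le_mul_of_nonneg_left ((H n).lψ p hp q hq) (by positivity))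
    · obtain ⟨j, rfl⟩ := Nat.exists_eq_add_of_le' h
      rw [Function.iterate_add_apply, Function.iterate_add_apply, Ps_semi H n _ hp1, Ps_semi H n _ hq1]
      exact (ih j (by omega) _ ((H n).mF hp1) _ ((H n).mF hq1)).trans
        (mul_le_mul_of_nonneg_left ((H n).lF p hp q hq) (by positivity))
lemma Cy_succ (H : ∀ n, Dst (F n) (F (n+1)) (ψ n) (N n)) (n k : ℕ) : Cy F ψ (n+1) k ⊆ Cy F ψ n k := by
  rintro _ ⟨q, hq, rfl⟩
  exact ⟨ψ n q, (H n).mψ hq, rfl⟩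
lemma Cy_mod (H : ∀ n, Dst (F n) (F (n+1)) (ψ n) (N n)) (n k : ℕ) : Cy F ψ n k ⊆ Cy F ψ n (k % 2^n) := by
  have h1 : ∀ m j, Cy F ψ n (j + 2^n * m) ⊆ Cy F ψ n j := by
    intro m
    induction m with
    | zero => intro j; rfl
    | succ m ih =>
      rintro j _ ⟨q, hq, rfl⟩
      refine ih j ⟨F n q, (H n).mF hq, ?_⟩
      simp only
      rw [<- Ps_semi H n q hq, <- Function.iterate_add_apply]
      rw [show j + 2^n * (m+1) = j + 2^n * m + 2^n by ring]
  have := h1 (k / 2^n) (k % 2^n)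
  rwa [Nat.mod_add_div] at this
lemma Cy_dist (H : ∀ n, Dst (F n) (F (n+1)) (ψ n) (N n)) {n k : ℕ} (hk : k < 2^n) {x y : ℝ × ℝ} (hx : x ∈ Cy F ψ n k)
    (hy : y ∈ Cy F ψ n k) : dist x y <= (7/10)^n * 3 := by
  obtain ⟨p, hp, rfl⟩ := hx
  obtain ⟨q, hq, rfl⟩ := hy
  exact (Ps_lip H n k hk p hp q hq).trans (mul_le_mul_of_nonneg_left (Q0_dist hp hq) (by positivity))
lemma Cy_compact (H : ∀ n, Dst (F n) (F (n+1)) (ψ n) (N n)) {n k : ℕ} (hk : k < 2^n) : IsCompact (Cy F ψ n k) := by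
  refine Q0_compact.image_of_continuousOn ?_
  have : LipschitzOnWith ⟨(7/10)^n, by positivity⟩ (fun q => (F 0)^[k] (Ps ψ n q)) Q0 :=
    LipschitzOnWith.of_dist_le_mul fun p hp q hq => Ps_lip H n k hk p hp q hq
  exact this.continuousOn
lemma Cy_rs (H : ∀ n, Dst (F n) (F (n+1)) (ψ n) (N n)) (x : ℤ_[2]) (n : ℕ) : Cy F ψ (n+1) (rs (n+1) x) ⊆ Cy F ψ n (rs n x) := by
  have := (Cy_succ H n (rs (n+1) x)).trans (Cy_mod H n _)
  rwa [rs_succ] at this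
lemma F_inj (H : ∀ n, Dst (F n) (F (n+1)) (ψ n) (N n)) (h0 : Function.Injective (F 0)) (n : ℕ) : InjOn (F n) Q0 := by
  induction n with
  | zero => exact h0.injOn
  | succ n ih =>
    have hψ := (H n).inj ih
    intro p hp q hq he
    have h1 : F n (F n (ψ n p)) = F n (F n (ψ n q)) := by rw [(H n).semi p hp, (H n).semi q hq, he]
    have hp1 := (H n).mψ hp
    have hq1 := (H n).mψ hq
    exact hψ hp hq (ih hp1 hq1 (ih ((H n).mF hp1) ((H n).mF hq1) h1))
lemma Ps_inj (H : ∀ n, Dst (F n) (F (n+1)) (ψ n) (N n)) (h0 : Function.Injective (F 0)) (n : ℕ) : InjOn (Ps ψ n) Q0 := by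
  induction n with
  | zero => exact Function.injective_id.injOn
  | succ n ih => exact ih.comp ((H n).inj (F_inj H h0 n)) (H n).mψ
lemma Cy_disj (H : ∀ n, Dst (F n) (F (n+1)) (ψ n) (N n)) (h0 : Function.Injective (F 0)) (n : ℕ) :
    ∀ j k, j < 2^n -> k < 2^n -> ∀ x, x ∈ Cy F ψ n j -> x ∈ Cy F ψ n k -> j = k := by
  induction n with
  | zero => intro j k hj hk _ _ _; simp at hj hk; omega
  | succ n ih =>
    have key : ∀ j, j < 2^n -> ∀ x, x ∈ Cy F ψ (n+1) j -> x ∈ Cy F ψ (n+1) (j + 2^n) -> False := by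
      rintro j hj x ⟨p, hp, rfl⟩ ⟨q, hq, he⟩
      simp only [Ps, Function.comp_apply] at he
      rw [Function.iterate_add_apply, Ps_semi H n _ ((H n).mψ hq)] at he
      have h1 := Ps_inj H h0 n ((H n).mF ((H n).mψ hq)) ((H n).mψ hp) (h0.iterate j he)
      exact (H n).sep p hp q hq h1.symm
    intro j k hj hk x hxj hxk
    have hm : j % 2^n = k % 2^n := ih _ _ (Nat.mod_lt _ (by positivity)) (Nat.mod_lt _ (by positivity)) x
      (Cy_mod H n j (Cy_succ H n j hxj)) (Cy_mod H n k (Cy_succ H n k hxk))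
    rw [pow_succ] at hj hk
    rcases lt_or_ge j (2^n) with h | h <;> rcases lt_or_ge k (2^n) with h' | h'
    · rwa [Nat.mod_eq_of_lt h, Nat.mod_eq_of_lt h'] at hm
    · rw [Nat.mod_eq_of_lt h, Nat.mod_eq_sub_mod h', Nat.mod_eq_of_lt (by omega)] at hm
      refine (key j h x hxj ?_).elim
      rwa [show j + 2^n = k by omega]
    · rw [Nat.mod_eq_of_lt h', Nat.mod_eq_sub_mod h, Nat.mod_eq_of_lt (by omega)] at hm
      refine (key k h' x hxk ?_).elim
      rwa [show k + 2^n = j by omega]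
    · rw [Nat.mod_eq_sub_mod h, Nat.mod_eq_sub_mod h', Nat.mod_eq_of_lt (by omega), Nat.mod_eq_of_lt (by omega)] at hm
      omega
lemma small_pow {ε : ℝ} (hε : 0 < ε) : ∃ n : ℕ, (7/10:ℝ)^n * 3 < ε := by
  obtain ⟨n, hn⟩ := exists_pow_lt_of_lt_one (show (0:ℝ) < ε/3 by positivity) (by norm_num : (7/10:ℝ) < 1)
  exact ⟨n, by linarith⟩
lemma basin (H : ∀ n, Dst (F n) (F (n+1)) (ψ n) (N n)) (hpre : ∀ s, volume s = 0 -> volume (F 0 ⁻¹' s) = 0)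
    {p0 : ℝ × ℝ} (hp0 : ∀ n, p0 ∈ Cy F ψ n 0) :
    ∀ᵐ q : ℝ × ℝ, q ∈ Q0 -> MapClusterPt p0 atTop (fun n : ℕ => (F 0)^[n] q) := by
  have hnull : ∀ n k, volume ((F 0)^[k] ⁻¹' (Ps ψ n '' N n)) = 0 := by
    intro n k
    induction k with
    | zero =>
      have hl : LipschitzOnWith ⟨(7/10)^n, by positivity⟩ (Ps ψ n) (N n) :=
        LipschitzOnWith.of_dist_le_mul fun p hp q hq => Ps_lip H n 0 (by positivity) p ((H n).NQ hp) q ((H n).NQ hq)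
      have := hl.hausdorffMeasure_image_le (d := 2) (by norm_num)
      rw [hausdorffMeasure_prod_real, (H n).null, mul_zero] at this
      simpa using this
    | succ k ih =>
      rw [Function.iterate_succ, preimage_comp]
      exact hpre _ ih
  have hae : ∀ᵐ q : ℝ × ℝ, ∀ n k, q ∉ (F 0)^[k] ⁻¹' (Ps ψ n '' N n) := by
    rw [ae_all_iff]; intro n; rw [ae_all_iff]; intro k
    exact measure_eq_zero_iff_ae_notMem.1 (hnull n k)
  filter_upwards [hae] with q hq hqQ
  have hmul : ∀ n m r, r ∈ Q0 -> (F 0)^[m * 2^n] (Ps ψ n r) = Ps ψ n ((F n)^[m] r) := by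
    intro n m r hr
    induction m with
    | zero => simp
    | succ m ih =>
      rw [add_mul, one_mul, add_comm, Function.iterate_add_apply, ih, Ps_semi H n _ ((H n).mF.iterate m hr),
        Function.iterate_succ_apply']
  have hvis : ∀ n, ∃ k, ∃ r ∈ Q0, (F 0)^[k] q = Ps ψ n r := by
    intro n
    induction n with
    | zero => exact ⟨0, q, hqQ, rfl⟩
    | succ n ih =>
      obtain ⟨k, r, hr, he⟩ := ih
      obtain ⟨m, hm⟩ := (H n).hit r hr
      have h1 : (F 0)^[m * 2^n + k] q = Ps ψ n ((F n)^[m] r) := by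
        rw [Function.iterate_add_apply, he, hmul n m r hr]
      rcases hm with ⟨s, hs, hse⟩ | hm
      · exact ⟨_, s, hs, by rw [h1, <- hse]; rfl⟩
      · exact absurd ⟨_, hm, h1.symm⟩ (hq n (m * 2^n + k))
  rw [mapClusterPt_iff_frequently]
  intro s hs
  obtain ⟨ε, hε, hb⟩ := Metric.mem_nhds_iff.1 hs
  obtain ⟨n, hn⟩ := small_pow hε
  obtain ⟨k, r, hr, he⟩ := hvis n
  rw [frequently_atTop]
  intro a
  refine ⟨a * 2^n + k, ?_, hb ?_⟩
  · have : a * 1 <= a * 2^n := Nat.mul_le_mul_left a Nat.one_le_two_pow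
    omega
  · rw [Function.iterate_add_apply, he, hmul n a r hr, mem_ball]
    refine (Cy_dist H (k := 0) (by positivity) ⟨_, (H n).mF.iterate a hr, rfl⟩ (hp0 n)).trans_lt hn
theorem dyn (H : ∀ n, Dst (F n) (F (n+1)) (ψ n) (N n)) (h0 : Function.Injective (F 0))
    (hpre : ∀ s, volume s = 0 -> volume (F 0 ⁻¹' s) = 0) :
    ∃ π : ℤ_[2] -> ℝ × ℝ, Continuous π ∧ Function.Injective π ∧ (∀ x, π (x + 1) = F 0 (π x)) ∧ (∀ x, π x ∈ Q0) ∧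
      ∀ᵐ q : ℝ × ℝ, q ∈ Q0 -> MapClusterPt (π 0) atTop (fun n : ℕ => (F 0)^[n] q) := by
  have hex : ∀ x : ℤ_[2], ∃ p, ∀ n, p ∈ Cy F ψ n (rs n x) := by
    intro x
    obtain ⟨p, hp⟩ := IsCompact.nonempty_iInter_of_sequence_nonempty_isCompact_isClosed (fun n => Cy F ψ n (rs n x))
      (Cy_rs H x) (fun n => Q0_ne.image _) (Cy_compact H (rs_lt 0 x)) (fun n => (Cy_compact H (rs_lt n x)).isClosed)
    exact ⟨p, mem_iInter.1 hp⟩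
  choose π hπ using hex
  have huniq : ∀ x p, (∀ n, p ∈ Cy F ψ n (rs n x)) -> p = π x := by
    intro x p hp
    by_contra hne
    obtain ⟨n, hn⟩ := small_pow (dist_pos.2 hne)
    exact absurd (Cy_dist H (rs_lt n x) (hp n) (hπ x n)) (not_le.2 hn)
  refine ⟨π, ?_, ?_, ?_, ?_, ?_⟩
  · rw [Metric.continuous_iff]
    intro x ε hε
    obtain ⟨n, hn⟩ := small_pow hε
    refine ⟨(2:ℝ)^(-n:ℤ), by positivity, fun y hy => ?_⟩
    have h1 := hπ y n
    rw [rs_near n hy.le] at h1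
    exact (Cy_dist H (rs_lt n x) h1 (hπ x n)).trans_lt hn
  · intro x y he
    refine rs_inj fun n => Cy_disj H h0 n _ _ (rs_lt n x) (rs_lt n y) (π x) (hπ x n) ?_
    rw [he]; exact hπ y n
  · intro x
    refine (huniq _ _ fun n => ?_).symm
    rw [rs_add]
    refine Cy_mod H n _ ?_
    obtain ⟨q, hq, he⟩ := hπ x n
    refine ⟨q, hq, ?_⟩
    simp only at he ⊢
    rw [Function.iterate_succ_apply', he]
  · intro x
    obtain ⟨q, hq, he⟩ := hπ x 0
    have : rs 0 x = 0 := by have := rs_lt 0 x; simpa using this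
    rw [this] at he
    rw [<- he]; exact hq
  · refine basin H hpre fun n => ?_
    have := hπ 0 n
    rwa [rs_zero] at this
end
open Metric MeasureTheory Topology
lemma PD_of {f : ℝ × ℝ -> ℝ × ℝ} {π : ℤ_[2] -> ℝ × ℝ} (hc : Continuous π) (hi : Function.Injective π)
    (hf : ∀ x, π (x + 1) = f (π x)) {U : Set (ℝ × ℝ)} (hU : IsOpen U) (hπ : ∀ x, π x ∈ U)
    (hae : ∀ᵐ q : ℝ × ℝ, q ∈ U -> MapClusterPt (π 0) atTop (fun n : ℕ => f^[n] q)) : IsPDCantorAttractor f (range π) := by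
  refine ⟨isCompact_range hc, ?_, ?_, U, hU, ?_, ?_⟩
  · apply Subset.antisymm
    · rintro _ ⟨_, ⟨x, rfl⟩, rfl⟩
      exact ⟨x + 1, hf x⟩
    · rintro _ ⟨x, rfl⟩
      exact ⟨π (x - 1), ⟨_, rfl⟩, by rw [<- hf, sub_add_cancel]⟩
  · have hcc : Continuous (Equiv.ofInjective π hi) := hc.subtype_mk _
    let e := hcc.homeoOfEquivCompactToT2
    refine ⟨e.symm, ?_⟩
    rintro ⟨_, x, rfl⟩ hx
    have h1 : ∀ y, e y = ⟨π y, y, rfl⟩ := fun y => rfl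
    have h2 : (⟨f (π x), hx⟩ : range π) = e (x + 1) := by
      rw [h1]; exact Subtype.ext (hf x).symm
    simp only
    rw [h2, <- h1, e.symm_apply_apply, e.symm_apply_apply]
  · rintro _ ⟨x, rfl⟩
    exact hπ x
  · filter_upwards [hae] with q hq hqU
    exact ⟨π 0, (mem_omegaLimit_singleton_iff_mapClusterPt ..).2 (hq hqU), 0, rfl⟩
lemma PD_scale {a b : ℝ} (ha : a ≠ 0) {F : ℝ × ℝ -> ℝ × ℝ} (hF : ∀ q, F q = (1 + a * q.1^2 - b * q.2, q.1))
    {π : ℤ_[2] -> ℝ × ℝ} (hc : Continuous π) (hi : Function.Injective π)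
    (hf : ∀ x, π (x + 1) = F (π x)) {U : Set (ℝ × ℝ)} (hU : IsOpen U) (hπ : ∀ x, π x ∈ U)
    (hae : ∀ᵐ q : ℝ × ℝ, q ∈ U -> MapClusterPt (π 0) atTop (fun n : ℕ => F^[n] q)) :
    ∃ A, IsPDCantorAttractor (henon a b) A := by
  have hsem : ∀ q, a • F q = henon a b (a • q) := by
    intro q
    rw [hF, henon]
    refine Prod.ext ?_ ?_
    · simp; ring
    · simp
  have hit : ∀ n q, a • F^[n] q = (henon a b)^[n] (a • q) := by
    intro n
    induction n with
    | zero => intro q; rfl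
    | succ n ih => intro q; rw [Function.iterate_succ_apply, Function.iterate_succ_apply, ih, hsem]
  refine ⟨_, PD_of (π := fun x => a • π x) (U := (fun q => a⁻¹ • q) ⁻¹' U) (hc.const_smul a) ?_ ?_ (hU.preimage (continuous_const_smul _)) ?_ ?_⟩
  · intro x y h
    exact hi (smul_right_injective _ ha h)
  · intro x; rw [hf, hsem]
  · intro x; simp only [mem_preimage]; rw [inv_smul_smul₀ ha]; exact hπ x
  · have h1 : ∀ᵐ q : ℝ × ℝ, a⁻¹ • q ∈ U -> MapClusterPt (π 0) atTop (fun n : ℕ => F^[n] (a⁻¹ • q)) := by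
      rw [ae_iff] at hae ⊢
      have := Measure.addHaar_preimage_smul (volume : Measure (ℝ × ℝ)) (inv_ne_zero ha) {q | ¬ (q ∈ U -> MapClusterPt (π 0) atTop (fun n : ℕ => F^[n] q))}
      rw [hae, mul_zero] at this
      exact this
    filter_upwards [h1] with q hq hqU
    have h2 := (hq hqU).tendsto_comp ((continuous_const_smul a).tendsto (π 0))
    have h3 : (fun q : ℝ × ℝ => a • q) ∘ (fun n : ℕ => F^[n] (a⁻¹ • q)) = fun n : ℕ => (henon a b)^[n] q := by
      funext n
      simp only [Function.comp]
      rw [hit, smul_inv_smul₀ ha]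
    rwa [h3] at h2
theorem PD_curve : ∃ z : ℂ -> ℂ, DifferentiableOn ℂ z (ball 0 bt) ∧
    ∀ b : ℝ, 0 < b -> b < bt -> ∃ A, IsPDCantorAttractor (henon (az (z b)).re b) A := by
  obtain ⟨Φ, S, c, l, G, hT⟩ := exists_tow
  obtain ⟨z, hz1, hz2, hz3, hz4⟩ := exists_lim (fun n => (hT.stp n).an) (fun n => (hT.stp n).bd) (fun n => (hT.stp n).sym)
  refine ⟨z 0, hz1 0, fun b hb0 hb1 => ?_⟩
  have hb : (b:ℂ) ∈ ball (0:ℂ) bt := by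
    rw [mem_ball_zero_iff, Complex.norm_real, Real.norm_eq_abs, abs_of_pos hb0]; exact hb1
  have hzc : ∀ n, conj (z n b) = z n b := fun n => by rw [<- hz3 n _ hb, Complex.conj_ofReal]
  have hp : ∀ n, (z n b, (b:ℂ)) ∈ UU bt := fun n => ⟨mem_ball_zero_iff.2 (by have := hz2 n _ hb; simp only; linarith), hb⟩
  have hpp : ∀ n, sg (z n b, (b:ℂ)) = (z n b, (b:ℂ)) := fun n => by
    simp only [sg, hzc, Complex.conj_ofReal]
  have hR := fun n => RR_of (hT.stp n).pf (hT.stp n).sf (hT.stp n).cf (hT.fam n).sym (hp n) (hpp n)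
  choose D X c' l' hR using hR
  let f : ℕ -> ℝ -> ℝ -> ℝ := fun n x y => (Φ n (z n b, (b:ℂ)) x y).re
  have hR' : ∀ n, RR (f n) (D n) (f (n+1)) (X n) (c' n) (l' n) := by
    intro n
    have e : f (n+1) = (fun x y : ℝ => (RN (Φ n) (S n) (c n) (l n) (z n b, (b:ℂ)) x y).re) := by
      funext x y
      simp only [f]
      rw [hT.succ n]
      simp only [rp]
      rw [hz4 n _ hb]
    rw [e]; exact hR n
  have hD : ∀ n, Dst (Fm (f n)) (Fm (f (n+1))) (pm (X n) (c' n) (l' n)) (Nb (f n)) := fun n => (hR' n).dst (hR' (n+1)).g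
  set w : ℝ := (z 0 b).re with hw
  have hw' : z 0 b = (w:ℂ) := (Complex.conj_eq_iff_re.1 (hzc 0)).symm
  have hwb : |w| <= 47/100 := by
    have := hz2 0 _ hb
    rwa [hw', Complex.norm_real, Real.norm_eq_abs] at this
  set a : ℝ := (az (z 0 b)).re with hadef
  have haz : az (z 0 b) = ((-1401155189092 + 200000000 * w) / 1000000000000 : ℝ) := by
    rw [hw', az]; push_cast; ring
  have ha : a = (-1401155189092 + 200000000 * w) / 1000000000000 := by rw [hadef, haz, Complex.ofReal_re]
  have ha0 : a ≠ 0 := by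
    rw [ha]
    have := (abs_le.1 hwb).2
    apply ne_of_lt
    apply div_neg_of_neg_of_pos <;> linarith
  have hF : ∀ q, Fm (f 0) q = (1 + a * q.1^2 - b * q.2, q.1) := by
    intro q
    simp only [Fm, f, hT.zero, F0]
    rw [haz, <- ha]
    congr 1
    rw [show (1 + (a:ℂ) * (q.1:ℂ)^2 - (b:ℂ) * (q.2:ℂ)) = ((1 + a * q.1^2 - b * q.2 : ℝ) : ℂ) by push_cast; ring, Complex.ofReal_re]
  have hinj : Function.Injective (Fm (f 0)) := by
    intro p q h
    rw [hF, hF, Prod.mk.injEq] at h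
    obtain ⟨h1, h2⟩ := h
    refine Prod.ext h2 ?_
    rw [h2] at h1
    exact mul_left_cancel₀ hb0.ne' (by linarith)
  have hpre : ∀ s, volume s = 0 -> volume (Fm (f 0) ⁻¹' s) = 0 := by
    intro s hs
    have hsub : Fm (f 0) ⁻¹' s ⊆ (fun q : ℝ × ℝ => (q.2, (1 + a * q.2^2 - q.1) / b)) '' s := by
      intro q hq
      refine ⟨_, hq, ?_⟩
      rw [hF]
      refine Prod.ext rfl ?_
      simp only
      field_simp
      ring
    refine measure_mono_null hsub (addHaar_image_eq_zero_of_differentiableOn_of_addHaar_eq_zero _ ?_ hs)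
    apply Differentiable.differentiableOn
    fun_prop
  obtain ⟨π, h1, h2, h3, h4, h5⟩ := dyn hD hinj hpre
  refine PD_scale ha0 hF h1 h2 h3 (U := interior Q0) isOpen_interior ?_ ?_
  · intro x
    have hin : ∀ y, (π y).1 ∈ Ioo (-(12/10):ℝ) (12/10) := by
      intro y
      have e : π y = Fm (f 0) (π (y - 1)) := by rw [<- h3, sub_add_cancel]
      have hq := h4 (y - 1)
      have := (hR' 0).g.P1 hq.1 hq.2
      rw [e]
      simp only [Fm]
      constructor <;> linarith [this.1, this.2]
    have h6 : (π x).2 = (π (x-1)).1 := by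
      have e : π x = Fm (f 0) (π (x - 1)) := by rw [<- h3, sub_add_cancel]
      rw [e]; rfl
    rw [Q0, interior_prod_eq, I0, interior_Icc]
    exact ⟨hin x, by rw [h6]; exact hin _⟩
  · filter_upwards [h5] with q hq hqU
    exact hq (interior_subset hqU)
noncomputable def be (n : ℕ) (t : ℝ) : ℝ := bt * ((2 + t) / 4) * (1/2)^n
lemma be_lt {n : ℕ} {t : ℝ} (ht : t ∈ Icc (0:ℝ) 1) : bt / 2 * (1/2)^n <= be n t ∧ be n t < bt * (1/2)^n := by
  have h := bt_pos
  have h2 : (0:ℝ) < (1/2)^n := by positivity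
  have h3 := mul_pos h h2
  rw [be]
  constructor <;> nlinarith [ht.1, ht.2]
lemma be_disj {m n : ℕ} (h : m < n) {s t : ℝ} (hs : s ∈ Icc (0:ℝ) 1) (ht : t ∈ Icc (0:ℝ) 1) : be n t < be m s := by
  refine (be_lt ht).2.trans_le (le_trans ?_ (be_lt hs).1)
  have : ((1:ℝ)/2)^n <= (1/2)^(m+1) := pow_le_pow_of_le_one (by norm_num) (by norm_num) h
  have h1 := mul_le_mul_of_nonneg_left this bt_pos.le
  rw [pow_succ] at h1
  linarith
lemma be_inj {n : ℕ} {s t : ℝ} (h : be n s = be n t) : s = t := by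
  have h2 : (0:ℝ) < (1/2)^n := by positivity
  have h3 := mul_left_cancel₀ bt_pos.ne' (mul_right_cancel₀ h2.ne' h)
  linarith
end HN

/-- In the parameter plane of the Hénon family there are infinitely many pairwise disjoint
nondegenerate real-analytic arcs such that every parameter on any of these arcs gives a
Hénon map with a period doubling Cantor attractor. -/
theorem henon_infinitely_many_arcs_of_PD_attractors :
    ∃ c : ℕ → ℝ → ℝ × ℝ,
      (∀ n, IsAnalyticArc (c n)) ∧
      (Pairwise fun m n => Disjoint (c m '' Icc (0 : ℝ) 1) (c n '' Icc (0 : ℝ) 1)) ∧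
      ∀ n, ∀ t ∈ Icc (0 : ℝ) 1,
        ∃ A : Set (ℝ × ℝ), IsPDCantorAttractor (henon (c n t).1 (c n t).2) A := by
  obtain ⟨z, hz, hA⟩ := HN.PD_curve
  have hb1 : ∀ n, ∀ t ∈ Icc (0:ℝ) 1, 0 < HN.be n t ∧ HN.be n t < HN.bt := by
    intro n t ht
    have h := HN.be_lt (n := n) ht
    have := HN.bt_pos
    refine ⟨lt_of_lt_of_le (by positivity) h.1, h.2.trans_le ?_⟩
    have : ((1:ℝ)/2)^n ≤ 1 := pow_le_one₀ (by norm_num) (by norm_num)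
    nlinarith
  refine ⟨fun n t => ((HN.az (z (HN.be n t))).re, HN.be n t), ?_, ?_, ?_⟩
  · intro n
    refine ⟨?_, fun s _ t _ h => HN.be_inj (Prod.ext_iff.1 h).2, 0, by simp, 1, by simp, fun h => ?_⟩
    · have hbe : AnalyticOnNhd ℝ (HN.be n) univ := by
        intro t _
        unfold HN.be
        fun_prop
      have hcont : Continuous (fun t => (HN.be n t : ℂ)) := by unfold HN.be; fun_prop
      refine ⟨(fun t => (HN.be n t : ℂ)) ⁻¹' Metric.ball 0 HN.bt, Metric.isOpen_ball.preimage hcont, ?_, ?_⟩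
      · intro t ht
        have := hb1 n t ht
        rw [mem_preimage, mem_ball_zero_iff, Complex.norm_real, Real.norm_eq_abs, abs_of_pos this.1]
        exact this.2
      · intro t ht
        have h1 : AnalyticAt ℝ (fun t => (HN.be n t : ℂ)) t := (Complex.ofRealCLM.analyticAt _).comp (hbe t trivial)
        have h2 : AnalyticAt ℝ z (HN.be n t) := (hz.analyticOnNhd Metric.isOpen_ball _ ht).restrictScalars
        have h3 : AnalyticAt ℝ (fun t => z (HN.be n t)) t := AnalyticAt.fun_comp (g := z) (f := fun t => (HN.be n t : ℂ)) h2 h1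
        have h4 : AnalyticAt ℝ (fun t => HN.az (z (HN.be n t))) t := by
          unfold HN.az
          exact (analyticAt_const.add (analyticAt_const.mul h3)).div analyticAt_const (by norm_num)
        exact ((Complex.reCLM.analyticAt _).comp h4).prod (hbe t trivial)
    · exact zero_ne_one (HN.be_inj (Prod.ext_iff.1 h).2)
  · intro m n hmn
    rw [Set.disjoint_left]
    rintro _ ⟨s, hs, rfl⟩ ⟨t, ht, h⟩
    have h' : HN.be n t = HN.be m s := (Prod.ext_iff.1 h).2
    rcases lt_or_gt_of_ne hmn with h1 | h1
    · exact (HN.be_disj h1 hs ht).ne h'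
    · exact (HN.be_disj h1 ht hs).ne' h'
  · intro n t ht
    exact hA _ (hb1 n t ht).1 (hb1 n t ht).2
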